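/- arXiv:2403.08160 — 6 statements merged into one kernel-verified Lean document; each statement's English description precedes it below -/
import Mathlib

section
/- Fix an integer k ≥ 1. Let z₁,…,z_m be i.i.d. uniform on S^{d-1}(√d), let V be the linear space of restrictions to S^{d-1}(√d) of polynomials in d variables of degree < k, let N = dim V, and let h₁,…,h_N be an orthonormal basis of V in L²(S^{d-1}(√d)) with respect to the uniform probability measure; write h(z) = (h₁(z),…,h_N(z)) ∈ ℝ^N. Then there exists c > 0, depending only on k, such that for all d ≥ 1, m ≥ 1 and t ≥ 0: P(‖(1/m)·Σ_{i=1}^m h(z_i)h(z_i)ᵀ − I_N‖_op ≥ t) ≤ 2N·exp(−c·(m/N)·min{t, t²}). -/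
/-!
Matrix-Bernstein concentration for the Gram matrix of a low-degree orthonormal system
(Lemma "lowdeg_concentration").
-/

open MeasureTheory Filter

noncomputable section

/-- Uniform probability measure on the sphere of radius `r` in `ℝ^d`
(normalized `(d-1)`-dimensional Hausdorff measure). -/
def sphereUniform (d : ℕ) (r : ℝ) : Measure (EuclideanSpace ℝ (Fin d)) :=
  ((Measure.hausdorffMeasure ((d : ℝ) - 1) :
        Measure (EuclideanSpace ℝ (Fin d))) (Metric.sphere 0 r))⁻¹ •
    (Measure.hausdorffMeasure ((d : ℝ) - 1) :
        Measure (EuclideanSpace ℝ (Fin d))).restrict (Metric.sphere 0 r)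

/-- The sphere `S^{d-1}(√d)` as a set. -/
def sphSet (d : ℕ) : Set (EuclideanSpace ℝ (Fin d)) :=
  Metric.sphere (0 : EuclideanSpace ℝ (Fin d)) (Real.sqrt d)

/-- The space `V` of restrictions to `S^{d-1}(√d)` of polynomials of degree `< k`. -/
def polyRestrictions (d k : ℕ) : Submodule ℝ (↥(sphSet d) → ℝ) :=
  Submodule.span ℝ
    {f | ∃ P : MvPolynomial (Fin d) ℝ, P.totalDegree < k ∧
      f = fun x : ↥(sphSet d) => MvPolynomial.eval (fun i => x.val i) P}

/-- `N = dim V`. -/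
def Ndim (d k : ℕ) : ℕ := Module.finrank ℝ (polyRestrictions d k)

/-- `ℓ² → ℓ²` operator norm of a real matrix. -/
def opNorm {n p : ℕ} (A : Matrix (Fin n) (Fin p) ℝ) : ℝ :=
  ‖LinearMap.toContinuousLinearMap (Matrix.toEuclideanLin A)‖

open scoped Matrix Matrix.Norms.Operator
open NormedSpace (exp)

section Duhamel

variable {𝔸 : Type*} [NormedRing 𝔸] [NormedAlgebra ℝ 𝔸] [CompleteSpace 𝔸]

theorem exp_sub_exp_eq_integral (X Y : 𝔸) :
    exp Y - exp X = ∫ u in (0 : ℝ)..1, exp ((1 - u) • X) * (Y - X) * exp (u • Y) := by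
  let _ : NormedAlgebra ℚ 𝔸 := NormedAlgebra.restrictScalars ℚ ℝ 𝔸
  have hc : Continuous (exp : 𝔸 → 𝔸) := NormedSpace.exp_continuous
  have hd : ∀ u : ℝ, HasDerivAt (fun u : ℝ => exp ((1 - u) • X) * exp (u • Y))
      (exp ((1 - u) • X) * (Y - X) * exp (u • Y)) u := by
    intro u
    have h1 : HasDerivAt (fun u : ℝ => exp ((1 - u) • X)) (-(exp ((1 - u) • X) * X)) u := by
      have := (hasDerivAt_exp_smul_const X (1 - u)).scomp u ((hasDerivAt_id u).const_sub 1)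
      simpa [Function.comp_def] using this
    have h2 := hasDerivAt_exp_smul_const' (𝕂 := ℝ) Y u
    refine (h1.mul h2).congr_deriv ?_
    noncomm_ring
  have := intervalIntegral.integral_eq_sub_of_hasDerivAt (fun u _ => hd u)
    (Continuous.intervalIntegrable (by fun_prop) 0 1)
  rw [this]
  simp

theorem hasDerivAt_exp_add_smul (A B : 𝔸) (s : ℝ) :
    HasDerivAt (fun s : ℝ => exp (A + s • B))
      (∫ u in (0 : ℝ)..1, exp ((1 - u) • (A + s • B)) * B * exp (u • (A + s • B))) s := by
  let _ : NormedAlgebra ℚ 𝔸 := NormedAlgebra.restrictScalars ℚ ℝ 𝔸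
  have hc : Continuous (exp : 𝔸 → 𝔸) := NormedSpace.exp_continuous
  rw [hasDerivAt_iff_tendsto_slope]
  have hcont : Continuous fun r : ℝ =>
      ∫ u in (0 : ℝ)..1, exp ((1 - u) • (A + s • B)) * B * exp (u • (A + r • B)) := by
    apply intervalIntegral.continuous_parametric_intervalIntegral_of_continuous'
    simp only [Function.uncurry_def]
    fun_prop
  refine ((hcont.tendsto s).mono_left nhdsWithin_le_nhds).congr' ?_
  filter_upwards [self_mem_nhdsWithin] with r hr
  have hr' : r - s ≠ 0 := sub_ne_zero.mpr hr
  rw [slope_def_module, exp_sub_exp_eq_integral, eq_inv_smul_iff₀ hr',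
    ← intervalIntegral.integral_smul]
  congr 1
  ext u
  rw [show A + r • B - (A + s • B) = (r - s) • B by module]
  simp

theorem hasDerivAt_clm_exp_add_smul (T : 𝔸 →L[ℝ] ℝ) (A B : 𝔸) (s : ℝ) :
    HasDerivAt (fun s : ℝ => T (exp (A + s • B)))
      (∫ u in (0 : ℝ)..1, T (exp ((1 - u) • (A + s • B)) * B * exp (u • (A + s • B)))) s := by
  let _ : NormedAlgebra ℚ 𝔸 := NormedAlgebra.restrictScalars ℚ ℝ 𝔸
  have hc : Continuous (exp : 𝔸 → 𝔸) := NormedSpace.exp_continuous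
  refine (T.hasFDerivAt.comp_hasDerivAt s (hasDerivAt_exp_add_smul A B s)).congr_deriv ?_
  rw [← T.intervalIntegral_comp_comm (Continuous.intervalIntegrable (by fun_prop) 0 1)]

end Duhamel

section MatrixExp

variable {n : Type*} [Fintype n] [DecidableEq n]

theorem exists_exp_smul_eq_of_isSymm {A : Matrix n n ℝ} (hA : A.IsSymm) :
    ∃ (U : Matrix n n ℝ) (l : n → ℝ), U * Uᵀ = 1 ∧ Uᵀ * U = 1 ∧
      A = U * Matrix.diagonal l * Uᵀ ∧
      ∀ s : ℝ, exp (s • A) = U * Matrix.diagonal (fun i => Real.exp (s * l i)) * Uᵀ := by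
  have hA' : A.IsHermitian := by rwa [Matrix.IsHermitian, Matrix.conjTranspose_eq_transpose_of_trivial]
  set U : Matrix n n ℝ := (hA'.eigenvectorUnitary : Matrix n n ℝ)
  have h1 : U * Uᵀ = 1 := by
    have := Unitary.coe_mul_star_self hA'.eigenvectorUnitary
    rwa [Unitary.coe_star, Matrix.star_eq_conjTranspose, Matrix.conjTranspose_eq_transpose_of_trivial] at this
  have h2 : Uᵀ * U = 1 := by
    have := Unitary.coe_star_mul_self hA'.eigenvectorUnitary
    rwa [Matrix.star_eq_conjTranspose, Matrix.conjTranspose_eq_transpose_of_trivial] at this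
  have h3 : A = U * Matrix.diagonal hA'.eigenvalues * Uᵀ := by
    have := hA'.spectral_theorem
    rw [Unitary.conjStarAlgAut_apply, Matrix.star_eq_conjTranspose,
      Matrix.conjTranspose_eq_transpose_of_trivial] at this
    exact this
  refine ⟨U, hA'.eigenvalues, h1, h2, h3, fun s => ?_⟩
  have hinv : U⁻¹ = Uᵀ := Matrix.inv_eq_right_inv h1
  have hu : IsUnit U := ⟨⟨U, Uᵀ, h1, h2⟩, rfl⟩
  have : s • A = U * Matrix.diagonal (fun i => s * hA'.eigenvalues i) * U⁻¹ := by
    rw [hinv]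
    conv_lhs => rw [h3]
    rw [← Matrix.smul_mul, ← Matrix.mul_smul, ← Matrix.diagonal_smul]
    rfl
  rw [this, Matrix.exp_conj _ _ hu, Matrix.exp_diagonal, hinv]
  congr 3
  ext i
  rw [Pi.coe_exp, Real.exp_eq_exp_ℝ]

theorem dotProduct_conj_diagonal (U : Matrix n n ℝ) (l v : n → ℝ) :
    v ⬝ᵥ (U * Matrix.diagonal l * Uᵀ) *ᵥ v = ∑ i, l i * (Uᵀ *ᵥ v) i ^ 2 := by
  rw [← Matrix.mulVec_mulVec, ← Matrix.mulVec_mulVec, Matrix.dotProduct_mulVec,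
    ← Matrix.mulVec_transpose]
  simp only [dotProduct, Matrix.mulVec_diagonal]
  exact Finset.sum_congr rfl fun i _ => by ring

/-- Chebyshev's association inequality for the spectral measure of `C` at `v`. -/
theorem dotProduct_exp_mul_le {C : Matrix n n ℝ} (hC : C.IsSymm) (v : n → ℝ) {u : ℝ}
    (h0 : 0 ≤ u) (h1 : u ≤ 1) :
    (v ⬝ᵥ exp ((1 - u) • C) *ᵥ v) * (v ⬝ᵥ exp (u • C) *ᵥ v) ≤
      (v ⬝ᵥ v) * (v ⬝ᵥ exp C *ᵥ v) := by
  obtain ⟨U, l, hU, -, -, hexp⟩ := exists_exp_smul_eq_of_isSymm hC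
  have hone : v ⬝ᵥ v = ∑ i, (Uᵀ *ᵥ v) i ^ 2 := by
    have := dotProduct_conj_diagonal U (fun _ => 1) v
    rw [show (Matrix.diagonal fun _ : n => (1 : ℝ)) = 1 from Matrix.diagonal_one, mul_one, hU,
      Matrix.one_mulVec] at this
    simpa using this
  have hC1 : exp C = U * Matrix.diagonal (fun i => Real.exp (l i)) * Uᵀ := by
    simpa using hexp 1
  rw [hexp, hexp, hC1, dotProduct_conj_diagonal, dotProduct_conj_diagonal,
    dotProduct_conj_diagonal, hone]
  set w := Uᵀ *ᵥ v
  have key : ∀ i j, Real.exp ((1 - u) * l i) * Real.exp (u * l j) ≤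
      (1 - u) * Real.exp (l i) + u * Real.exp (l j) := by
    intro i j
    rw [← Real.exp_add]
    have := convexOn_exp.2 (Set.mem_univ (l i)) (Set.mem_univ (l j)) (sub_nonneg.2 h1) h0 (by ring)
    simpa using this
  calc _ = ∑ i, ∑ j, (Real.exp ((1 - u) * l i) * Real.exp (u * l j)) * (w i ^ 2 * w j ^ 2) := by
        rw [Finset.sum_mul_sum]
        exact Finset.sum_congr rfl fun i _ => Finset.sum_congr rfl fun j _ => by ring
    _ ≤ ∑ i, ∑ j, ((1 - u) * Real.exp (l i) + u * Real.exp (l j)) * (w i ^ 2 * w j ^ 2) := by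
        gcongr with i _ j _
        exact key i j
    _ = (1 - u) * ∑ i, ∑ j, (w j ^ 2) * (Real.exp (l i) * w i ^ 2)
        + u * ∑ i, ∑ j, (w i ^ 2) * (Real.exp (l j) * w j ^ 2) := by
        simp only [Finset.mul_sum, ← Finset.sum_add_distrib]
        exact Finset.sum_congr rfl fun i _ => Finset.sum_congr rfl fun j _ => by ring
    _ = _ := by
        rw [Finset.sum_comm, ← Finset.sum_mul_sum]
        ring

theorem hasDerivAt_trace_exp_add_smul_vecMulVec (A : Matrix n n ℝ) (v : n → ℝ) (s : ℝ) :
    HasDerivAt (fun s : ℝ => (exp (A + s • Matrix.vecMulVec v v)).trace)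
      (v ⬝ᵥ exp (A + s • Matrix.vecMulVec v v) *ᵥ v) s := by
  have hc : Continuous (exp : Matrix n n ℝ → Matrix n n ℝ) := NormedSpace.exp_continuous
  set T : Matrix n n ℝ →L[ℝ] ℝ := LinearMap.toContinuousLinearMap (Matrix.traceLinearMap n ℝ ℝ)
  refine (hasDerivAt_clm_exp_add_smul T A (Matrix.vecMulVec v v) s).congr_deriv ?_
  set C := A + s • Matrix.vecMulVec v v
  have : ∀ u : ℝ, T (exp ((1 - u) • C) * Matrix.vecMulVec v v * exp (u • C)) =
      v ⬝ᵥ exp C *ᵥ v := by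
    intro u
    change Matrix.trace _ = _
    rw [Matrix.trace_mul_comm, ← mul_assoc, ← Matrix.exp_add_of_commute, ← add_smul,
      Matrix.mul_vecMulVec, Matrix.trace_vecMulVec, dotProduct_comm]
    · simp
    · exact ((Commute.refl C).smul_left _).smul_right _
  exact (intervalIntegral.integral_congr fun u _ => this u).trans (by simp)

theorem hasDerivAt_dotProduct_exp_add_smul_vecMulVec (A : Matrix n n ℝ) (v : n → ℝ) (s : ℝ) :
    HasDerivAt (fun s : ℝ => v ⬝ᵥ exp (A + s • Matrix.vecMulVec v v) *ᵥ v)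
      (∫ u in (0 : ℝ)..1, (v ⬝ᵥ exp ((1 - u) • (A + s • Matrix.vecMulVec v v)) *ᵥ v) *
        (v ⬝ᵥ exp (u • (A + s • Matrix.vecMulVec v v)) *ᵥ v)) s := by
  have hc : Continuous (exp : Matrix n n ℝ → Matrix n n ℝ) := NormedSpace.exp_continuous
  set T : Matrix n n ℝ →L[ℝ] ℝ := LinearMap.toContinuousLinearMap
    { toFun := fun M => v ⬝ᵥ M *ᵥ v
      map_add' := fun M M' => by rw [Matrix.add_mulVec, dotProduct_add]
      map_smul' := fun c M => by rw [Matrix.smul_mulVec, dotProduct_smul]; rfl }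
  refine (hasDerivAt_clm_exp_add_smul T A (Matrix.vecMulVec v v) s).congr_deriv ?_
  congr 1
  ext u
  change v ⬝ᵥ (_ * Matrix.vecMulVec v v * _) *ᵥ v = _
  rw [← Matrix.mulVec_mulVec, Matrix.mul_vecMulVec, Matrix.vecMulVec_mulVec, dotProduct_smul,
    op_smul_eq_mul]
  rfl

theorem trace_exp_add_smul_vecMulVec_le {A : Matrix n n ℝ} (hA : A.IsSymm) {v : n → ℝ} {L : ℝ}
    (hL : 0 < L) (hv : v ⬝ᵥ v = L) (s : ℝ) :
    (exp (A + s • Matrix.vecMulVec v v)).trace ≤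
      (exp A).trace + (Real.exp (s * L) - 1) / L * (v ⬝ᵥ exp A *ᵥ v) := by
  have hc : Continuous (exp : Matrix n n ℝ → Matrix n n ℝ) := NormedSpace.exp_continuous
  set B := Matrix.vecMulVec v v with hB
  have hsymm : ∀ s : ℝ, (A + s • B).IsSymm := fun s =>
    hA.add (Matrix.IsSymm.smul (by rw [hB, Matrix.IsSymm, Matrix.transpose_vecMulVec]) s)
  set g : ℝ → ℝ := fun s => v ⬝ᵥ exp (A + s • B) *ᵥ v with hg
  have hφ := hasDerivAt_trace_exp_add_smul_vecMulVec A v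
  have hgd := hasDerivAt_dotProduct_exp_add_smul_vecMulVec A v
  rw [← hB] at hφ hgd
  have hgle : ∀ s : ℝ, (∫ u in (0 : ℝ)..1, (v ⬝ᵥ exp ((1 - u) • (A + s • B)) *ᵥ v) *
        (v ⬝ᵥ exp (u • (A + s • B)) *ᵥ v)) ≤ L * g s := by
    intro s
    have := intervalIntegral.integral_mono_on (zero_le_one' ℝ)
      (f := fun u => (v ⬝ᵥ exp ((1 - u) • (A + s • B)) *ᵥ v) *
        (v ⬝ᵥ exp (u • (A + s • B)) *ᵥ v)) (g := fun _ => L * g s) (μ := volume)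
      (Continuous.intervalIntegrable (by fun_prop) 0 1)
      (Continuous.intervalIntegrable (by fun_prop) 0 1)
      (fun u hu => by rw [← hv]; exact dotProduct_exp_mul_le (hsymm s) v hu.1 hu.2)
    simpa using this
  have hGd : ∀ s : ℝ, HasDerivAt (fun s => g s * Real.exp (-(s * L)))
      ((∫ u in (0 : ℝ)..1, (v ⬝ᵥ exp ((1 - u) • (A + s • B)) *ᵥ v) *
        (v ⬝ᵥ exp (u • (A + s • B)) *ᵥ v)) * Real.exp (-(s * L)) +
        g s * (Real.exp (-(s * L)) * -L)) s := fun s =>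
    (hgd s).mul (((hasDerivAt_id s).mul_const L).neg.exp.congr_deriv (by simp))
  have hanti : Antitone fun s => g s * Real.exp (-(s * L)) := by
    refine antitone_of_deriv_nonpos (fun s => (hGd s).differentiableAt) fun s => ?_
    rw [(hGd s).deriv]
    nlinarith [hgle s, Real.exp_pos (-(s * L))]
  have hψ : ∀ s : ℝ, HasDerivAt
      (fun s => (exp A).trace + (Real.exp (s * L) - 1) / L * g 0 - (exp (A + s • B)).trace)
      (Real.exp (s * L) * g 0 - g s) s := by
    intro s
    have h1 : HasDerivAt (fun s => (exp A).trace + (Real.exp (s * L) - 1) / L * g 0)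
        (Real.exp (s * L) * g 0) s := by
      have := (((((hasDerivAt_id s).mul_const L).exp.sub_const 1).div_const L).mul_const
        (g 0)).const_add (exp A).trace
      refine this.congr_deriv ?_
      simp only [id]
      field_simp
    exact h1.sub (hφ s)
  have hcmp : ∀ s : ℝ, (Real.exp (s * L) * g 0 - g s) =
      Real.exp (s * L) * (g 0 * Real.exp (-(0 * L)) - g s * Real.exp (-(s * L))) := by
    intro s
    have : Real.exp (s * L) * Real.exp (-(s * L)) = 1 := by rw [← Real.exp_add]; simp
    simp only [zero_mul, neg_zero, Real.exp_zero]
    linear_combination (g s) * this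
  have hcont : Continuous
      (fun s : ℝ => (exp A).trace + (Real.exp (s * L) - 1) / L * g 0 - (exp (A + s • B)).trace) :=
    continuous_iff_continuousAt.2 fun s => (hψ s).continuousAt
  suffices 0 ≤ (exp A).trace + (Real.exp (s * L) - 1) / L * g 0 - (exp (A + s • B)).trace by
    simp only [hg, zero_smul, add_zero] at this
    linarith
  have h0 : (exp A).trace + (Real.exp (0 * L) - 1) / L * g 0 - (exp (A + (0 : ℝ) • B)).trace
      = 0 := by simp
  rcases le_total 0 s with hs | hs
  · have hm := monotoneOn_of_deriv_nonneg (convex_Ici (0 : ℝ)) hcont.continuousOn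
      (fun x _ => (hψ x).differentiableAt.differentiableWithinAt) (fun x hx => by
        rw [interior_Ici] at hx
        rw [(hψ x).deriv, hcmp]
        exact mul_nonneg (Real.exp_pos _).le (sub_nonneg.2 (hanti (le_of_lt hx))))
    have := hm (Set.mem_Ici.2 le_rfl) (Set.mem_Ici.2 hs) hs
    simp only at this
    linarith
  · have hm := antitoneOn_of_deriv_nonpos (convex_Iic (0 : ℝ)) hcont.continuousOn
      (fun x _ => (hψ x).differentiableAt.differentiableWithinAt) (fun x hx => by
        rw [interior_Iic] at hx
        rw [(hψ x).deriv, hcmp]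
        exact mul_nonpos_of_nonneg_of_nonpos (Real.exp_pos _).le
          (sub_nonpos.2 (hanti (le_of_lt hx))))
    have := hm (Set.mem_Iic.2 hs) (Set.mem_Iic.2 le_rfl) hs
    simp only at this
    linarith

end MatrixExp

section TraceMGF

variable {n : Type*} [Fintype n] [DecidableEq n]

theorem trace_conj_diagonal {U : Matrix n n ℝ} (hU : Uᵀ * U = 1) (l : n → ℝ) :
    (U * Matrix.diagonal l * Uᵀ).trace = ∑ i, l i := by
  rw [Matrix.trace_mul_cycle, hU, one_mul, Matrix.trace_diagonal]

theorem trace_exp_nonneg {A : Matrix n n ℝ} (hA : A.IsSymm) : 0 ≤ (exp A).trace := by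
  obtain ⟨U, l, -, hU', -, hexp⟩ := exists_exp_smul_eq_of_isSymm hA
  have := hexp 1
  rw [one_smul] at this
  rw [this, trace_conj_diagonal hU']
  positivity

theorem isSymm_vecMulVec_self {n : Type*} (v : n → ℝ) : (Matrix.vecMulVec v v).IsSymm := by
  rw [Matrix.IsSymm, Matrix.transpose_vecMulVec]

theorem isSymm_sum_vecMulVec_self {n ι : Type*} [Fintype ι] (v : ι → n → ℝ) :
    (∑ i, Matrix.vecMulVec (v i) (v i)).IsSymm := by
  rw [Matrix.IsSymm, Matrix.transpose_sum]
  exact Finset.sum_congr rfl fun i _ => isSymm_vecMulVec_self (v i)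

variable {E : Type*} [MeasurableSpace E] {μ : Measure E} [IsProbabilityMeasure μ]

theorem measurable_trace_exp_add_smul_sum {ι : Type*} [Fintype ι] {h : E → n → ℝ}
    (hm : Measurable h) (A : Matrix n n ℝ) (s : ℝ) :
    Measurable fun z : ι → E =>
      (exp (A + s • ∑ i, Matrix.vecMulVec (h (z i)) (h (z i)))).trace := by
  have hc : Continuous (exp : Matrix n n ℝ → Matrix n n ℝ) := NormedSpace.exp_continuous
  have hF : Measurable fun M : n → n → ℝ => (exp (Matrix.of M)).trace :=
    Continuous.measurable (by fun_prop)
  have hcoord : ∀ a, Measurable fun x => h x a := fun a => (measurable_pi_apply a).comp hm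
  have hG : Measurable fun z : ι → E => fun a b =>
      A a b + s * ∑ i, h (z i) a * h (z i) b := by
    refine measurable_pi_lambda _ fun a => measurable_pi_lambda _ fun b => ?_
    refine measurable_const.add (measurable_const.mul (Finset.measurable_sum _ fun i _ => ?_))
    exact ((hcoord a).comp (measurable_pi_apply i)).mul ((hcoord b).comp (measurable_pi_apply i))
  convert hF.comp hG using 1
  ext z
  simp only [Function.comp]
  congr 2
  ext a b
  simp [Matrix.sum_apply, Matrix.vecMulVec_apply]

theorem integrable_and_integral_dotProduct_mulVec {μ : Measure E} {h : E → n → ℝ}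
    (hint : ∀ a b, Integrable (fun x => h x a * h x b) μ)
    (hI : ∀ a b, ∫ x, h x a * h x b ∂μ = if a = b then 1 else 0) (Q : Matrix n n ℝ) :
    Integrable (fun x => h x ⬝ᵥ Q *ᵥ h x) μ ∧ ∫ x, h x ⬝ᵥ Q *ᵥ h x ∂μ = Q.trace := by
  have hquad : ∀ x, h x ⬝ᵥ Q *ᵥ h x = ∑ a, ∑ b, Q a b * (h x a * h x b) := by
    intro x
    simp only [dotProduct, Matrix.mulVec, Finset.mul_sum]
    exact Finset.sum_congr rfl fun a _ => Finset.sum_congr rfl fun b _ => by ring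
  simp only [hquad]
  refine ⟨integrable_finsetSum _ fun a _ => integrable_finsetSum _ fun b _ =>
    (hint a b).const_mul (Q a b), ?_⟩
  rw [integral_finsetSum _ fun a _ => integrable_finsetSum _ fun b _ => (hint a b).const_mul (Q a b)]
  refine Finset.sum_congr rfl fun a _ => ?_
  rw [integral_finsetSum _ fun b _ => (hint a b).const_mul (Q a b)]
  simp [integral_const_mul, hI]

theorem lintegral_trace_exp_add_vecMulVec_le {h : E → n → ℝ} (hm : Measurable h) {L : ℝ}
    (hL : 0 < L) (hnorm : ∀ᵐ x ∂μ, h x ⬝ᵥ h x = L)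
    (hI : ∀ a b, ∫ x, h x a * h x b ∂μ = if a = b then 1 else 0)
    {A : Matrix n n ℝ} (hA : A.IsSymm) (s : ℝ) {K : ℝ} (hK : 0 ≤ K) :
    ∫⁻ x, ENNReal.ofReal ((exp (A + s • Matrix.vecMulVec (h x) (h x))).trace * K) ∂μ ≤
      ENNReal.ofReal ((exp A).trace * (1 + (Real.exp (s * L) - 1) / L) * K) := by
  have hcoord : ∀ a, Measurable fun x => h x a := fun a => (measurable_pi_apply a).comp hm
  have hint : ∀ a b, Integrable (fun x => h x a * h x b) μ := by
    intro a b
    refine Integrable.of_bound ((hcoord a).mul (hcoord b)).aestronglyMeasurable L ?_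
    filter_upwards [hnorm] with x hx
    have hle : ∀ c, h x c ^ 2 ≤ L := fun c => by
      rw [← hx, pow_two]
      exact Finset.single_le_sum (f := fun c => h x c * h x c)
        (fun c _ => mul_self_nonneg _) (Finset.mem_univ c)
    rw [Real.norm_eq_abs, abs_le]
    constructor <;> nlinarith [hle a, hle b, sq_nonneg (h x a + h x b), sq_nonneg (h x a - h x b)]
  obtain ⟨hquadint, hquadval⟩ := integrable_and_integral_dotProduct_mulVec hint hI (exp A)
  have hle : ∀ᵐ x ∂μ, (exp (A + s • Matrix.vecMulVec (h x) (h x))).trace * K ≤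
      ((exp A).trace + (Real.exp (s * L) - 1) / L * (h x ⬝ᵥ exp A *ᵥ h x)) * K := by
    filter_upwards [hnorm] with x hx
    exact mul_le_mul_of_nonneg_right (trace_exp_add_smul_vecMulVec_le hA hL hx s) hK
  have hfint : Integrable (fun x =>
      ((exp A).trace + (Real.exp (s * L) - 1) / L * (h x ⬝ᵥ exp A *ᵥ h x)) * K) μ :=
    ((integrable_const _).add (hquadint.const_mul _)).mul_const _
  calc _ ≤ ∫⁻ x, ENNReal.ofReal
        (((exp A).trace + (Real.exp (s * L) - 1) / L * (h x ⬝ᵥ exp A *ᵥ h x)) * K) ∂μ :=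
        lintegral_mono_ae (hle.mono fun x hx => ENNReal.ofReal_le_ofReal hx)
    _ = ENNReal.ofReal (∫ x,
        ((exp A).trace + (Real.exp (s * L) - 1) / L * (h x ⬝ᵥ exp A *ᵥ h x)) * K ∂μ) := by
        rw [ofReal_integral_eq_lintegral_ofReal hfint]
        filter_upwards [hle] with x hx
        refine le_trans (mul_nonneg (trace_exp_nonneg ?_) hK) hx
        exact hA.add ((isSymm_vecMulVec_self _).smul s)
    _ = _ := by
        rw [integral_mul_const, integral_add (integrable_const _) (hquadint.const_mul _),
          integral_const_mul, hquadval]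
        rw [integral_const, probReal_univ, one_smul]
        ring_nf

theorem lintegral_trace_exp_add_sum_le {h : E → n → ℝ} (hm : Measurable h) {L : ℝ}
    (hL : 1 ≤ L) (hnorm : ∀ᵐ x ∂μ, h x ⬝ᵥ h x = L)
    (hI : ∀ a b, ∫ x, h x a * h x b ∂μ = if a = b then 1 else 0) (s : ℝ) (m : ℕ)
    {A : Matrix n n ℝ} (hA : A.IsSymm) :
    ∫⁻ z, ENNReal.ofReal (exp (A + s • ∑ i, Matrix.vecMulVec (h (z i)) (h (z i)))).trace
        ∂(Measure.pi fun _ : Fin m => μ) ≤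
      ENNReal.ofReal ((exp A).trace * (1 + (Real.exp (s * L) - 1) / L) ^ m) := by
  have hL0 : 0 < L := by linarith
  have hK : 0 ≤ 1 + (Real.exp (s * L) - 1) / L := by
    have : 1 + (Real.exp (s * L) - 1) / L = (L - 1 + Real.exp (s * L)) / L := by
      field_simp
      ring
    rw [this]
    have := Real.exp_pos (s * L)
    exact div_nonneg (by linarith) hL0.le
  induction m generalizing A with
  | zero => simp
  | succ m ih =>
    have hmp := (measurePreserving_piFinSuccAbove (fun _ : Fin (m + 1) => μ) 0).symm
    have hmeas := (measurable_trace_exp_add_smul_sum (ι := Fin (m + 1)) hm A s).ennreal_ofReal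
    rw [← hmp.lintegral_comp hmeas, lintegral_prod]
    swap
    · exact (hmeas.comp hmp.measurable).aemeasurable
    calc _ ≤ ∫⁻ x, ENNReal.ofReal ((exp (A + s • Matrix.vecMulVec (h x) (h x))).trace *
          (1 + (Real.exp (s * L) - 1) / L) ^ m) ∂μ := by
          refine lintegral_mono fun x => ?_
          refine le_trans (le_of_eq (lintegral_congr fun y => ?_))
            (ih (hA.add ((isSymm_vecMulVec_self (h x)).smul s)))
          rw [Fin.sum_univ_succ, smul_add, add_assoc]
          rfl
      _ ≤ _ := lintegral_trace_exp_add_vecMulVec_le hm hL0 hnorm hI hA s (pow_nonneg hK m)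
      _ = _ := by rw [pow_succ']; ring_nf

end TraceMGF

section Tail

theorem exists_le_abs_of_le_opNorm {N : ℕ} [NeZero N] {U : Matrix (Fin N) (Fin N) ℝ}
    {l : Fin N → ℝ} (hU : U * Uᵀ = 1) (hU' : Uᵀ * U = 1) {t : ℝ}
    (ht : t ≤ opNorm (U * Matrix.diagonal l * Uᵀ)) : ∃ i, t ≤ |l i| := by
  obtain ⟨i, -, hi⟩ := Finset.exists_max_image Finset.univ (fun i => |l i|)
    ⟨(0 : Fin N), Finset.mem_univ _⟩
  refine ⟨i, ht.trans ?_⟩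
  obtain ⟨D, hD⟩ : ∃ D, D = U * Matrix.diagonal l * Uᵀ := ⟨_, rfl⟩
  rw [← hD]
  have hsq : ∀ x : Fin N → ℝ, (D *ᵥ x) ⬝ᵥ (D *ᵥ x) ≤ |l i| ^ 2 * (x ⬝ᵥ x) := by
    intro x
    have hDD : D * D = U * Matrix.diagonal (fun i => l i * l i) * Uᵀ := by
      rw [← Matrix.diagonal_mul_diagonal, hD]
      calc _ = U * Matrix.diagonal l * (Uᵀ * U) * Matrix.diagonal l * Uᵀ := by
            simp only [Matrix.mul_assoc]
        _ = _ := by rw [hU', Matrix.mul_one]; simp only [Matrix.mul_assoc]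
    have hDT : Dᵀ = D := by
      rw [hD]
      simp [Matrix.transpose_mul, Matrix.mul_assoc]
    have h1 : (D *ᵥ x) ⬝ᵥ (D *ᵥ x) = x ⬝ᵥ (D * D) *ᵥ x := by
      rw [← Matrix.mulVec_mulVec, Matrix.dotProduct_mulVec x D, ← Matrix.mulVec_transpose, hDT]
    have h2 : x ⬝ᵥ x = ∑ i, (Uᵀ *ᵥ x) i ^ 2 := by
      have := dotProduct_conj_diagonal U (fun _ => 1) x
      rw [show (Matrix.diagonal fun _ : Fin N => (1 : ℝ)) = 1 from Matrix.diagonal_one, mul_one,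
        hU, Matrix.one_mulVec] at this
      simpa using this
    rw [h1, hDD, dotProduct_conj_diagonal, h2, Finset.mul_sum]
    refine Finset.sum_le_sum fun j _ => mul_le_mul_of_nonneg_right ?_ (sq_nonneg _)
    rw [← abs_mul_abs_self, ← pow_two]
    exact pow_le_pow_left₀ (abs_nonneg _) (hi j (Finset.mem_univ _)) 2
  refine ContinuousLinearMap.opNorm_le_bound _ (abs_nonneg _) fun x => ?_
  refine le_of_sq_le_sq ?_ (by positivity)
  rw [mul_pow, EuclideanSpace.real_norm_sq_eq, EuclideanSpace.real_norm_sq_eq]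
  have := hsq x.ofLp
  simp only [dotProduct, ← pow_two] at this
  exact this

theorem exp_le_trace_exp_or_of_le_opNorm {N : ℕ} [NeZero N] {S : Matrix (Fin N) (Fin N) ℝ}
    (hS : S.IsSymm) {r t : ℝ} (hr : 0 < r) (ht : t ≤ opNorm (r⁻¹ • S - 1)) {σ : ℝ} (hσ : 0 ≤ σ) :
    Real.exp (σ * (r * (1 + t))) ≤ (exp (σ • S)).trace ∨
      Real.exp (-σ * (r * (1 - t))) ≤ (exp (-σ • S)).trace := by
  obtain ⟨U, l, hU, hU', hSU, hexp⟩ := exists_exp_smul_eq_of_isSymm hS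
  have hD : r⁻¹ • S - 1 = U * Matrix.diagonal (fun i => r⁻¹ * l i - 1) * Uᵀ := by
    have : Matrix.diagonal (fun i => r⁻¹ * l i - 1) = r⁻¹ • Matrix.diagonal l - 1 := by
      rw [← Matrix.diagonal_smul, ← Matrix.diagonal_one, ← Matrix.diagonal_sub]
      rfl
    rw [this, Matrix.mul_sub, Matrix.sub_mul, Matrix.mul_one, hU, Matrix.mul_smul,
      Matrix.smul_mul, ← hSU]
  rw [hD] at ht
  obtain ⟨i, hi⟩ := exists_le_abs_of_le_opNorm hU hU' ht
  have htr : ∀ s, (exp (s • S)).trace = ∑ j, Real.exp (s * l j) := fun s => by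
    rw [hexp, trace_conj_diagonal hU']
  have hsingle : ∀ s, Real.exp (s * l i) ≤ (exp (s • S)).trace := fun s => by
    rw [htr]
    exact Finset.single_le_sum (f := fun j => Real.exp (s * l j))
      (fun j _ => (Real.exp_pos _).le) (Finset.mem_univ i)
  have hrl : l i = r * (r⁻¹ * l i) := by field_simp
  rcases le_abs.1 hi with hi | hi
  · left
    refine le_trans (Real.exp_le_exp.2 (mul_le_mul_of_nonneg_left ?_ hσ)) (hsingle σ)
    rw [hrl]
    exact mul_le_mul_of_nonneg_left (by linarith) hr.le
  · right
    refine le_trans (Real.exp_le_exp.2 (mul_le_mul_of_nonpos_left ?_ (by linarith))) (hsingle (-σ))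
    conv_lhs => rw [hrl]
    exact mul_le_mul_of_nonneg_left (by linarith) hr.le

theorem measure_exp_le_trace_exp_le {E : Type*} [MeasurableSpace E] {μ : Measure E}
    [IsProbabilityMeasure μ] {N : ℕ} [NeZero N] {h : E → Fin N → ℝ} (hm : Measurable h)
    (hnorm : ∀ᵐ x ∂μ, h x ⬝ᵥ h x = N)
    (hI : ∀ a b, ∫ x, h x a * h x b ∂μ = if a = b then 1 else 0) (m : ℕ) (s c : ℝ) :
    (Measure.pi fun _ : Fin m => μ)
        {z | Real.exp c ≤ (exp (s • ∑ i, Matrix.vecMulVec (h (z i)) (h (z i)))).trace} ≤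
      ENNReal.ofReal (N * Real.exp (m * ((Real.exp (s * N) - 1) / N) - c)) := by
  have hN : (1 : ℝ) ≤ N := by exact_mod_cast NeZero.one_le
  have hmeas := measurable_trace_exp_add_smul_sum (ι := Fin m) hm 0 s
  have hmgf := lintegral_trace_exp_add_sum_le hm hN hnorm hI s m (A := 0) (by simp [Matrix.IsSymm])
  simp only [zero_add] at hmeas hmgf
  have hK : (1 + (Real.exp (s * N) - 1) / N) ^ m ≤
      Real.exp (m * ((Real.exp (s * N) - 1) / N)) := by
    rw [Real.exp_nat_mul]
    refine pow_le_pow_left₀ ?_ (by rw [add_comm]; exact Real.add_one_le_exp _) m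
    have h1 : -1 ≤ (Real.exp (s * N) - 1) / N := by
      rw [le_div_iff₀ (by linarith)]
      linarith [Real.exp_pos (s * N)]
    linarith
  calc _ ≤ (Measure.pi fun _ : Fin m => μ) {z | ENNReal.ofReal (Real.exp c) ≤
        ENNReal.ofReal (exp (s • ∑ i, Matrix.vecMulVec (h (z i)) (h (z i)))).trace} :=
        measure_mono fun z hz => ENNReal.ofReal_le_ofReal hz
    _ ≤ _ := meas_ge_le_lintegral_div hmeas.ennreal_ofReal.aemeasurable
        (by simp [Real.exp_pos]) ENNReal.ofReal_ne_top
    _ ≤ ENNReal.ofReal (N * Real.exp (m * ((Real.exp (s * N) - 1) / N))) /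
        ENNReal.ofReal (Real.exp c) := by
        refine ENNReal.div_le_div_right (hmgf.trans (ENNReal.ofReal_le_ofReal ?_)) _
        rw [NormedSpace.exp_zero, Matrix.trace_one, Fintype.card_fin]
        gcongr
    _ = _ := by
        rw [← ENNReal.ofReal_div_of_pos (Real.exp_pos c), Real.exp_sub, mul_div_assoc]

theorem exp_sub_one_sub_mul_le {t θ : ℝ} (hθ : |θ| = min 1 t / 2) :
    Real.exp θ - 1 - θ - |θ| * t ≤ -(1 / 4) * min t (t ^ 2) := by
  have h1 : |θ| ≤ 1 := by rw [hθ]; linarith [min_le_left (1 : ℝ) t]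
  have h2 : Real.exp θ - 1 - θ ≤ |θ| ^ 2 := by
    rw [sq_abs]
    exact (le_abs_self _).trans (Real.abs_exp_sub_one_sub_id_le h1)
  rw [hθ] at *
  rcases le_total 1 t with h | h
  · rw [min_eq_left h] at *
    nlinarith [min_le_left t (t ^ 2)]
  · rw [min_eq_right h] at *
    nlinarith [min_le_right t (t ^ 2)]

theorem measure_le_opNorm_gram_sub_one_le {E : Type*} [MeasurableSpace E] {μ : Measure E}
    [IsProbabilityMeasure μ] {N : ℕ} [NeZero N] {h : E → Fin N → ℝ} (hm : Measurable h)
    (hnorm : ∀ᵐ x ∂μ, h x ⬝ᵥ h x = N)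
    (hI : ∀ a b, ∫ x, h x a * h x b ∂μ = if a = b then 1 else 0) {m : ℕ} (hm1 : 1 ≤ m)
    {t : ℝ} (ht : 0 ≤ t) :
    (Measure.pi fun _ : Fin m => μ)
        {z | t ≤ opNorm ((m : ℝ)⁻¹ • ∑ i, Matrix.vecMulVec (h (z i)) (h (z i)) - 1)} ≤
      ENNReal.ofReal (2 * N * Real.exp (-(1 / 4) * (m / N) * min t (t ^ 2))) := by
  have hN : (0 : ℝ) < N := by exact_mod_cast Nat.pos_of_neZero N
  have hmpos : (0 : ℝ) < m := by exact_mod_cast hm1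
  set θ : ℝ := min 1 t / 2 with hθ
  have hθ0 : 0 ≤ θ := by positivity
  have hbound : ∀ η : ℝ, |η| = θ →
      m * ((Real.exp (η / N * N) - 1) / N) - (η / N * m + θ / N * m * t) ≤
        -(1 / 4) * (m / N) * min t (t ^ 2) := by
    intro η hη
    have := exp_sub_one_sub_mul_le hη
    rw [hη] at this
    rw [div_mul_cancel₀ _ hN.ne']
    calc _ = (m / N) * (Real.exp η - 1 - η - θ * t) := by field_simp; ring
      _ ≤ (m / N) * (-(1 / 4) * min t (t ^ 2)) := by gcongr
      _ = _ := by ring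
  have hone : ∀ η : ℝ, |η| = θ → (Measure.pi fun _ : Fin m => μ)
        {z | Real.exp (η / N * m + θ / N * m * t) ≤
          (exp ((η / N) • ∑ i, Matrix.vecMulVec (h (z i)) (h (z i)))).trace} ≤
      ENNReal.ofReal (N * Real.exp (-(1 / 4) * (m / N) * min t (t ^ 2))) := fun η hη =>
    (measure_exp_le_trace_exp_le hm hnorm hI m (η / N) _).trans <| ENNReal.ofReal_le_ofReal <|
      mul_le_mul_of_nonneg_left (Real.exp_le_exp.2 (hbound η hη)) hN.le
  refine le_trans (measure_mono ?_) ((measure_union_le _ _).trans ((add_le_add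
    (hone θ (abs_of_nonneg hθ0)) (hone (-θ) (by rw [abs_neg, abs_of_nonneg hθ0]))).trans
      (le_of_eq ?_)))
  · intro z hz
    refine (exp_le_trace_exp_or_of_le_opNorm (isSymm_sum_vecMulVec_self fun i => h (z i)) hmpos hz
      (div_nonneg hθ0 hN.le)).imp (fun H => ?_) fun H => ?_
    · refine le_trans (le_of_eq ?_) H
      congr 1
      ring
    · rw [← neg_div] at H
      refine le_trans (le_of_eq ?_) H
      congr 1
      ring
  · rw [← ENNReal.ofReal_add (by positivity) (by positivity)]
    congr 1
    ring

end Tail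

section Sphere

theorem totalDegree_aeval_le {σ τ : Type*} {f : σ → MvPolynomial τ ℝ}
    (hf : ∀ i, (f i).totalDegree ≤ 1) (P : MvPolynomial σ ℝ) :
    (MvPolynomial.aeval f P).totalDegree ≤ P.totalDegree := by
  rw [MvPolynomial.aeval_def, MvPolynomial.eval₂_eq]
  refine MvPolynomial.totalDegree_finsetSum_le fun s hs => ?_
  refine (MvPolynomial.totalDegree_mul _ _).trans ?_
  rw [MvPolynomial.algebraMap_eq, MvPolynomial.totalDegree_C, zero_add]
  refine (MvPolynomial.totalDegree_finsetProd _ _).trans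
    (le_trans (Finset.sum_le_sum fun i _ => ?_) (MvPolynomial.le_totalDegree hs))
  exact (MvPolynomial.totalDegree_pow _ _).trans (by simpa using Nat.mul_le_mul_left (s i) (hf i))

theorem exists_eval_comp_linear {d : ℕ}
    (R : EuclideanSpace ℝ (Fin d) →ₗ[ℝ] EuclideanSpace ℝ (Fin d)) (P : MvPolynomial (Fin d) ℝ) :
    ∃ Q : MvPolynomial (Fin d) ℝ, Q.totalDegree ≤ P.totalDegree ∧
      ∀ x : EuclideanSpace ℝ (Fin d), MvPolynomial.eval (fun i => R x i) P =
        MvPolynomial.eval (fun i => x i) Q := by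
  set f : Fin d → MvPolynomial (Fin d) ℝ := fun i =>
    ∑ j, MvPolynomial.C (R (EuclideanSpace.single j 1) i) * MvPolynomial.X j with hf
  refine ⟨MvPolynomial.aeval f P, totalDegree_aeval_le (fun i => ?_) P, fun x => ?_⟩
  · refine MvPolynomial.totalDegree_finsetSum_le fun j _ => ?_
    refine (MvPolynomial.totalDegree_mul _ _).trans ?_
    rw [MvPolynomial.totalDegree_C, MvPolynomial.totalDegree_X]
  · have hx : ∀ i, R x i = MvPolynomial.eval (fun i => x i) (f i) := by
      intro i
      have h1 : x = ∑ j, x j • EuclideanSpace.single j (1 : ℝ) := by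
        ext a
        simp [Pi.single_apply]
      conv_lhs => rw [h1, map_sum]
      simp [hf, mul_comm]
    simp only [hx]
    rw [MvPolynomial.map_aeval, show (MvPolynomial.eval fun i => x i).comp
      (algebraMap ℝ (MvPolynomial (Fin d) ℝ)) = RingHom.id ℝ by ext; simp]
    rfl

theorem measurePreserving_sphereUniform {d : ℕ} (r : ℝ)
    (R : EuclideanSpace ℝ (Fin d) ≃ₗᵢ[ℝ] EuclideanSpace ℝ (Fin d)) :
    MeasurePreserving R (sphereUniform d r) (sphereUniform d r) := by
  have h1 := (R.toIsometryEquiv.measurePreserving_hausdorffMeasure ((d : ℝ) - 1)).restrict_preimage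
    (s := Metric.sphere 0 r) Metric.isClosed_sphere.measurableSet
  have h2 : R.toIsometryEquiv ⁻¹' Metric.sphere 0 r = Metric.sphere 0 r := by
    ext x
    simp
  rw [h2] at h1
  exact h1.smul_measure _

theorem ae_mem_sphere (d : ℕ) (r : ℝ) :
    ∀ᵐ x ∂sphereUniform d r, x ∈ Metric.sphere (0 : EuclideanSpace ℝ (Fin d)) r :=
  Measure.ae_smul_measure (ae_restrict_mem Metric.isClosed_sphere.measurableSet) _

theorem sphereUniform_eq_zero_or_isProbabilityMeasure (d : ℕ) (r : ℝ) :
    sphereUniform d r = 0 ∨ IsProbabilityMeasure (sphereUniform d r) := by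
  set H := (Measure.hausdorffMeasure ((d : ℝ) - 1) : Measure (EuclideanSpace ℝ (Fin d))) with hH
  by_cases h0 : H (Metric.sphere 0 r) = 0
  · left
    rw [sphereUniform, ← hH, Measure.restrict_eq_zero.2 h0, smul_zero]
  by_cases h1 : H (Metric.sphere 0 r) = ⊤
  · left
    rw [sphereUniform, ← hH, h1, ENNReal.inv_top, zero_smul]
  · right
    constructor
    rw [sphereUniform, ← hH, Measure.smul_apply, Measure.restrict_apply_univ, smul_eq_mul,
      ENNReal.inv_mul_cancel h0 h1]

theorem exists_linearIsometryEquiv_apply_eq {F : Type*} [NormedAddCommGroup F]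
    [InnerProductSpace ℝ F] {x y : F} (h : ‖x‖ = ‖y‖) : ∃ R : F ≃ₗᵢ[ℝ] F, R x = y :=
  ⟨_, Submodule.reflection_sub h⟩

theorem polyRestrictions_eq_map (d k : ℕ) (hk : 1 ≤ k) :
    polyRestrictions d k = (MvPolynomial.restrictTotalDegree (Fin d) ℝ (k - 1)).map
      (LinearMap.pi fun x : ↥(sphSet d) =>
        (MvPolynomial.aeval (R := ℝ) fun i => x.val i).toLinearMap) := by
  refine le_antisymm (Submodule.span_le.2 ?_) ?_
  · rintro f ⟨P, hP, rfl⟩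
    refine ⟨P, (MvPolynomial.mem_restrictTotalDegree _ _ _).2 (by omega), ?_⟩
    ext x
    simp [MvPolynomial.aeval_eq_eval]
  · rintro f ⟨P, hP, rfl⟩
    have := (MvPolynomial.mem_restrictTotalDegree _ _ _).1 hP
    refine Submodule.subset_span ⟨P, by omega, ?_⟩
    ext x
    simp [MvPolynomial.aeval_eq_eval]

theorem finiteDimensional_polyRestrictions (d k : ℕ) (hk : 1 ≤ k) :
    FiniteDimensional ℝ (polyRestrictions d k) := by
  rw [polyRestrictions_eq_map d k hk]
  infer_instance

theorem Ndim_pos {d k : ℕ} (hd : 1 ≤ d) (hk : 1 ≤ k) : 0 < Ndim d k := by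
  have := finiteDimensional_polyRestrictions d k hk
  have : NeZero d := ⟨by omega⟩
  have hx : EuclideanSpace.single (0 : Fin d) (Real.sqrt d) ∈ sphSet d := by
    simp [sphSet, abs_of_nonneg]
  have : Nontrivial (polyRestrictions d k) := by
    refine ⟨⟨⟨fun _ => 1, Submodule.subset_span ⟨1, ?_, ?_⟩⟩, 0, fun h => ?_⟩⟩
    · rw [MvPolynomial.totalDegree_one]
      omega
    · simp
    · have := congrFun (congrArg Subtype.val h) ⟨_, hx⟩
      simp at this
  exact Module.finrank_pos

variable {d k : ℕ} {h : Fin (Ndim d k) → EuclideanSpace ℝ (Fin d) → ℝ}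

theorem exists_eq_sum_of_orthonormal (hk : 1 ≤ k) [IsProbabilityMeasure (sphereUniform d √d)]
    (hint : ∀ a b, Integrable (fun x => h a x * h b x) (sphereUniform d √d))
    (hP : ∀ a, ∃ P : MvPolynomial (Fin d) ℝ, P.totalDegree < k ∧
      h a = fun x => MvPolynomial.eval (fun i => x i) P)
    (hI : ∀ a b, (∫ x, h a x * h b x ∂sphereUniform d √d) = if a = b then 1 else 0)
    (Q : MvPolynomial (Fin d) ℝ) (hQ : Q.totalDegree < k) :
    ∃ c : Fin (Ndim d k) → ℝ, ∀ x ∈ Metric.sphere (0 : EuclideanSpace ℝ (Fin d)) √d,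
      MvPolynomial.eval (fun i => x i) Q = ∑ a, c a * h a x := by
  have := finiteDimensional_polyRestrictions d k hk
  let hr : Fin (Ndim d k) → polyRestrictions d k := fun a =>
    ⟨fun x => h a x.val, by
      obtain ⟨P, hPd, hPe⟩ := hP a
      exact Submodule.subset_span ⟨P, hPd, by rw [hPe]⟩⟩
  have hli : LinearIndependent ℝ hr := by
    rw [Fintype.linearIndependent_iff]
    intro c hc b
    have hz : ∀ x ∈ Metric.sphere (0 : EuclideanSpace ℝ (Fin d)) √d, ∑ a, c a * h a x = 0 := by
      intro x hx
      have := congrFun (congrArg Subtype.val hc) ⟨x, hx⟩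
      simpa [hr] using this
    have h1 : ∫ x, ∑ a, c a * (h a x * h b x) ∂sphereUniform d √d = c b := by
      rw [integral_finsetSum _ fun a _ => (hint a b).const_mul (c a)]
      simp [integral_const_mul, hI]
    rw [← h1]
    refine integral_eq_zero_of_ae ?_
    filter_upwards [ae_mem_sphere d √d] with x hx
    simp only [← mul_assoc, ← Finset.sum_mul, hz x hx, zero_mul, Pi.zero_apply]
  have hspan := hli.span_eq_top_of_card_eq_finrank' (Fintype.card_fin _)
  have hmem : (⟨fun x => MvPolynomial.eval (fun i => x.val i) Q,
      Submodule.subset_span ⟨Q, hQ, rfl⟩⟩ : polyRestrictions d k) ∈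
      Submodule.span ℝ (Set.range hr) := by
    rw [hspan]
    trivial
  obtain ⟨c, hc⟩ := (Submodule.mem_span_range_iff_exists_fun ℝ).1 hmem
  refine ⟨c, fun x hx => ?_⟩
  have := congrFun (congrArg Subtype.val hc) ⟨x, hx⟩
  simpa [hr] using this.symm

theorem sum_sq_eq_Ndim_of_orthonormal (hk : 1 ≤ k) [IsProbabilityMeasure (sphereUniform d √d)]
    (hint : ∀ a b, Integrable (fun x => h a x * h b x) (sphereUniform d √d))
    (hP : ∀ a, ∃ P : MvPolynomial (Fin d) ℝ, P.totalDegree < k ∧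
      h a = fun x => MvPolynomial.eval (fun i => x i) P)
    (hI : ∀ a b, (∫ x, h a x * h b x ∂sphereUniform d √d) = if a = b then 1 else 0)
    {y : EuclideanSpace ℝ (Fin d)} (hy : y ∈ Metric.sphere (0 : EuclideanSpace ℝ (Fin d)) √d) :
    ∑ a, h a y * h a y = Ndim d k := by
  have hinv : ∀ (R : EuclideanSpace ℝ (Fin d) ≃ₗᵢ[ℝ] EuclideanSpace ℝ (Fin d)),
      ∀ x ∈ Metric.sphere (0 : EuclideanSpace ℝ (Fin d)) √d,
        ∑ a, h a (R x) * h a (R x) = ∑ a, h a x * h a x := by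
    intro R
    have hex : ∀ a, ∃ c : Fin (Ndim d k) → ℝ,
        ∀ x ∈ Metric.sphere (0 : EuclideanSpace ℝ (Fin d)) √d, h a (R x) = ∑ b, c b * h b x := by
      intro a
      obtain ⟨P, hPd, hPe⟩ := hP a
      obtain ⟨Q, hQd, hQe⟩ := exists_eval_comp_linear R.toLinearEquiv.toLinearMap P
      obtain ⟨c, hc⟩ := exists_eq_sum_of_orthonormal hk hint hP hI Q (hQd.trans_lt hPd)
      refine ⟨c, fun x hx => ?_⟩
      rw [hPe, ← hc x hx, ← hQe]
      rfl
    choose c hc using hex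
    set C : Matrix (Fin (Ndim d k)) (Fin (Ndim d k)) ℝ := Matrix.of c with hC
    have hmul : ∀ x ∈ Metric.sphere (0 : EuclideanSpace ℝ (Fin d)) √d,
        (fun a => h a (R x)) = C *ᵥ fun b => h b x := fun x hx => funext fun a => hc a x hx
    have hCC : C * Cᵀ = 1 := by
      ext a a'
      have h1 : ∫ x, h a (R x) * h a' (R x) ∂sphereUniform d √d = if a = a' then 1 else 0 := by
        rw [← hI a a']
        exact (measurePreserving_sphereUniform √d R).integral_comp
          R.toHomeomorph.measurableEmbedding (fun x => h a x * h a' x)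
      have h2 : ∫ x, h a (R x) * h a' (R x) ∂sphereUniform d √d =
          ∫ x, ∑ b, ∑ b', (c a b * c a' b') * (h b x * h b' x) ∂sphereUniform d √d := by
        refine integral_congr_ae ?_
        filter_upwards [ae_mem_sphere d √d] with x hx
        rw [hc a x hx, hc a' x hx, Finset.sum_mul_sum]
        exact Finset.sum_congr rfl fun b _ => Finset.sum_congr rfl fun b' _ => by ring
      rw [h1, integral_finsetSum _ fun b _ => integrable_finsetSum _ fun b' _ =>
        (hint b b').const_mul (c a b * c a' b')] at h2
      rw [Matrix.one_apply, h2, Matrix.mul_apply]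
      refine Finset.sum_congr rfl fun b _ => ?_
      rw [integral_finsetSum _ fun b' _ => (hint b b').const_mul (c a b * c a' b')]
      simp [integral_const_mul, hI, hC]
    have hCC' : Cᵀ * C = 1 := mul_eq_one_comm.1 hCC
    intro x hx
    change (fun a => h a (R x)) ⬝ᵥ (fun a => h a (R x)) = (fun a => h a x) ⬝ᵥ (fun a => h a x)
    rw [hmul x hx, Matrix.dotProduct_mulVec, ← Matrix.mulVec_transpose, Matrix.mulVec_mulVec, hCC',
      Matrix.one_mulVec]
  have hconst : ∫ x, ∑ a, h a x * h a x ∂sphereUniform d √d = ∑ a, h a y * h a y := by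
    have : ∀ᵐ x ∂sphereUniform d √d, ∑ a, h a x * h a x = ∑ a, h a y * h a y := by
      filter_upwards [ae_mem_sphere d √d] with x hx
      obtain ⟨R, rfl⟩ := exists_linearIsometryEquiv_apply_eq (x := x) (y := y)
        (by rw [mem_sphere_zero_iff_norm.1 hx, mem_sphere_zero_iff_norm.1 hy])
      exact (hinv R x hx).symm
    rw [integral_congr_ae this]
    simp
  rw [← hconst, integral_finsetSum _ fun a _ => hint a a]
  simp [hI]

end Sphere

/-- Let `z₁, …, z_m` be i.i.d. uniform on `S^{d-1}(√d)` and `h₁, …, h_N` an orthonormal basis of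
the restrictions to the sphere of polynomials of degree `< k`.  Then there is `c > 0`, depending
only on `k`, such that for all `d, m ≥ 1` and `t ≥ 0`,
`P(‖(1/m) ∑ᵢ h(zᵢ) h(zᵢ)ᵀ − I_N‖_op ≥ t) ≤ 2 N exp(−c (m/N) min{t, t²})`. -/
theorem low_degree_design_matrix_concentration (k : ℕ) (hk : 1 ≤ k) :
    ∃ c : ℝ, 0 < c ∧ ∀ d m : ℕ, 1 ≤ d → 1 ≤ m → ∀ t : ℝ, 0 ≤ t →
      ∀ h : Fin (Ndim d k) → EuclideanSpace ℝ (Fin d) → ℝ,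
        (∀ a, ∃ P : MvPolynomial (Fin d) ℝ, P.totalDegree < k ∧
          h a = fun x => MvPolynomial.eval (fun i => x i) P) →
        (∀ a b, (∫ x, h a x * h b x ∂sphereUniform d (Real.sqrt d)) =
          if a = b then 1 else 0) →
        (Measure.pi fun _ : Fin m => sphereUniform d (Real.sqrt d))
            {z | t ≤ opNorm (Matrix.of (fun a b : Fin (Ndim d k) =>
              (m : ℝ)⁻¹ * ∑ i, h a (z i) * h b (z i)) - 1)} ≤
          ENNReal.ofReal (2 * (Ndim d k) *
            Real.exp (-c * ((m : ℝ) / (Ndim d k)) * min t (t ^ 2))) := by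
  refine ⟨1 / 4, by norm_num, fun d m hd hm t ht h hP hI => ?_⟩
  have : NeZero (Ndim d k) := ⟨(Ndim_pos hd hk).ne'⟩
  have : IsProbabilityMeasure (sphereUniform d √d) := by
    refine (sphereUniform_eq_zero_or_isProbabilityMeasure d √d).resolve_left fun h0 => ?_
    have := hI 0 0
    simp [h0] at this
  have hcont : ∀ a, Continuous (h a) := by
    intro a
    obtain ⟨P, -, hPe⟩ := hP a
    rw [hPe]
    exact (MvPolynomial.continuous_eval P).comp (PiLp.continuous_ofLp 2 _)
  have hint : ∀ a b, Integrable (fun x => h a x * h b x) (sphereUniform d √d) := by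
    intro a b
    have hab : Continuous fun x => h a x * h b x := (hcont a).mul (hcont b)
    obtain ⟨B, hB⟩ := (isCompact_sphere (0 : EuclideanSpace ℝ (Fin d))
      √d).exists_bound_of_continuousOn hab.continuousOn
    refine Integrable.of_bound hab.aestronglyMeasurable B ?_
    filter_upwards [ae_mem_sphere d √d] with x hx using hB x hx
  have hmain := measure_le_opNorm_gram_sub_one_le (μ := sphereUniform d √d)
    (h := fun x a => h a x) (measurable_pi_lambda _ fun a => (hcont a).measurable)
    (by filter_upwards [ae_mem_sphere d √d] with x hx using
      sum_sq_eq_Ndim_of_orthonormal hk hint hP hI hx) hI hm ht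
  convert hmain using 6 with z
  ext a b
  simp [Matrix.sum_apply, Matrix.vecMulVec_apply]

end
end

section
/- Assume σ satisfies |σ(x)| ≤ C₀(1+|x|)^{C₀}, μ_k(σ) ≠ 0 for every k = 0,…,ℓ, and μ_{>ℓ}(σ)² > 0, where ℓ = ⌈min(κ₁,κ₂)⌉; fix λ > 0. Let σ_{<ℓ} denote the orthogonal projection in L²(τ_{d,1}) of σ onto the subspace of polynomials of degree < ℓ, and let U_{<ℓ} ∈ ℝ^{p×p} have entries (U_{<ℓ})_{ij} = (1/p)·E_{x∼Unif(S^{d-1}(√d))}[σ_{<ℓ}(⟨x, w_i⟩)·σ_{<ℓ}(⟨x, w_j⟩)]. Then E_{X,W}|Tr(Z·R·U_{<ℓ}·R·Zᵀ)| = o(1) as d → ∞. -/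
/-!
Vanishing of the low-degree variance trace term `E|Tr(Z R U_{<ℓ} R Zᵀ)| = o(1)`
(Proposition "tech_bounds_ell", Eq. (low_f_b4)).
-/

open MeasureTheory Filter

noncomputable section

/-- Euclidean inner product. -/
def dotp {d : ℕ} (u v : EuclideanSpace ℝ (Fin d)) : ℝ := ∑ i, u i * v i

/-- `τ_{d,1}`: distribution of `⟨x, e⟩` for `x` uniform on `S^{d-1}(√d)` and `e` a unit vector. -/
def tau1 (d : ℕ) : Measure ℝ :=
  (sphereUniform d (Real.sqrt d)).map fun x => if h : 0 < d then x ⟨0, h⟩ else 0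

/-- Law of `n` i.i.d. uniform points on the sphere of radius `√d`. -/
def Xmeas (d n : ℕ) : Measure (Fin n → EuclideanSpace ℝ (Fin d)) :=
  Measure.pi fun _ => sphereUniform d (Real.sqrt d)

/-- Law of `p` i.i.d. uniform points on the unit sphere. -/
def Wmeas (d p : ℕ) : Measure (Fin p → EuclideanSpace ℝ (Fin d)) :=
  Measure.pi fun _ => sphereUniform d 1

/-- Joint law of the (independent) covariates and weights. -/
def XWmeas (d n p : ℕ) :
    Measure ((Fin n → EuclideanSpace ℝ (Fin d)) × (Fin p → EuclideanSpace ℝ (Fin d))) :=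
  (Xmeas d n).prod (Wmeas d p)

/-- Entrywise application `σ(X Wᵀ)`. -/
def entrywise (d n p : ℕ) (f : ℝ → ℝ) (x : Fin n → EuclideanSpace ℝ (Fin d))
    (w : Fin p → EuclideanSpace ℝ (Fin d)) : Matrix (Fin n) (Fin p) ℝ :=
  Matrix.of fun i j => f (dotp (x i) (w j))

/-- Standard Gaussian measure on `ℝ`. -/
def stdGaussian : Measure ℝ := ProbabilityTheory.gaussianReal 0 1

/-- Degree-`k` probabilists' Hermite polynomial, normalized in `L²` of the Gaussian. -/
def hermiteL2 (k : ℕ) (s : ℝ) : ℝ :=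
  Polynomial.aeval s (Polynomial.hermite k) / Real.sqrt (Nat.factorial k)

/-- `μ_k(σ) = E[σ(G) He_k(G)]`. -/
def hermiteCoeff (σ : ℝ → ℝ) (k : ℕ) : ℝ := ∫ g, σ g * hermiteL2 k g ∂stdGaussian

/-- `μ_{>ℓ}(σ)² = E[σ(G)²] − ∑_{k=0}^{ℓ} μ_k(σ)²`. -/
def muGtSq (σ : ℝ → ℝ) (l : ℕ) : ℝ :=
  (∫ g, σ g ^ 2 ∂stdGaussian) - ∑ k ∈ Finset.range (l + 1), hermiteCoeff σ k ^ 2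

/-- The random features matrix `Z = σ(XWᵀ)/√p`. -/
def Zmat (d n p : ℕ) (σ : ℝ → ℝ) (x : Fin n → EuclideanSpace ℝ (Fin d))
    (w : Fin p → EuclideanSpace ℝ (Fin d)) : Matrix (Fin n) (Fin p) ℝ :=
  (Real.sqrt p)⁻¹ • entrywise d n p σ x w

/-- The resolvent `R = (ZᵀZ + λ I_p)⁻¹`. -/
def Rmat (d n p : ℕ) (σ : ℝ → ℝ) (lam : ℝ) (x : Fin n → EuclideanSpace ℝ (Fin d))
    (w : Fin p → EuclideanSpace ℝ (Fin d)) : Matrix (Fin p) (Fin p) ℝ :=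
  ((Zmat d n p σ x w).transpose * Zmat d n p σ x w +
    lam • (1 : Matrix (Fin p) (Fin p) ℝ))⁻¹

/-- `U_{<ℓ}`: the matrix with entries `(1/p) E_x[σ_{<ℓ}(⟨x,w_i⟩) σ_{<ℓ}(⟨x,w_j⟩)]`, where
`σ_{<ℓ}` is represented by a polynomial `P` of degree `< ℓ`. -/
def UmatLow (d p : ℕ) (P : Polynomial ℝ) (w : Fin p → EuclideanSpace ℝ (Fin d)) :
    Matrix (Fin p) (Fin p) ℝ :=
  Matrix.of fun i j => (p : ℝ)⁻¹ *
    ∫ x, P.eval (dotp x (w i)) * P.eval (dotp x (w j)) ∂sphereUniform d (Real.sqrt d)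

/-- A probability measure carried by the sphere of radius `r` about the origin and invariant
under linear isometries. -/
structure IsSphereLaw {E : Type*} [NormedAddCommGroup E] [InnerProductSpace ℝ E]
    [MeasurableSpace E] (r : ℝ) (μ : Measure E) : Prop where
  isProbabilityMeasure : IsProbabilityMeasure μ
  norm_eq : ∀ᵐ x ∂μ, ‖x‖ = r
  map_eq : ∀ L : E ≃ₗᵢ[ℝ] E, μ.map L = μ

section SphereLaw

open scoped RealInnerProductSpace

variable {E : Type*} [NormedAddCommGroup E] [InnerProductSpace ℝ E]

theorem exists_linearIsometryEquiv_apply_eq_s12 {u v : E} (h : ‖u‖ = ‖v‖) :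
    ∃ L : E ≃ₗᵢ[ℝ] E, L u = v ∧ ∀ w, ⟪w, u⟫ = 0 → ⟪w, v⟫ = 0 → L w = w := by
  refine ⟨(ℝ ∙ (u - v))ᗮ.reflection, Submodule.reflection_sub h, fun w hu hv => ?_⟩
  apply Submodule.reflection_mem_subspace_eq_self
  rw [Submodule.mem_orthogonal_singleton_iff_inner_left, inner_sub_right, hu, hv, sub_zero]

variable [MeasurableSpace E] {r : ℝ} {μ : Measure E}

namespace IsSphereLaw

theorem integrable_of_bound (hμ : IsSphereLaw r μ) {f : E → ℝ} (hf : AEStronglyMeasurable f μ)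
    (C : ℝ) (hC : ∀ x, ‖x‖ = r → |f x| ≤ C) : Integrable f μ := by
  have := hμ.isProbabilityMeasure
  refine Integrable.of_bound hf C ?_
  filter_upwards [hμ.norm_eq] with x hx using hC x hx

variable [BorelSpace E]

theorem integral_comp (hμ : IsSphereLaw r μ) (L : E ≃ₗᵢ[ℝ] E) (f : E → ℝ) :
    ∫ x, f (L x) ∂μ = ∫ x, f x ∂μ := by
  have h := integral_map_equiv (μ := μ) L.toHomeomorph.toMeasurableEquiv f
  have h2 : Measure.map L.toHomeomorph.toMeasurableEquiv μ = μ := hμ.map_eq L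
  rw [h2] at h
  exact h.symm

theorem integral_comp_inner (hμ : IsSphereLaw r μ) {u v : E} (h : ‖u‖ = ‖v‖) (f : ℝ → ℝ) :
    ∫ x, f ⟪x, u⟫ ∂μ = ∫ x, f ⟪x, v⟫ ∂μ := by
  obtain ⟨L, hL, -⟩ := exists_linearIsometryEquiv_apply_eq_s12 h
  rw [← hμ.integral_comp L (fun x => f ⟪x, v⟫), ← hL]
  simp

theorem measure_inner_mem (hμ : IsSphereLaw r μ) {u v : E} (h : ‖u‖ = ‖v‖) {N : Set ℝ}
    (hN : MeasurableSet N) :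
    μ {x | ⟪x, u⟫ ∈ N} = μ {x | ⟪x, v⟫ ∈ N} := by
  obtain ⟨L, hL, -⟩ := exists_linearIsometryEquiv_apply_eq_s12 h
  have hm : MeasurableSet {x : E | ⟪x, v⟫ ∈ N} :=
    (show Continuous fun x : E => ⟪x, v⟫ by fun_prop).measurable hN
  conv_rhs => rw [← hμ.map_eq L, Measure.map_apply L.continuous.measurable hm]
  simp [← hL]

theorem integral_inner_pow_odd (hμ : IsSphereLaw r μ) (v : E) {i : ℕ} (hi : Odd i) :
    ∫ x, ⟪x, v⟫ ^ i ∂μ = 0 := by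
  have h := hμ.integral_comp (LinearIsometryEquiv.neg ℝ) (fun x => ⟪x, v⟫ ^ i)
  simp only [LinearIsometryEquiv.coe_neg, inner_neg_left, hi.neg_pow, integral_neg] at h
  linarith

end IsSphereLaw

variable [BorelSpace E] [FiniteDimensional ℝ E]

theorem volume_inner_div_norm_mem_eq_zero (hd : 2 ≤ Module.finrank ℝ E) {e : E}
    (he : ‖e‖ = 1) {N : Set ℝ} (hN : volume N = 0) (ν : Measure E) [ν.IsAddHaarMeasure] :
    ν {g : E | ⟪e, g⟫ / ‖g‖ ∈ N} = 0 := by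
  have hee : ⟪e, e⟫ = 1 := by rw [real_inner_self_eq_norm_sq, he, one_pow]
  have hspan : ν ((ℝ ∙ e : Submodule ℝ E) : Set E) = 0 := by
    apply Measure.addHaar_submodule
    intro h
    have h1 := finrank_span_singleton (K := ℝ) (v := e) (by rintro rfl; simp at he)
    rw [h, finrank_top] at h1
    omega
  set B : Set E := {y | ⟪e, y⟫ ∈ N ∧ 0 < 1 - ⟪e, y⟫ ^ 2 ∧ y - ⟪e, y⟫ • e ≠ 0} with hB
  have hBnull : ν B = 0 := by
    obtain ⟨c, -, hc⟩ := LinearMap.exists_map_addHaar_eq_smul_addHaar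
      ((innerSL ℝ e : E →L[ℝ] ℝ) : E →ₗ[ℝ] ℝ) ν volume (fun t => ⟨t • e, by simp [he]⟩)
    obtain ⟨N', hNN', hN'm, hN'0⟩ := exists_measurable_superset_of_null hN
    refine measure_mono_null (t := (fun y => ⟪e, y⟫) ⁻¹' N') (fun y hy => hNN' hy.1) ?_
    have h2 := congrArg (fun m => m N') hc
    simp only [Measure.smul_apply, hN'0, smul_zero] at h2
    rw [Measure.map_apply (by exact (innerSL ℝ e).continuous.measurable) hN'm] at h2
    exact h2
  set Ψ : E → E := fun y => (y - ⟪e, y⟫ • e) +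
    (⟪e, y⟫ / √(1 - ⟪e, y⟫ ^ 2) * ‖y - ⟪e, y⟫ • e‖) • e with hΨ
  have hdiff : DifferentiableOn ℝ Ψ B := by
    intro y hy
    apply DifferentiableAt.differentiableWithinAt
    have h1 : DifferentiableAt ℝ (fun y : E => ⟪e, y⟫) y :=
      (innerSL ℝ e).differentiableAt
    have h2 : DifferentiableAt ℝ (fun y : E => y - ⟪e, y⟫ • e) y := by fun_prop
    refine h2.add (DifferentiableAt.smul_const (DifferentiableAt.mul ?_ (h2.norm ℝ hy.2.2)) e)
    have h3 : DifferentiableAt ℝ (fun y : E => √(1 - ⟪e, y⟫ ^ 2)) y :=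
      DifferentiableAt.sqrt (by fun_prop) hy.2.1.ne'
    simp only [div_eq_mul_inv]
    exact h1.mul (h3.inv (Real.sqrt_pos.2 hy.2.1).ne')
  have himage := addHaar_image_eq_zero_of_differentiableOn_of_addHaar_eq_zero ν hdiff hBnull
  refine measure_mono_null (fun g hg => ?_) (measure_union_null hspan himage)
  by_cases hgs : g ∈ (ℝ ∙ e : Submodule ℝ E)
  · exact Or.inl hgs
  right
  have hperp : g - ⟪e, g⟫ • e ≠ 0 := fun h =>
    hgs (Submodule.mem_span_singleton.2 ⟨⟪e, g⟫, (sub_eq_zero.1 h).symm⟩)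
  have hg0 : 0 < ‖g‖ := norm_pos_iff.2 (by rintro rfl; simp at hgs)
  have hsq : ‖g - ⟪e, g⟫ • e‖ ^ 2 = ‖g‖ ^ 2 - ⟪e, g⟫ ^ 2 := by
    rw [← real_inner_self_eq_norm_sq, inner_sub_left, inner_sub_right, inner_sub_right]
    simp only [inner_smul_left, inner_smul_right, hee, real_inner_comm e g]
    rw [real_inner_self_eq_norm_sq]
    simp; ring
  have hpos : 0 < ‖g - ⟪e, g⟫ • e‖ := norm_pos_iff.2 hperp
  set s := ⟪e, g⟫ / ‖g‖ with hs
  have hs2 : 1 - s ^ 2 = (‖g - ⟪e, g⟫ • e‖ / ‖g‖) ^ 2 := by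
    rw [hs, div_pow, div_pow, hsq]; field_simp
  have hsy : ⟪e, g - ⟪e, g⟫ • e + s • e⟫ = s := by
    rw [inner_add_right, inner_sub_right, inner_smul_right, inner_smul_right, hee]; ring
  have hyp : g - ⟪e, g⟫ • e + s • e - s • e = g - ⟪e, g⟫ • e := by abel
  refine ⟨g - ⟪e, g⟫ • e + s • e, ⟨?_, ?_, ?_⟩, ?_⟩
  · rw [hsy]; exact hg
  · rw [hsy, hs2]; positivity
  · rw [hsy, hyp]; exact hperp
  · simp only [hΨ]
    rw [hsy, hyp, hs2, Real.sqrt_sq (by positivity)]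
    have : s / (‖g - ⟪e, g⟫ • e‖ / ‖g‖) * ‖g - ⟪e, g⟫ • e‖ = ⟪e, g⟫ := by
      rw [hs]; field_simp
    rw [this]; abel

/-- One-dimensional marginals of a rotation-invariant law on a sphere of dimension at least one
are absolutely continuous. -/
theorem IsSphereLaw.measure_inner_mem_eq_zero (hμ : IsSphereLaw r μ) (hr : 0 < r)
    (hd : 2 ≤ Module.finrank ℝ E) {y : E} (hy : y ≠ 0) {N : Set ℝ} (hN : volume N = 0) :
    μ {x | ⟪x, y⟫ ∈ N} = 0 := by
  have := hμ.isProbabilityMeasure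
  obtain ⟨N', hNN', hN'm, hN'0⟩ := exists_measurable_superset_of_null hN
  refine measure_mono_null (t := {x | ⟪x, y⟫ ∈ N'}) (fun x hx => hNN' hx) ?_
  set M : Set ℝ := {s | ‖y‖ * s ∈ N'} with hM
  have hMm : MeasurableSet M := (measurable_const_mul ‖y‖) hN'm
  have hy0 : ‖y‖ ≠ 0 := norm_ne_zero_iff.2 hy
  have scale : ∀ c : ℝ, c ≠ 0 → volume {s : ℝ | c * s ∈ N'} = 0 := fun c hc => by
    have := Real.volume_preimage_mul_left hc N'
    rw [hN'0, mul_zero] at this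
    exact this
  have hvol : ∀ᵐ x ∂μ, ∀ᵐ g ∂(Measure.addHaar : Measure E), ⟪x, g⟫ / ‖g‖ ∉ M := by
    filter_upwards [hμ.norm_eq] with x hx
    have he : ‖r⁻¹ • x‖ = 1 := by
      rw [norm_smul, hx, norm_inv, Real.norm_of_nonneg hr.le, inv_mul_cancel₀ hr.ne']
    have h := volume_inner_div_norm_mem_eq_zero hd he
      (scale (‖y‖ * r) (mul_ne_zero hy0 hr.ne')) (Measure.addHaar : Measure E)
    rw [ae_iff]
    refine measure_mono_null (fun g hg => ?_) h
    simp only [not_not, hM, Set.mem_ofPred_eq] at hg ⊢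
    convert hg using 1
    rw [real_inner_smul_left]
    field_simp
  rw [Measure.ae_ae_comm] at hvol
  · have hne : ∀ᵐ g ∂(Measure.addHaar : Measure E), g ≠ 0 := by
      have : Nontrivial E := Module.nontrivial_of_finrank_pos (R := ℝ) (by omega)
      rw [ae_iff]
      simp
    obtain ⟨g, hg, hg0⟩ := (hvol.and hne).exists
    have hg1 : ‖g‖ ≠ 0 := norm_ne_zero_iff.2 hg0
    rw [hμ.measure_inner_mem (v := (‖y‖ / ‖g‖) • g) _ hN'm]
    · rw [ae_iff] at hg
      refine measure_mono_null (fun x hx => ?_) hg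
      simp only [not_not, hM, Set.mem_ofPred_eq] at hx ⊢
      convert hx using 1
      rw [inner_smul_right]; ring
    · rw [norm_smul, norm_div, norm_norm, norm_norm, div_mul_cancel₀ _ hg1]
  · have : Measurable fun q : E × E => ⟪q.1, q.2⟫ / ‖q.2‖ := by fun_prop
    exact (this hMm).compl

end SphereLaw

namespace IsSphereLaw

open scoped RealInnerProductSpace

variable {E : Type*} [NormedAddCommGroup E] [InnerProductSpace ℝ E]
  [MeasurableSpace E] [BorelSpace E] {r : ℝ} {μ : Measure E}

theorem integral_inner_pow (hμ : IsSphereLaw r μ) {w : E} (hw : ‖w‖ = 1) (y : E) (i : ℕ) :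
    ∫ x, ⟪x, y⟫ ^ i ∂μ = ‖y‖ ^ i * ∫ x, ⟪x, w⟫ ^ i ∂μ := by
  rw [hμ.integral_comp_inner (v := ‖y‖ • w) (by rw [norm_smul, hw, norm_norm, mul_one])
    (fun s => s ^ i), ← integral_const_mul]
  simp_rw [inner_smul_right, mul_pow]

variable [FiniteDimensional ℝ E]

theorem integral_norm_perp_pow_pos (hμ : IsSphereLaw r μ) (hr : 0 < r)
    (hd : 2 ≤ Module.finrank ℝ E) (w : E) (hw : ‖w‖ = 1) (i : ℕ) :
    0 < ∫ u, ‖u - ⟪u, w⟫ • w‖ ^ i ∂μ := by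
  have := hμ.isProbabilityMeasure
  obtain ⟨e, he, he0⟩ : ∃ e ∈ (ℝ ∙ w)ᗮ, e ≠ 0 := by
    rw [← Submodule.ne_bot_iff, ne_eq, Submodule.orthogonal_eq_bot_iff]
    intro h
    have h1 := finrank_span_singleton (K := ℝ) (v := w) (by rintro rfl; simp at hw)
    rw [h, finrank_top] at h1
    omega
  rw [Submodule.mem_orthogonal_singleton_iff_inner_right] at he
  have hpos : ∀ᵐ u ∂μ, 0 < ‖u - ⟪u, w⟫ • w‖ ^ i := by
    have h0 : ∀ᵐ u ∂μ, ⟪u, e⟫ ≠ 0 := by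
      rw [ae_iff]
      simpa using hμ.measure_inner_mem_eq_zero hr hd he0 (N := {0}) (by simp)
    filter_upwards [h0] with u hu
    refine pow_pos (norm_pos_iff.2 fun h => hu ?_) i
    rw [sub_eq_zero.1 h, inner_smul_left, he, mul_zero]
  have hint : Integrable (fun u => ‖u - ⟪u, w⟫ • w‖ ^ i) μ := by
    refine hμ.integrable_of_bound
      (by fun_prop) ((r + r) ^ i) fun x hx => ?_
    rw [abs_of_nonneg (by positivity)]
    refine pow_le_pow_left₀ (norm_nonneg _) ((norm_sub_le _ _).trans ?_) i
    rw [norm_smul, hw, mul_one, hx]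
    gcongr
    simpa [hx, hw] using norm_inner_le_norm (𝕜 := ℝ) x w
  refine lt_of_le_of_ne (integral_nonneg fun u => by positivity) fun h => ?_
  have h0 := (integral_eq_zero_iff_of_nonneg (fun u => by positivity) hint).1 h.symm
  obtain ⟨u, h1, h2⟩ := (hpos.and h0).exists
  exact h1.ne' h2

/-- If `F` is orthogonal to the powers of `r² - s²` of degree `i` under the marginal of a sphere
law in direction `w`, it remains orthogonal to degree `i` powers of coordinates transverse
to `w`. -/
theorem integral_mul_inner_pow_perp_eq_zero (hμ : IsSphereLaw r μ) (hr : 0 < r)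
    (hd : 2 ≤ Module.finrank ℝ E) {w : E} (hw : ‖w‖ = 1) {F : ℝ → ℝ} (hF : Measurable F)
    {C : ℝ} (hC : ∀ s, |s| ≤ r → |F s| ≤ C) (i : ℕ)
    (h0 : ∀ h, i = h + h → ∫ x, F ⟪x, w⟫ * (r ^ 2 - ⟪x, w⟫ ^ 2) ^ h ∂μ = 0)
    {z : E} (hz : ⟪w, z⟫ = 0) : ∫ x, F ⟪x, w⟫ * ⟪x, z⟫ ^ i ∂μ = 0 := by
  have := hμ.isProbabilityMeasure
  have hww : ⟪w, w⟫ = 1 := by rw [real_inner_self_eq_norm_sq, hw, one_pow]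
  have hperp : ∀ u : E, ⟪w, u - ⟪u, w⟫ • w⟫ = 0 := fun u => by
    rw [inner_sub_right, inner_smul_right, hww, real_inner_comm]; ring
  have hhom : ∀ (c : ℝ) (y : E), ∫ x, F ⟪x, w⟫ * ⟪x, c • y⟫ ^ i ∂μ =
      c ^ i * ∫ x, F ⟪x, w⟫ * ⟪x, y⟫ ^ i ∂μ := fun c y => by
    rw [← integral_const_mul]
    simp_rw [inner_smul_right, mul_pow]
    congr 1; ext x; ring
  have hrot : ∀ y y' : E, ‖y‖ = ‖y'‖ → ⟪w, y⟫ = 0 → ⟪w, y'⟫ = 0 →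
      ∫ x, F ⟪x, w⟫ * ⟪x, y⟫ ^ i ∂μ = ∫ x, F ⟪x, w⟫ * ⟪x, y'⟫ ^ i ∂μ := by
    intro y y' hyy hy hy'
    obtain ⟨L, hL, hLw⟩ := exists_linearIsometryEquiv_apply_eq_s12 hyy
    rw [← hμ.integral_comp L (fun x => F ⟪x, w⟫ * ⟪x, y'⟫ ^ i), ← hL]
    have : ∀ x, ⟪L x, w⟫ = ⟪x, w⟫ := fun x => by
      conv_lhs => rw [← hLw w hy hy', L.inner_map_map]
    simp [this]
  have hprop : ∀ u : E, ‖z‖ ^ i * ∫ x, F ⟪x, w⟫ * ⟪x, u - ⟪u, w⟫ • w⟫ ^ i ∂μ =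
      ‖u - ⟪u, w⟫ • w‖ ^ i * ∫ x, F ⟪x, w⟫ * ⟪x, z⟫ ^ i ∂μ := fun u => by
    rw [← hhom, ← hhom]
    refine hrot _ _ ?_ ?_ ?_
    · simp only [norm_smul, norm_norm]; ring
    · rw [inner_smul_right, hperp, mul_zero]
    · rw [inner_smul_right, hz, mul_zero]
  have hsymm : ∀ x u : E, ⟪x, u - ⟪u, w⟫ • w⟫ = ⟪u, x - ⟪x, w⟫ • w⟫ := fun x u => by
    rw [inner_sub_right, inner_sub_right, inner_smul_right, inner_smul_right,
      real_inner_comm x u]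
    ring
  have hbound : ∀ x : E, ‖x‖ = r → |⟪x, w⟫| ≤ r := fun x hx => by
    simpa [hx, hw] using norm_inner_le_norm (𝕜 := ℝ) x w
  have hint : Integrable (Function.uncurry fun u x : E =>
      F ⟪x, w⟫ * ⟪x, u - ⟪u, w⟫ • w⟫ ^ i) (μ.prod μ) := by
    refine Integrable.of_bound (by unfold Function.uncurry; fun_prop) (C * (r * (r + r)) ^ i) ?_
    have h1 := (Measure.quasiMeasurePreserving_fst (μ := μ) (ν := μ)).ae hμ.norm_eq
    have h2 := (Measure.quasiMeasurePreserving_snd (μ := μ) (ν := μ)).ae hμ.norm_eq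
    filter_upwards [h1, h2] with q hq1 hq2
    simp only [Function.uncurry, Real.norm_eq_abs, abs_mul, abs_pow]
    have hF2 := hC _ (hbound _ hq2)
    refine mul_le_mul hF2 (pow_le_pow_left₀ (abs_nonneg _) ?_ i) (by positivity)
      ((abs_nonneg _).trans hF2)
    refine (abs_real_inner_le_norm _ _).trans ?_
    rw [hq2]
    gcongr
    refine (norm_sub_le _ _).trans ?_
    rw [norm_smul, hw, mul_one, hq1]
    gcongr
    exact hbound _ hq1
  have hzero : ∫ u, ∫ x, F ⟪x, w⟫ * ⟪x, u - ⟪u, w⟫ • w⟫ ^ i ∂μ ∂μ = 0 := by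
    rw [integral_integral_swap hint]
    have hin : ∀ x : E, ∫ u, F ⟪x, w⟫ * ⟪x, u - ⟪u, w⟫ • w⟫ ^ i ∂μ =
        F ⟪x, w⟫ * (‖x - ⟪x, w⟫ • w‖ ^ i * ∫ u, ⟪u, w⟫ ^ i ∂μ) := fun x => by
      rw [integral_const_mul, ← hμ.integral_inner_pow hw]
      simp_rw [hsymm x]
    simp_rw [hin]
    rcases Nat.even_or_odd i with ⟨h, hi⟩ | hi
    · have : ∀ᵐ x ∂μ, F ⟪x, w⟫ * (‖x - ⟪x, w⟫ • w‖ ^ i * ∫ u, ⟪u, w⟫ ^ i ∂μ) =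
          (F ⟪x, w⟫ * (r ^ 2 - ⟪x, w⟫ ^ 2) ^ h) * ∫ u, ⟪u, w⟫ ^ i ∂μ := by
        filter_upwards [hμ.norm_eq] with x hx
        have : ‖x - ⟪x, w⟫ • w‖ ^ 2 = r ^ 2 - ⟪x, w⟫ ^ 2 := by
          rw [← real_inner_self_eq_norm_sq, inner_sub_left, real_inner_smul_left, hperp,
            inner_sub_right, inner_smul_right, real_inner_self_eq_norm_sq, hx]
          ring
        rw [hi, ← two_mul, pow_mul, this]
        ring
      rw [integral_congr_ae this, integral_mul_const, h0 h hi, zero_mul]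
    · simp [hμ.integral_inner_pow_odd w hi]
  have h1 : ‖z‖ ^ i * ∫ u, ∫ x, F ⟪x, w⟫ * ⟪x, u - ⟪u, w⟫ • w⟫ ^ i ∂μ ∂μ =
      (∫ u, ‖u - ⟪u, w⟫ • w‖ ^ i ∂μ) * ∫ x, F ⟪x, w⟫ * ⟪x, z⟫ ^ i ∂μ := by
    rw [← integral_const_mul, ← integral_mul_const]
    simp_rw [hprop]
  rw [hzero, mul_zero, eq_comm, mul_eq_zero] at h1
  exact h1.resolve_left (hμ.integral_norm_perp_pow_pos hr hd w hw i).ne'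

/-- A zonal function orthogonal to the zonal polynomials of degree at most `m` about its own pole
is orthogonal to those about every pole. -/
theorem integral_mul_inner_pow_eq_zero (hμ : IsSphereLaw r μ) (hr : 0 < r)
    (hd : 2 ≤ Module.finrank ℝ E) {w : E} (hw : ‖w‖ = 1) {f : ℝ → ℝ} (hf : Measurable f)
    {C : ℝ} (hC : ∀ s, |s| ≤ r → |f s| ≤ C) {m : ℕ}
    (h0 : ∀ j ≤ m, ∫ x, f ⟪x, w⟫ * ⟪x, w⟫ ^ j ∂μ = 0) (u : E) {j : ℕ} (hj : j ≤ m) :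
    ∫ x, f ⟪x, w⟫ * ⟪x, u⟫ ^ j ∂μ = 0 := by
  have hww : ⟪w, w⟫ = 1 := by rw [real_inner_self_eq_norm_sq, hw, one_pow]
  have hbound : ∀ x : E, ‖x‖ = r → |⟪x, w⟫| ≤ r := fun x hx => by
    simpa [hx, hw] using norm_inner_le_norm (𝕜 := ℝ) x w
  have hint : ∀ (k i : ℕ) (y : E),
      Integrable (fun x => f ⟪x, w⟫ * ⟪x, w⟫ ^ k * ⟪x, y⟫ ^ i) μ := by
    intro k i y
    refine hμ.integrable_of_bound (by fun_prop) (C * r ^ k * (r * ‖y‖) ^ i) fun x hx => ?_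
    have hF2 := hC _ (hbound x hx)
    have hC0 := (abs_nonneg _).trans hF2
    rw [abs_mul, abs_mul, abs_pow, abs_pow]
    gcongr
    · exact hbound x hx
    · simpa [hx] using abs_real_inner_le_norm x y
  have hpoly : ∀ Q : Polynomial ℝ, Q.natDegree ≤ m →
      ∫ x, f ⟪x, w⟫ * Q.eval ⟪x, w⟫ ∂μ = 0 := by
    intro Q hQ
    have : ∀ x : E, f ⟪x, w⟫ * Q.eval ⟪x, w⟫ = ∑ k ∈ Finset.range (m + 1),
        Q.coeff k * (f ⟪x, w⟫ * ⟪x, w⟫ ^ k) := fun x => by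
      rw [Polynomial.eval_eq_sum_range' (Nat.lt_succ_of_le hQ), Finset.mul_sum]
      exact Finset.sum_congr rfl fun k _ => by ring
    simp_rw [this]
    rw [integral_finsetSum]
    · refine Finset.sum_eq_zero fun k hk => ?_
      rw [integral_const_mul, h0 k (Nat.lt_succ_iff.1 (Finset.mem_range.1 hk)), mul_zero]
    · intro k _
      simpa using (hint k 0 w).const_mul (Q.coeff k)
  have hz : ⟪w, u - ⟪u, w⟫ • w⟫ = 0 := by
    rw [inner_sub_right, inner_smul_right, hww, real_inner_comm]; ring
  have hexp : ∀ x : E, f ⟪x, w⟫ * ⟪x, u⟫ ^ j = ∑ k ∈ Finset.range (j + 1),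
      (⟪u, w⟫ ^ k * (j.choose k : ℝ)) *
        (f ⟪x, w⟫ * ⟪x, w⟫ ^ k * ⟪x, u - ⟪u, w⟫ • w⟫ ^ (j - k)) := fun x => by
    have : ⟪x, u⟫ = ⟪u, w⟫ * ⟪x, w⟫ + ⟪x, u - ⟪u, w⟫ • w⟫ := by
      rw [inner_sub_right, inner_smul_right]; ring
    conv_lhs => rw [this, add_pow, Finset.mul_sum]
    exact Finset.sum_congr rfl fun k _ => by ring
  simp_rw [hexp]
  rw [integral_finsetSum _ fun k _ => (hint k (j - k) _).const_mul _]
  refine Finset.sum_eq_zero fun k hk => ?_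
  have hkj : k ≤ j := Nat.lt_succ_iff.1 (Finset.mem_range.1 hk)
  rw [integral_const_mul]
  refine mul_eq_zero_of_right _ ?_
  refine hμ.integral_mul_inner_pow_perp_eq_zero hr hd hw (F := fun s => f s * s ^ k)
    (by fun_prop) (C := C * r ^ k) (fun s hs => ?_) (j - k) (fun h hh => ?_) hz
  · have hF2 := hC s hs
    have hC0 := (abs_nonneg _).trans hF2
    rw [abs_mul, abs_pow]
    gcongr
  · rw [← hpoly (Polynomial.X ^ k * (Polynomial.C (r ^ 2) - Polynomial.X ^ 2) ^ h)]
    · congr 1; ext x; simp; ring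
    · refine Polynomial.natDegree_mul_le.trans ?_
      have h1 : (Polynomial.C (r ^ 2) - Polynomial.X ^ 2 : Polynomial ℝ).natDegree ≤ 2 := by
        compute_degree
      have h2 := Polynomial.natDegree_pow_le_of_le h h1
      rw [Polynomial.natDegree_X_pow]
      omega

end IsSphereLaw

section Moments

open scoped RealInnerProductSpace

theorem IsSphereLaw.integral_exp_inner_le {d : ℕ} {ν : Measure (EuclideanSpace ℝ (Fin d))}
    (hν : IsSphereLaw 1 ν) {x : EuclideanSpace ℝ (Fin d)} (hx : ‖x‖ = √d) :
    ∫ w, Real.exp ⟪w, x⟫ ∂ν ≤ Real.exp (1 / 2) := by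
  have := hν.isProbabilityMeasure
  set T : Finset (Fin d → ℝ) := Fintype.piFinset fun _ => {1, -1} with hT
  have hcard : (T.card : ℝ) = 2 ^ d := by
    rw [hT, Fintype.card_piFinset]
    have : ({1, -1} : Finset ℝ).card = 2 := Finset.card_pair (by norm_num)
    simp [this]
  have hint : ∀ y : EuclideanSpace ℝ (Fin d), Integrable (fun w => Real.exp ⟪w, y⟫) ν :=
    fun y => hν.integrable_of_bound (by fun_prop) (Real.exp ‖y‖) fun w hw => by
      rw [abs_of_pos (Real.exp_pos _), Real.exp_le_exp]
      simpa [hw] using real_inner_le_norm w y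
  have hnorm : ∀ ε ∈ T, ‖x‖ = ‖(WithLp.toLp 2 ε : EuclideanSpace ℝ (Fin d))‖ := by
    intro ε hε
    rw [hx, EuclideanSpace.norm_eq]
    congr 1
    have : ∀ i, ‖ε i‖ ^ 2 = 1 := fun i => by
      have := Fintype.mem_piFinset.1 hε i
      simp only [Finset.mem_insert, Finset.mem_singleton] at this
      rcases this with h | h <;> simp [h]
    simp only [this]; simp
  have hsum : 2 ^ d * ∫ w, Real.exp ⟪w, x⟫ ∂ν =
      ∫ w, ∑ ε ∈ T, Real.exp ⟪w, (WithLp.toLp 2 ε : EuclideanSpace ℝ (Fin d))⟫ ∂ν := by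
    rw [integral_finsetSum _ fun ε _ => hint _,
      Finset.sum_congr rfl fun ε hε => (hν.integral_comp_inner (hnorm ε hε) Real.exp).symm,
      Finset.sum_const, nsmul_eq_mul, hcard]
  have hle : ∫ w, ∑ ε ∈ T, Real.exp ⟪w, (WithLp.toLp 2 ε : EuclideanSpace ℝ (Fin d))⟫ ∂ν ≤
      ∫ _w, 2 ^ d * Real.exp (1 / 2) ∂ν := by
    refine integral_mono_ae (integrable_finsetSum _ fun ε _ => hint _)
      (integrable_const _) ?_
    filter_upwards [hν.norm_eq] with w hw
    have h1 : ∀ ε : Fin d → ℝ, Real.exp ⟪w, (WithLp.toLp 2 ε : EuclideanSpace ℝ (Fin d))⟫ =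
        ∏ i, Real.exp (w i * ε i) := fun ε => by
      rw [PiLp.inner_apply, Real.exp_sum]
      simp [mul_comm]
    simp_rw [h1]
    rw [hT, ← Finset.prod_univ_sum (fun _ : Fin d => ({1, -1} : Finset ℝ))
      (fun i s => Real.exp (w i * s))]
    have h2 : ∀ i, ∑ s ∈ ({1, -1} : Finset ℝ), Real.exp (w i * s) ≤
        2 * Real.exp (w i ^ 2 / 2) := fun i => by
      rw [Finset.sum_pair (by norm_num)]
      have := Real.cosh_le_exp_half_sq (w i)
      rw [Real.cosh_eq] at this
      simp only [mul_one, mul_neg]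
      linarith
    refine (Finset.prod_le_prod (fun i _ => Finset.sum_nonneg fun s _ => (Real.exp_pos _).le)
      fun i _ => h2 i).trans_eq ?_
    rw [Finset.prod_mul_distrib, ← Real.exp_sum, ← Finset.sum_div]
    have h3 : ∑ i, w i ^ 2 = 1 := by
      have := EuclideanSpace.real_norm_sq_eq w
      rw [hw] at this
      linarith
    simp [h3]
  rw [← hsum, integral_const] at hle
  simp only [probReal_univ, one_smul] at hle
  exact le_of_mul_le_mul_left hle (by positivity)

/-- A function of polynomial growth has second moments bounded uniformly in the dimension under
the one-dimensional marginals of sphere laws. -/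
theorem exists_lintegral_sq_inner_le {σ : ℝ → ℝ} {C₀ : ℝ} (hC₀ : 0 < C₀)
    (hgrow : ∀ s, |σ s| ≤ C₀ * (1 + |s|) ^ C₀) :
    ∃ K : ℝ, 0 ≤ K ∧ ∀ (d : ℕ) (ν : Measure (EuclideanSpace ℝ (Fin d))), IsSphereLaw 1 ν →
      ∀ x : EuclideanSpace ℝ (Fin d), ‖x‖ = √d →
        ∫⁻ w, ENNReal.ofReal (σ ⟪x, w⟫ ^ 2) ∂ν ≤ ENNReal.ofReal K := by
  set k := ⌈2 * C₀⌉₊ with hk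
  set A := C₀ ^ 2 * (k.factorial * Real.exp 1) with hA
  have hA0 : 0 ≤ A := by positivity
  have hpt : ∀ s, σ s ^ 2 ≤ A * (Real.exp s + Real.exp (-s)) := fun s => by
    have h1 : (1 + |s|) ^ (2 * C₀) ≤ k.factorial * Real.exp (1 + |s|) := by
      have h0 : 1 ≤ 1 + |s| := by linarith [abs_nonneg s]
      have := Real.pow_div_factorial_le_exp (1 + |s|) (by linarith) k
      rw [div_le_iff₀ (by positivity)] at this
      refine (Real.rpow_le_rpow_of_exponent_le h0 (Nat.le_ceil (2 * C₀))).trans ?_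
      rw [Real.rpow_natCast]
      linarith
    have h2 : Real.exp |s| ≤ Real.exp s + Real.exp (-s) := by
      rcases abs_choice s with h | h <;> rw [h] <;>
        linarith [Real.exp_pos s, Real.exp_pos (-s)]
    calc σ s ^ 2 = |σ s| ^ 2 := (sq_abs _).symm
      _ ≤ (C₀ * (1 + |s|) ^ C₀) ^ 2 := pow_le_pow_left₀ (abs_nonneg _) (hgrow s) 2
      _ = C₀ ^ 2 * (1 + |s|) ^ (2 * C₀) := by
        rw [mul_pow, mul_comm 2 C₀, Real.rpow_mul (by positivity)]
        norm_cast
      _ ≤ C₀ ^ 2 * (k.factorial * (Real.exp 1 * (Real.exp s + Real.exp (-s)))) := by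
        refine mul_le_mul_of_nonneg_left (h1.trans ?_) (by positivity)
        rw [Real.exp_add]
        gcongr
      _ = _ := by rw [hA]; ring
  refine ⟨A * (Real.exp (1 / 2) + Real.exp (1 / 2)), by positivity, fun d ν hν x hx => ?_⟩
  have := hν.isProbabilityMeasure
  have hint : ∀ y : EuclideanSpace ℝ (Fin d), Integrable (fun w => Real.exp ⟪w, y⟫) ν :=
    fun y => hν.integrable_of_bound (by fun_prop) (Real.exp ‖y‖) fun w hw => by
      rw [abs_of_pos (Real.exp_pos _), Real.exp_le_exp]
      simpa [hw] using real_inner_le_norm w y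
  calc ∫⁻ w, ENNReal.ofReal (σ ⟪x, w⟫ ^ 2) ∂ν
      ≤ ∫⁻ w, ENNReal.ofReal (A * (Real.exp ⟪w, x⟫ + Real.exp ⟪w, -x⟫)) ∂ν := by
        refine lintegral_mono fun w => ENNReal.ofReal_le_ofReal ?_
        rw [inner_neg_right, real_inner_comm]
        exact hpt _
    _ = ENNReal.ofReal (∫ w, A * (Real.exp ⟪w, x⟫ + Real.exp ⟪w, -x⟫) ∂ν) :=
        (ofReal_integral_eq_lintegral_ofReal (((hint x).add (hint (-x))).const_mul A)
          (ae_of_all _ fun w => mul_nonneg hA0 (add_nonneg (Real.exp_pos _).le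
            (Real.exp_pos _).le))).symm
    _ ≤ _ := by
        refine ENNReal.ofReal_le_ofReal ?_
        rw [integral_const_mul, integral_add (hint x) (hint (-x))]
        gcongr
        · exact hν.integral_exp_inner_le hx
        · exact hν.integral_exp_inner_le (by rw [norm_neg, hx])

end Moments

section Resolvent

open Matrix

theorem abs_trace_resolvent_mul_le {n p ι : Type*} [Fintype n] [Fintype p] [DecidableEq p]
    [Fintype ι] (Z : Matrix n p ℝ) {lam : ℝ} (hlam : 0 < lam) (v : ι → p → ℝ) (a : ι → n → ℝ) :
    |trace (Z * (Zᵀ * Z + lam • (1 : Matrix p p ℝ))⁻¹ * (∑ j, vecMulVec (v j) (v j)) *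
        (Zᵀ * Z + lam • (1 : Matrix p p ℝ))⁻¹ * Zᵀ)| ≤
      ∑ j, (a j ⬝ᵥ a j + lam⁻¹ * ((v j - Zᵀ *ᵥ a j) ⬝ᵥ (v j - Zᵀ *ᵥ a j))) := by
  set M := Zᵀ * Z + lam • (1 : Matrix p p ℝ) with hM
  have hMt : Mᵀ = M := by simp [hM]
  have hMdef : M.PosDef := by
    refine Matrix.PosDef.posSemidef_add ?_ ?_
    · simpa using Matrix.posSemidef_conjTranspose_mul_self Z
    · exact Matrix.PosDef.one.smul hlam
  have hunit : IsUnit M.det := hMdef.det_pos.ne'.isUnit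
  have htr : trace (Z * M⁻¹ * (∑ j, vecMulVec (v j) (v j)) * M⁻¹ * Zᵀ) =
      ∑ j, (Z *ᵥ (M⁻¹ *ᵥ v j)) ⬝ᵥ (Z *ᵥ (M⁻¹ *ᵥ v j)) := by
    have hRt : M⁻¹ * Zᵀ = (Z * M⁻¹)ᵀ := by
      rw [transpose_mul, transpose_nonsing_inv, hMt]
    rw [Matrix.mul_assoc _ M⁻¹, hRt, Matrix.mul_sum, Matrix.sum_mul, trace_sum]
    refine Finset.sum_congr rfl fun j _ => ?_
    rw [mul_vecMulVec, vecMulVec_mul, vecMul_transpose, trace_vecMulVec, mulVec_mulVec]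
  rw [htr, abs_of_nonneg (Finset.sum_nonneg fun j _ => by
    exact Finset.sum_nonneg fun i _ => mul_self_nonneg _)]
  refine Finset.sum_le_sum fun j _ => ?_
  set q := M⁻¹ *ᵥ v j with hq
  set b := v j - Zᵀ *ᵥ a j with hb
  have hMq : Zᵀ *ᵥ (Z *ᵥ q) + lam • q = Zᵀ *ᵥ a j + b := by
    have h1 : M *ᵥ q = v j := by rw [hq, mulVec_mulVec, mul_nonsing_inv _ hunit, one_mulVec]
    rw [hb, add_sub_cancel, ← h1, hM, add_mulVec, mulVec_mulVec, smul_mulVec, one_mulVec]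
  have key : (Z *ᵥ q) ⬝ᵥ (Z *ᵥ q) + lam * (q ⬝ᵥ q) = (Z *ᵥ q) ⬝ᵥ a j + q ⬝ᵥ b := by
    have h1 := congrArg (fun t => q ⬝ᵥ t) hMq
    simp only [dotProduct_add, dotProduct_smul, smul_eq_mul] at h1
    have h2 : ∀ t, q ⬝ᵥ (Zᵀ *ᵥ t) = (Z *ᵥ q) ⬝ᵥ t := fun t => by
      rw [dotProduct_transpose_mulVec, dotProduct_comm]
    rwa [h2, h2] at h1
  have h1 : 0 ≤ (Z *ᵥ q - a j) ⬝ᵥ (Z *ᵥ q - a j) :=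
    Finset.sum_nonneg fun i _ => mul_self_nonneg _
  have hnn : ∀ t : p → ℝ, 0 ≤ t ⬝ᵥ t := fun t =>
    Finset.sum_nonneg fun i _ => mul_self_nonneg _
  have h2 := hnn (lam • q - b)
  simp only [sub_dotProduct, dotProduct_sub, smul_dotProduct, dotProduct_smul, smul_eq_mul,
    dotProduct_comm (a j) (Z *ᵥ q), dotProduct_comm b q] at h1 h2
  have h3 : 2 * (q ⬝ᵥ b) ≤ lam * (q ⬝ᵥ q) + lam⁻¹ * (b ⬝ᵥ b) := by
    have h4 : 0 ≤ lam⁻¹ * (lam * (lam * (q ⬝ᵥ q)) - lam * (q ⬝ᵥ b) -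
        (lam * (q ⬝ᵥ b) - b ⬝ᵥ b)) := mul_nonneg (inv_nonneg.2 hlam.le) (by linarith)
    have h5 : lam⁻¹ * (lam * (lam * (q ⬝ᵥ q)) - lam * (q ⬝ᵥ b) - (lam * (q ⬝ᵥ b) - b ⬝ᵥ b)) =
        lam * (q ⬝ᵥ q) - 2 * (q ⬝ᵥ b) + lam⁻¹ * (b ⬝ᵥ b) := by
      field_simp; ring
    linarith
  have h6 : 0 ≤ lam * (q ⬝ᵥ q) := mul_nonneg hlam.le (hnn q)
  linarith

end Resolvent

section OrthonormalPolynomials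

open scoped RealInnerProductSpace

theorem MeasureTheory.MemLp.inner_toLp {α : Type*} [MeasurableSpace α] {μ : Measure α}
    {f : α → ℝ} (hf : MemLp f 2 μ) (g : Lp ℝ 2 μ) : ⟪hf.toLp f, g⟫ = ∫ x, f x * g x ∂μ := by
  rw [L2.inner_def]
  refine integral_congr_ae ?_
  filter_upwards [hf.coeFn_toLp] with x hx
  rw [hx]
  simp [mul_comm]

/-- The functions whose `L²` class lies in a given subspace. -/
def functionsWithClassIn {α : Type*} [MeasurableSpace α] {μ : Measure α}
    (K : Submodule ℝ (Lp ℝ 2 μ)) : Submodule ℝ (α → ℝ) where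
  carrier := {f | ∃ h : MemLp f 2 μ, h.toLp f ∈ K}
  add_mem' := by
    rintro f g ⟨hf, hfK⟩ ⟨hg, hgK⟩
    exact ⟨hf.add hg, by rw [MemLp.toLp_add hf hg]; exact K.add_mem hfK hgK⟩
  zero_mem' := ⟨MemLp.zero, by rw [MemLp.toLp_zero]; exact K.zero_mem⟩
  smul_mem' := by
    rintro c f ⟨hf, hfK⟩
    exact ⟨hf.const_smul c, by rw [MemLp.toLp_const_smul c hf]; exact K.smul_mem c hfK⟩

theorem memLp_of_bound_on_sphere {E : Type*} [NormedAddCommGroup E] [InnerProductSpace ℝ E]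
    [MeasurableSpace E] {r : ℝ} {μ : Measure E} (hμ : IsSphereLaw r μ) {f : E → ℝ}
    (hf : AEStronglyMeasurable f μ) (C : ℝ) (hC : ∀ x, ‖x‖ = r → |f x| ≤ C) : MemLp f 2 μ := by
  have := hμ.isProbabilityMeasure
  refine MemLp.of_bound hf C ?_
  filter_upwards [hμ.norm_eq] with x hx using hC x hx

/-- An orthonormal family in `L²` of a sphere law through which polynomials of degree at most `m`
expand. -/
theorem IsSphereLaw.exists_orthonormal_polynomials {d : ℕ} {r : ℝ}
    {μ : Measure (EuclideanSpace ℝ (Fin d))} (hμ : IsSphereLaw r μ) (m : ℕ) :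
    ∃ (B : ℕ) (y : Fin B → EuclideanSpace ℝ (Fin d) → ℝ), B ≤ (d + 1) ^ m ∧
      (∀ j, Measurable (y j)) ∧ (∀ j, MemLp (y j) 2 μ) ∧ (∀ j, ∫ x, y j x ^ 2 ∂μ = 1) ∧
      (∀ g : EuclideanSpace ℝ (Fin d) → ℝ, MemLp g 2 μ →
        (∀ u, ∀ k ≤ m, ∫ x, g x * ⟪x, u⟫ ^ k ∂μ = 0) → ∀ j, ∫ x, g x * y j x ∂μ = 0) ∧
      ∀ P : Polynomial ℝ, P.natDegree ≤ m → ∀ u v,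
        ∫ x, P.eval ⟪x, u⟫ * P.eval ⟪x, v⟫ ∂μ =
          ∑ j, (∫ x, P.eval ⟪x, u⟫ * y j x ∂μ) * ∫ x, P.eval ⟪x, v⟫ * y j x ∂μ := by
  classical
  have := hμ.isProbabilityMeasure
  have hpw : ∀ (u : EuclideanSpace ℝ (Fin d)) (k : ℕ), MemLp (fun x => ⟪x, u⟫ ^ k) 2 μ :=
    fun u k => memLp_of_bound_on_sphere hμ (by fun_prop) ((r * ‖u‖) ^ k) fun x hx => by
      rw [abs_pow]
      exact pow_le_pow_left₀ (abs_nonneg _) (by simpa [hx] using abs_real_inner_le_norm x u) k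
  set ext : Option (Fin d) → EuclideanSpace ℝ (Fin d) → ℝ :=
    fun a x => a.elim 1 fun b => x b with hext
  have hextc : ∀ a, Continuous (ext a) := by
    rintro (_ | b)
    · exact continuous_const
    · exact (EuclideanSpace.proj (𝕜 := ℝ) b).continuous
  have hmono : ∀ τ : Fin m → Option (Fin d), MemLp (fun x => ∏ i, ext (τ i) x) 2 μ := fun τ =>
    memLp_of_bound_on_sphere hμ
      (continuous_finsetProd _ fun i _ => hextc (τ i)).aestronglyMeasurable
      (∏ _i : Fin m, max 1 r) fun x hx => by
        rw [Finset.abs_prod]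
        refine Finset.prod_le_prod (fun i _ => abs_nonneg _) fun i _ => ?_
        rcases τ i with _ | b
        · simp [hext]
        · refine le_max_of_le_right ?_
          rw [← hx]
          exact PiLp.norm_apply_le x b
  set pw := fun q : EuclideanSpace ℝ (Fin d) × Fin (m + 1) => (hpw q.1 q.2).toLp _ with hpwdef
  set mono := fun τ => (hmono τ).toLp _ with hmonodef
  set K := Submodule.span ℝ (Set.range pw) with hK
  have hKle : K ≤ Submodule.span ℝ (Set.range mono) := by
    rw [hK, Submodule.span_le]
    rintro _ ⟨⟨u, k⟩, rfl⟩
    have hmem : (fun x => ⟪x, u⟫ ^ (k : ℕ)) ∈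
        functionsWithClassIn (Submodule.span ℝ (Set.range mono)) := by
      set c : Fin m → Option (Fin d) → ℝ := fun i a =>
        if (i : ℕ) < k then a.elim 0 (fun b => u b) else a.elim 1 (fun _ => 0) with hc
      have hfac : ∀ i x, ∑ a, c i a * ext a x = if (i : ℕ) < k then ⟪x, u⟫ else 1 := by
        intro i x
        rw [Fintype.sum_option]
        by_cases h : (i : ℕ) < k
        · simp [hc, hext, h, PiLp.inner_apply]
        · simp [hc, hext, h]
      have hexp : (fun x => ⟪x, u⟫ ^ (k : ℕ)) =
          ∑ τ : Fin m → Option (Fin d), (∏ i, c i (τ i)) • fun x => ∏ i, ext (τ i) x := by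
        ext x
        have h1 : ∏ i, ∑ a, c i a * ext a x = ⟪x, u⟫ ^ (k : ℕ) := by
          simp_rw [hfac]
          rw [Finset.prod_ite, Finset.prod_const_one, mul_one, Finset.prod_const]
          congr 1
          rw [Fin.card_filter_val_lt, min_eq_right (Nat.lt_succ_iff.1 k.2)]
        rw [← h1, Finset.prod_univ_sum, Fintype.piFinset_univ, Finset.sum_apply]
        refine Finset.sum_congr rfl fun τ _ => ?_
        simp [Finset.prod_mul_distrib]
      rw [hexp]
      refine Submodule.sum_mem _ fun τ _ => Submodule.smul_mem _ _ ⟨hmono τ, ?_⟩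
      exact Submodule.subset_span ⟨τ, rfl⟩
    exact hmem.2
  have hfinm : FiniteDimensional ℝ (Submodule.span ℝ (Set.range mono)) :=
    FiniteDimensional.span_of_finite ℝ (Set.finite_range mono)
  have hfin : FiniteDimensional ℝ K := Submodule.finiteDimensional_of_le hKle
  have hcard : Module.finrank ℝ K ≤ (d + 1) ^ m := by
    refine (Submodule.finrank_mono hKle).trans ((finrank_range_le_card mono).trans ?_)
    simp
  set b := stdOrthonormalBasis ℝ K with hb
  have hpoly : ∀ (P : Polynomial ℝ), P.natDegree ≤ m → ∀ u,
      (fun x => P.eval ⟪x, u⟫) ∈ functionsWithClassIn K := by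
    intro P hP u
    have : (fun x => P.eval ⟪x, u⟫) =
        ∑ k ∈ Finset.range (m + 1), P.coeff k • fun x => ⟪x, u⟫ ^ k := by
      ext x
      rw [Polynomial.eval_eq_sum_range' (Nat.lt_succ_of_le hP)]
      simp
    rw [this]
    refine Submodule.sum_mem _ fun k hk => Submodule.smul_mem _ _ ⟨hpw u k, ?_⟩
    exact Submodule.subset_span ⟨(u, ⟨k, Finset.mem_range.1 hk⟩), rfl⟩
  refine ⟨_, fun j => ⇑((b j : K) : Lp ℝ 2 μ), hcard, fun j => (Lp.stronglyMeasurable _).measurable,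
    fun j => Lp.memLp _, fun j => ?_, fun g hg hgK j => ?_, fun P hP u v => ?_⟩
  · have h1 : ⟪((b j : K) : Lp ℝ 2 μ), ((b j : K) : Lp ℝ 2 μ)⟫ = 1 := by
      rw [← Submodule.coe_inner, real_inner_self_eq_norm_sq, b.orthonormal.1 j, one_pow]
    rw [L2.inner_def] at h1
    rw [← h1]
    congr 1; ext x
    simp [sq]
  · rw [← hg.inner_toLp]
    have : K ≤ (ℝ ∙ hg.toLp g)ᗮ := by
      rw [hK, Submodule.span_le]
      rintro _ ⟨⟨u, k⟩, rfl⟩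
      rw [SetLike.mem_coe, Submodule.mem_orthogonal_singleton_iff_inner_right, hg.inner_toLp,
        ← hgK u k (Nat.lt_succ_iff.1 k.2)]
      refine integral_congr_ae ?_
      filter_upwards [(hpw u k).coeFn_toLp] with x hx
      simp only [hpwdef, hx]
    exact Submodule.mem_orthogonal_singleton_iff_inner_right.1 (this (b j).2)
  · obtain ⟨hu, huK⟩ := hpoly P hP u
    obtain ⟨hv, hvK⟩ := hpoly P hP v
    have h1 := b.sum_inner_mul_inner ⟨_, huK⟩ ⟨_, hvK⟩
    simp only [Submodule.coe_inner] at h1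
    simp_rw [← hu.inner_toLp, ← hv.inner_toLp]
    rw [show ∫ x, P.eval ⟪x, u⟫ * P.eval ⟪x, v⟫ ∂μ = ⟪hu.toLp _, hv.toLp _⟫ by
      rw [hu.inner_toLp]
      refine integral_congr_ae ?_
      filter_upwards [hv.coeFn_toLp] with x hx
      rw [hx], ← h1]
    refine Finset.sum_congr rfl fun j _ => ?_
    rw [real_inner_comm (hv.toLp _)]

end OrthonormalPolynomials

section MainBound

open scoped RealInnerProductSpace

theorem lintegral_sq_integral_sub_average_le {α : Type*} [MeasurableSpace α] {μ : Measure α}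
    [IsProbabilityMeasure μ] {g : α → ℝ} (hg : MemLp g 2 μ) {n : ℕ} (hn : 0 < n) :
    ∫⁻ X, ENNReal.ofReal ((∫ x, g x ∂μ - (n : ℝ)⁻¹ * ∑ i, g (X i)) ^ 2)
        ∂(Measure.pi fun _ : Fin n => μ) ≤
      ENNReal.ofReal (n : ℝ)⁻¹ * ∫⁻ x, ENNReal.ofReal (g x ^ 2) ∂μ := by
  have hn' : (n : ℝ) ≠ 0 := by positivity
  set π := Measure.pi fun _ : Fin n => μ with hπ
  set S : (Fin n → α) → ℝ := ∑ i, fun X => g (X i) with hS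
  have hgi : ∀ i, MemLp (fun X : Fin n → α => g (X i)) 2 π := fun i =>
    hg.comp_measurePreserving (measurePreserving_eval (fun _ => μ) i)
  have hSmem : MemLp S 2 π := memLp_finsetSum' _ fun i _ => hgi i
  have hmean : ∫ X, S X ∂π = n * ∫ x, g x ∂μ := by
    simp only [hS, Finset.sum_apply]
    rw [integral_finsetSum _ fun i _ => (hgi i).integrable (by norm_num)]
    have : ∀ i : Fin n, ∫ X, g (X i) ∂π = ∫ x, g x ∂μ := fun i =>
      integral_comp_eval (μ := fun _ : Fin n => μ) hg.aestronglyMeasurable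
    simp [this]
  have hvar : ProbabilityTheory.variance S π = n * ProbabilityTheory.variance g μ := by
    rw [hS, hπ, ProbabilityTheory.variance_sum_pi fun _ => hg]
    simp
  have hpt : ∀ X : Fin n → α, ENNReal.ofReal ((∫ x, g x ∂μ - (n : ℝ)⁻¹ * ∑ i, g (X i)) ^ 2) =
      ENNReal.ofReal (((n : ℝ)⁻¹) ^ 2) * ENNReal.ofReal ((S X - ∫ Y, S Y ∂π) ^ 2) := fun X => by
    rw [← ENNReal.ofReal_mul (by positivity), hmean, hS, Finset.sum_apply]
    congr 1
    field_simp
    ring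
  simp_rw [hpt]
  rw [lintegral_const_mul' _ _ ENNReal.ofReal_ne_top,
    ← ProbabilityTheory.evariance_eq_lintegral_ofReal, ← ProbabilityTheory.ofReal_variance hSmem,
    hvar, ← ofReal_integral_eq_lintegral_ofReal hg.integrable_sq
      (ae_of_all _ fun x => sq_nonneg (g x)),
    ← ENNReal.ofReal_mul (by positivity), ← ENNReal.ofReal_mul (by positivity)]
  refine ENNReal.ofReal_le_ofReal ?_
  have := ProbabilityTheory.variance_le_expectation_sq hg.aestronglyMeasurable
  simp only [Pi.pow_apply] at this
  calc ((n : ℝ)⁻¹) ^ 2 * (n * ProbabilityTheory.variance g μ)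
      = (n : ℝ)⁻¹ * ProbabilityTheory.variance g μ := by field_simp
    _ ≤ _ := by gcongr

theorem dotp_eq_inner {d : ℕ} (u v : EuclideanSpace ℝ (Fin d)) : dotp u v = ⟪u, v⟫ := by
  simp [dotp, PiLp.inner_apply, mul_comm]

theorem UmatLow_eq_sum_vecMulVec {d p m : ℕ} {P : Polynomial ℝ} {B : ℕ}
    {y : Fin B → EuclideanSpace ℝ (Fin d) → ℝ} (hP : P.natDegree ≤ m)
    (hexp : ∀ P : Polynomial ℝ, P.natDegree ≤ m → ∀ u v,
        ∫ x, P.eval ⟪x, u⟫ * P.eval ⟪x, v⟫ ∂sphereUniform d √d =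
          ∑ j, (∫ x, P.eval ⟪x, u⟫ * y j x ∂sphereUniform d √d) *
            ∫ x, P.eval ⟪x, v⟫ * y j x ∂sphereUniform d √d)
    (w : Fin p → EuclideanSpace ℝ (Fin d)) :
    UmatLow d p P w = ∑ j, Matrix.vecMulVec
      (fun α => (√p)⁻¹ * ∫ x, P.eval ⟪x, w α⟫ * y j x ∂sphereUniform d √d)
      (fun α => (√p)⁻¹ * ∫ x, P.eval ⟪x, w α⟫ * y j x ∂sphereUniform d √d) := by
  ext α β
  have hp : (√p)⁻¹ * (√p)⁻¹ = (p : ℝ)⁻¹ := by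
    rw [← mul_inv, Real.mul_self_sqrt (by positivity)]
  rw [Matrix.sum_apply]
  simp only [UmatLow, Matrix.of_apply, dotp_eq_inner, Matrix.vecMulVec_apply]
  rw [hexp P hP, Finset.mul_sum]
  refine Finset.sum_congr rfl fun j _ => ?_
  rw [← hp]; ring

theorem lintegral_abs_trace_le {d n p m : ℕ} (hd : 2 ≤ d) (hn : 0 < n) (hp : 0 < p)
    (hμ : IsSphereLaw √d (sphereUniform d √d)) (hν : IsSphereLaw 1 (sphereUniform d 1))
    {σ : ℝ → ℝ} (hσ : Measurable σ) {C : ℝ} (hC : ∀ s, |s| ≤ √d → |σ s| ≤ C)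
    {K : ℝ} (hK0 : 0 ≤ K) (hK : ∀ x : EuclideanSpace ℝ (Fin d), ‖x‖ = √d →
      ∫⁻ w, ENNReal.ofReal (σ ⟪x, w⟫ ^ 2) ∂sphereUniform d 1 ≤ ENNReal.ofReal K)
    {P : Polynomial ℝ} (hP : P.natDegree ≤ m)
    (hproj : ∀ w : EuclideanSpace ℝ (Fin d), ‖w‖ = 1 → ∀ j ≤ m,
      ∫ x, (σ ⟪x, w⟫ - P.eval ⟪x, w⟫) * ⟪x, w⟫ ^ j ∂sphereUniform d √d = 0)
    {lam : ℝ} (hlam : 0 < lam) :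
    ∫⁻ ω, ENNReal.ofReal |Matrix.trace
          (Zmat d n p σ ω.1 ω.2 * Rmat d n p σ lam ω.1 ω.2 * UmatLow d p P ω.2 *
            Rmat d n p σ lam ω.1 ω.2 * (Zmat d n p σ ω.1 ω.2).transpose)| ∂XWmeas d n p ≤
      ENNReal.ofReal ((d + 1) ^ m / n * (1 + K / lam)) := by
  have hn' : (n : ℝ) ≠ 0 := by positivity
  have hp' : (p : ℝ) ≠ 0 := by positivity
  have hr : 0 < √(d : ℝ) := Real.sqrt_pos.2 (by positivity)
  have hfr : 2 ≤ Module.finrank ℝ (EuclideanSpace ℝ (Fin d)) := by simpa using hd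
  obtain ⟨B, y, hB, hym, hyL, hy1, horth, hexp⟩ := hμ.exists_orthonormal_polynomials m
  set μ := sphereUniform d √d with hμdef
  set ν := sphereUniform d 1 with hνdef
  have := hμ.isProbabilityMeasure
  have := hν.isProbabilityMeasure
  have hinner : ∀ x w : EuclideanSpace ℝ (Fin d), ‖x‖ = √d → ‖w‖ = 1 → |⟪x, w⟫| ≤ √d :=
    fun x w hx hw => by simpa [hx, hw] using abs_real_inner_le_norm x w
  obtain ⟨C', hC'⟩ := (isCompact_Icc (a := -√(d : ℝ)) (b := √d)).exists_bound_of_continuousOn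
    P.continuous.continuousOn
  have hCP : ∀ s, |s| ≤ √d → |P.eval s| ≤ C' := fun s hs => hC' s (abs_le.1 hs)
  have hσL : ∀ w, ‖w‖ = 1 → MemLp (fun x => σ ⟪x, w⟫) 2 μ := fun w hw =>
    memLp_of_bound_on_sphere hμ (hσ.comp (by fun_prop :
      Measurable fun x : EuclideanSpace ℝ (Fin d) => ⟪x, w⟫)).aestronglyMeasurable C
      fun x hx => hC _ (hinner x w hx hw)
  have hPL : ∀ w, ‖w‖ = 1 → MemLp (fun x => P.eval ⟪x, w⟫) 2 μ := fun w hw =>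
    memLp_of_bound_on_sphere hμ
      (P.continuous.measurable.comp (by fun_prop)).aestronglyMeasurable C'
      fun x hx => hCP _ (hinner x w hx hw)
  set c : Fin B → EuclideanSpace ℝ (Fin d) → ℝ := fun j w => ∫ x, σ ⟪x, w⟫ * y j x ∂μ with hc
  have hcP : ∀ j w, ‖w‖ = 1 → ∫ x, P.eval ⟪x, w⟫ * y j x ∂μ = c j w := by
    intro j w hw
    have h1 := horth _ ((hσL w hw).sub (hPL w hw)) (fun u k hk =>
      hμ.integral_mul_inner_pow_eq_zero hr hfr hw (f := fun s => σ s - P.eval s)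
        (hσ.sub P.continuous.measurable) (C := C + C')
        (fun s hs => (abs_sub _ _).trans (add_le_add (hC s hs) (hCP s hs)))
        (hproj w hw) u hk) j
    simp only [Pi.sub_apply, sub_mul] at h1
    have h2 := integral_sub (μ := μ) (f := fun x => σ ⟪x, w⟫ * y j x)
      (g := fun x => P.eval ⟪x, w⟫ * y j x) ((hσL w hw).integrable_mul (hyL j))
      ((hPL w hw).integrable_mul (hyL j))
    rw [h1] at h2
    exact (sub_eq_zero.1 h2.symm).symm
  set D : Fin B → (Fin n → EuclideanSpace ℝ (Fin d)) → EuclideanSpace ℝ (Fin d) → ℝ :=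
    fun j X w => c j w - (n : ℝ)⁻¹ * ∑ i, σ ⟪X i, w⟫ * y j (X i) with hD
  have hsy : ∀ j, Measurable fun q : EuclideanSpace ℝ (Fin d) × EuclideanSpace ℝ (Fin d) =>
      σ ⟪q.1, q.2⟫ * y j q.1 := fun j => by
    have := hym j
    fun_prop
  have hcm : ∀ j, Measurable (c j) := fun j => by
    have : StronglyMeasurable (Function.uncurry fun w x : EuclideanSpace ℝ (Fin d) =>
      σ ⟪x, w⟫ * y j x) := ((hsy j).comp measurable_swap).stronglyMeasurable
    exact this.integral_prod_right.measurable
  have hDm : ∀ j, Measurable fun q : (Fin n → EuclideanSpace ℝ (Fin d)) ×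
      EuclideanSpace ℝ (Fin d) => D j q.1 q.2 := fun j => by
    refine ((hcm j).comp measurable_snd).sub ((Finset.measurable_fun_sum _ fun i _ => ?_).const_mul _)
    have : Measurable fun q : (Fin n → EuclideanSpace ℝ (Fin d)) × EuclideanSpace ℝ (Fin d) =>
      (q.1 i, q.2) := by fun_prop
    exact (hsy j).comp this
  have hpt : ∀ X : Fin n → EuclideanSpace ℝ (Fin d), ∀ W : Fin p → EuclideanSpace ℝ (Fin d),
      (∀ α, ‖W α‖ = 1) → |Matrix.trace (Zmat d n p σ X W * Rmat d n p σ lam X W *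
        UmatLow d p P W * Rmat d n p σ lam X W * (Zmat d n p σ X W).transpose)| ≤
      ∑ j, (∑ i, ((n : ℝ)⁻¹ * y j (X i)) ^ 2 +
        lam⁻¹ * ∑ α, (p : ℝ)⁻¹ * D j X (W α) ^ 2) := by
    intro X W hW
    rw [UmatLow_eq_sum_vecMulVec hP hexp]
    refine (abs_trace_resolvent_mul_le _ hlam _
      fun j i => (n : ℝ)⁻¹ * y j (X i)).trans_eq ?_
    refine Finset.sum_congr rfl fun j _ => ?_
    congr 1
    · exact Finset.sum_congr rfl fun i _ => by ring
    congr 1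
    refine Finset.sum_congr rfl fun α _ => ?_
    have h1 : (√p)⁻¹ * ∫ x, P.eval ⟪x, W α⟫ * y j x ∂μ -
        ((Zmat d n p σ X W).transpose.mulVec fun i => (n : ℝ)⁻¹ * y j (X i)) α =
        (√p)⁻¹ * D j X (W α) := by
      rw [hcP j _ (hW α), hD]
      simp only [Matrix.mulVec, dotProduct, Matrix.transpose_apply, Zmat, Matrix.smul_apply,
        entrywise, Matrix.of_apply, smul_eq_mul, dotp_eq_inner, mul_sub, Finset.mul_sum]
      congr 1
      exact Finset.sum_congr rfl fun i _ => by ring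
    rw [Pi.sub_apply, h1, ← sq, mul_pow, inv_pow, Real.sq_sqrt (by positivity)]
  have hXfst : MeasurePreserving (Prod.fst : _ × (Fin p → EuclideanSpace ℝ (Fin d)) → _)
      (XWmeas d n p) (Xmeas d n) := by
    have : IsProbabilityMeasure (Wmeas d p) := by unfold Wmeas; infer_instance
    exact measurePreserving_fst
  have hT1 : ∀ j i, ∫⁻ ω, ENNReal.ofReal (((n : ℝ)⁻¹ * y j (ω.1 i)) ^ 2) ∂XWmeas d n p =
      ENNReal.ofReal (((n : ℝ)⁻¹) ^ 2) := by
    intro j i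
    have hmp : MeasurePreserving (fun ω : (Fin n → EuclideanSpace ℝ (Fin d)) ×
        (Fin p → EuclideanSpace ℝ (Fin d)) => ω.1 i) (XWmeas d n p) μ :=
      (measurePreserving_eval (fun _ : Fin n => μ) i).comp hXfst
    rw [hmp.lintegral_comp (f := fun x => ENNReal.ofReal (((n : ℝ)⁻¹ * y j x) ^ 2))
      (((hym j).const_mul _).pow_const 2).ennreal_ofReal]
    simp_rw [mul_pow, ENNReal.ofReal_mul (sq_nonneg (n : ℝ)⁻¹)]
    rw [lintegral_const_mul' _ _ ENNReal.ofReal_ne_top,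
      ← ofReal_integral_eq_lintegral_ofReal (hyL j).integrable_sq
        (ae_of_all _ fun x => sq_nonneg _), hy1]
    simp
  have hT2 : ∀ j α, ∫⁻ ω, ENNReal.ofReal (D j ω.1 (ω.2 α) ^ 2) ∂XWmeas d n p ≤
      ENNReal.ofReal ((n : ℝ)⁻¹ * K) := by
    intro j α
    have hDm2 : Measurable fun q : (Fin n → EuclideanSpace ℝ (Fin d)) ×
      EuclideanSpace ℝ (Fin d) => ENNReal.ofReal (D j q.1 q.2 ^ 2) :=
      ((hDm j).pow_const 2).ennreal_ofReal
    have hmp : MeasurePreserving (Prod.map id (Function.eval α)) (XWmeas d n p)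
        ((Xmeas d n).prod ν) := by
      have : SFinite (Xmeas d n) := by unfold Xmeas; infer_instance
      have : SFinite (Wmeas d p) := by unfold Wmeas; infer_instance
      exact (MeasurePreserving.id _).prod (measurePreserving_eval (fun _ : Fin p => ν) α)
    have hsf : SFinite (Xmeas d n) := by unfold Xmeas; infer_instance
    calc ∫⁻ ω, ENNReal.ofReal (D j ω.1 (ω.2 α) ^ 2) ∂XWmeas d n p
        = ∫⁻ q, ENNReal.ofReal (D j q.1 q.2 ^ 2) ∂((Xmeas d n).prod ν) :=
          hmp.lintegral_comp hDm2
      _ = ∫⁻ w, ∫⁻ X, ENNReal.ofReal (D j X w ^ 2) ∂Xmeas d n ∂ν :=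
          lintegral_prod_symm _ hDm2.aemeasurable
      _ ≤ ∫⁻ w, ENNReal.ofReal (n : ℝ)⁻¹ *
            ∫⁻ x, ENNReal.ofReal ((σ ⟪x, w⟫ * y j x) ^ 2) ∂μ ∂ν := by
          refine lintegral_mono_ae ?_
          filter_upwards [hν.norm_eq] with w hw
          refine lintegral_sq_integral_sub_average_le ?_ hn
          refine (hyL j).of_le_mul (c := C)
            ((hσL w hw).aestronglyMeasurable.mul (hyL j).aestronglyMeasurable) ?_
          filter_upwards [hμ.norm_eq] with x hx
          rw [norm_mul]
          gcongr
          exact hC _ (hinner x w hx hw)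
      _ = ENNReal.ofReal (n : ℝ)⁻¹ *
            ∫⁻ x, ∫⁻ w, ENNReal.ofReal ((σ ⟪x, w⟫ * y j x) ^ 2) ∂ν ∂μ := by
          rw [lintegral_const_mul' _ _ ENNReal.ofReal_ne_top, lintegral_lintegral_swap]
          exact (((hsy j).comp measurable_swap).pow_const 2).ennreal_ofReal.aemeasurable
      _ ≤ ENNReal.ofReal (n : ℝ)⁻¹ *
            ∫⁻ x, ENNReal.ofReal K * ENNReal.ofReal (y j x ^ 2) ∂μ := by
          gcongr _ * ?_
          refine lintegral_mono_ae ?_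
          filter_upwards [hμ.norm_eq] with x hx
          simp_rw [mul_pow, ENNReal.ofReal_mul (sq_nonneg _)]
          rw [lintegral_mul_const' _ _ ENNReal.ofReal_ne_top]
          gcongr
          exact hK x hx
      _ = ENNReal.ofReal ((n : ℝ)⁻¹ * K) := by
          rw [lintegral_const_mul' _ _ ENNReal.ofReal_ne_top,
            ← ofReal_integral_eq_lintegral_ofReal (hyL j).integrable_sq
              (ae_of_all _ fun x => sq_nonneg _), hy1, ENNReal.ofReal_one, mul_one,
            ENNReal.ofReal_mul (by positivity)]
  have hWae : ∀ᵐ ω ∂XWmeas d n p, ∀ α, ‖ω.2 α‖ = 1 := by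
    rw [ae_all_iff]
    intro α
    have h1 : ∀ᵐ W ∂Wmeas d p, ‖W α‖ = 1 :=
      (measurePreserving_eval (fun _ : Fin p => ν) α).quasiMeasurePreserving.ae hν.norm_eq
    have : SFinite (Wmeas d p) := by unfold Wmeas; infer_instance
    exact Measure.quasiMeasurePreserving_snd.ae h1
  have hm1 : ∀ j i, Measurable fun ω : (Fin n → EuclideanSpace ℝ (Fin d)) ×
      (Fin p → EuclideanSpace ℝ (Fin d)) => ENNReal.ofReal (((n : ℝ)⁻¹ * y j (ω.1 i)) ^ 2) :=
    fun j i => ((((hym j).comp ((measurable_pi_apply i).comp measurable_fst)).const_mul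
      _).pow_const 2).ennreal_ofReal
  have hm2 : ∀ j α, Measurable fun ω : (Fin n → EuclideanSpace ℝ (Fin d)) ×
      (Fin p → EuclideanSpace ℝ (Fin d)) => ENNReal.ofReal (D j ω.1 (ω.2 α) ^ 2) :=
    fun j α => (((hDm j).comp (measurable_fst.prodMk
      ((measurable_pi_apply α).comp measurable_snd))).pow_const 2).ennreal_ofReal
  calc ∫⁻ ω, ENNReal.ofReal |Matrix.trace
          (Zmat d n p σ ω.1 ω.2 * Rmat d n p σ lam ω.1 ω.2 * UmatLow d p P ω.2 *
            Rmat d n p σ lam ω.1 ω.2 * (Zmat d n p σ ω.1 ω.2).transpose)| ∂XWmeas d n p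
      ≤ ∫⁻ ω, ∑ j, (∑ i, ENNReal.ofReal (((n : ℝ)⁻¹ * y j (ω.1 i)) ^ 2) +
          ENNReal.ofReal lam⁻¹ * ∑ α, ENNReal.ofReal (p : ℝ)⁻¹ *
            ENNReal.ofReal (D j ω.1 (ω.2 α) ^ 2)) ∂XWmeas d n p := by
        refine lintegral_mono_ae ?_
        filter_upwards [hWae] with ω hω
        refine (ENNReal.ofReal_le_ofReal (hpt ω.1 ω.2 hω)).trans_eq ?_
        rw [ENNReal.ofReal_sum_of_nonneg fun j _ => by positivity]
        refine Finset.sum_congr rfl fun j _ => ?_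
        rw [ENNReal.ofReal_add (by positivity) (by positivity), ENNReal.ofReal_mul (by positivity),
          ENNReal.ofReal_sum_of_nonneg fun i _ => by positivity,
          ENNReal.ofReal_sum_of_nonneg fun i _ => by positivity]
        simp_rw [ENNReal.ofReal_mul (show 0 ≤ (p : ℝ)⁻¹ by positivity)]
    _ = ∑ j, (∑ i, ∫⁻ ω, ENNReal.ofReal (((n : ℝ)⁻¹ * y j (ω.1 i)) ^ 2) ∂XWmeas d n p +
          ENNReal.ofReal lam⁻¹ * ∑ α, ENNReal.ofReal (p : ℝ)⁻¹ *
            ∫⁻ ω, ENNReal.ofReal (D j ω.1 (ω.2 α) ^ 2) ∂XWmeas d n p) := by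
        rw [lintegral_finsetSum _ fun j _ => by
          have := hm1 j
          have := hm2 j
          fun_prop]
        refine Finset.sum_congr rfl fun j _ => ?_
        rw [lintegral_add_left (Finset.measurable_fun_sum _ fun i _ => hm1 j i),
          lintegral_finsetSum _ fun i _ => hm1 j i,
          lintegral_const_mul' _ _ ENNReal.ofReal_ne_top,
          lintegral_finsetSum _ fun α _ => (hm2 j α).const_mul _]
        simp_rw [lintegral_const_mul' _ _ ENNReal.ofReal_ne_top]
    _ ≤ ∑ j : Fin B, (∑ i : Fin n, ENNReal.ofReal (((n : ℝ)⁻¹) ^ 2) +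
          ENNReal.ofReal lam⁻¹ * ∑ α : Fin p, ENNReal.ofReal (p : ℝ)⁻¹ *
            ENNReal.ofReal ((n : ℝ)⁻¹ * K)) := by
        gcongr with j _ i _ α _
        · exact (hT1 j i).le
        · exact hT2 j α
    _ = ENNReal.ofReal (∑ j : Fin B, (∑ i : Fin n, ((n : ℝ)⁻¹) ^ 2 +
          lam⁻¹ * ∑ α : Fin p, (p : ℝ)⁻¹ * ((n : ℝ)⁻¹ * K))) := by
        rw [ENNReal.ofReal_sum_of_nonneg fun j _ => by positivity]
        refine Finset.sum_congr rfl fun j _ => ?_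
        rw [ENNReal.ofReal_add (by positivity) (by positivity),
          ENNReal.ofReal_mul (show 0 ≤ lam⁻¹ by positivity),
          ENNReal.ofReal_sum_of_nonneg fun i _ => by positivity,
          ENNReal.ofReal_sum_of_nonneg fun i _ => by positivity]
        simp_rw [ENNReal.ofReal_mul (show 0 ≤ (p : ℝ)⁻¹ by positivity)]
    _ ≤ ENNReal.ofReal ((d + 1) ^ m / n * (1 + K / lam)) := by
        refine ENNReal.ofReal_le_ofReal ?_
        simp only [Finset.sum_const, Finset.card_univ, Fintype.card_fin, nsmul_eq_mul]
        have hB' : (B : ℝ) ≤ (d + 1) ^ m := by exact_mod_cast hB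
        calc (B : ℝ) * (n * ((n : ℝ)⁻¹) ^ 2 + lam⁻¹ * (p * ((p : ℝ)⁻¹ * ((n : ℝ)⁻¹ * K))))
            = B / n * (1 + K / lam) := by field_simp
          _ ≤ _ := by gcongr

end MainBound

section Assembly

open scoped RealInnerProductSpace

theorem sphereUniform_eq_zero_or_isSphereLaw (d : ℕ) (r : ℝ) :
    sphereUniform d r = 0 ∨ IsSphereLaw r (sphereUniform d r) := by
  set H : Measure (EuclideanSpace ℝ (Fin d)) := Measure.hausdorffMeasure ((d : ℝ) - 1) with hH
  have hdef : sphereUniform d r =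
    (H (Metric.sphere 0 r))⁻¹ • H.restrict (Metric.sphere 0 r) := rfl
  rcases eq_or_ne (H (Metric.sphere 0 r)) 0 with h0 | h0
  · left
    rw [hdef, Measure.restrict_eq_zero.2 h0, smul_zero]
  rcases eq_or_ne (H (Metric.sphere 0 r)) ⊤ with h1 | h1
  · left
    rw [hdef, h1, ENNReal.inv_top, zero_smul]
  right
  refine ⟨⟨?_⟩, ?_, fun L => ?_⟩
  · rw [hdef, Measure.smul_apply, Measure.restrict_apply_univ, smul_eq_mul,
      ENNReal.inv_mul_cancel h0 h1]
  · rw [hdef]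
    refine Measure.ae_smul_measure ?_ _
    filter_upwards [ae_restrict_mem Metric.isClosed_sphere.measurableSet] with x hx
    simpa using hx
  · have hpre : L ⁻¹' Metric.sphere 0 r = Metric.sphere 0 r := by
      ext x; simp
    rw [hdef, Measure.map_smul]
    congr 1
    conv_lhs => rw [← hpre]
    rw [← Measure.restrict_map L.continuous.measurable Metric.isClosed_sphere.measurableSet]
    congr 1
    exact L.toIsometryEquiv.map_hausdorffMeasure _

theorem aemeasurable_of_hermiteCoeff_zero_ne_zero {σ : ℝ → ℝ} (h : hermiteCoeff σ 0 ≠ 0) :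
    AEMeasurable σ := by
  have hint : Integrable (fun g => σ g * hermiteL2 0 g) stdGaussian := by
    by_contra hc
    exact h (integral_undef hc)
  have h0 : (fun g => σ g * hermiteL2 0 g) = σ := by
    funext g; simp [hermiteL2]
  rw [h0] at hint
  exact hint.aestronglyMeasurable.aemeasurable.mono_ac
    (ProbabilityTheory.gaussianReal_absolutelyContinuous' 0 one_ne_zero)

theorem AEMeasurable.exists_measurable_growth {σ : ℝ → ℝ} (hσ : AEMeasurable σ) {b : ℝ → ℝ}
    (hb : Measurable b) (hb0 : ∀ s, 0 ≤ b s) (hgrow : ∀ s, |σ s| ≤ b s) :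
    ∃ τ : ℝ → ℝ, Measurable τ ∧ (∀ s, |τ s| ≤ b s) ∧ volume {s | σ s ≠ τ s} = 0 := by
  refine ⟨{s | |hσ.mk σ s| ≤ b s}.indicator (hσ.mk σ), ?_, fun s => ?_, ?_⟩
  · exact hσ.measurable_mk.indicator
      (measurableSet_le hσ.measurable_mk.abs hb)
  · by_cases hs : |hσ.mk σ s| ≤ b s
    · rwa [Set.indicator_of_mem (by exact hs)]
    · rw [Set.indicator_of_notMem (by exact hs), abs_zero]
      exact hb0 s
  · have : σ =ᵐ[volume] {s | |hσ.mk σ s| ≤ b s}.indicator (hσ.mk σ) := by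
      filter_upwards [hσ.ae_eq_mk] with s hs
      have : |hσ.mk σ s| ≤ b s := hs ▸ hgrow s
      rw [Set.indicator_of_mem (by exact this), hs]
    exact this

theorem XWmeas_eq_zero {d n p : ℕ} (hn : 0 < n) (hp : 0 < p)
    (h : sphereUniform d √d = 0 ∨ sphereUniform d 1 = 0) : XWmeas d n p = 0 := by
  have hpi : ∀ k : ℕ, 0 < k →
      Measure.pi (fun _ : Fin k => (0 : Measure (EuclideanSpace ℝ (Fin d)))) = 0 := fun k hk => by
    rw [← Measure.measure_univ_eq_zero, Measure.pi_univ]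
    simp [hk.ne']
  rcases h with h | h
  · rw [XWmeas, Xmeas, h, hpi n hn, Measure.zero_prod]
  · rw [XWmeas, Wmeas, h, hpi p hp, Measure.prod_zero]

theorem ae_inner_notMem {d n p : ℕ} (hd : 2 ≤ d)
    (hμ : IsSphereLaw √d (sphereUniform d √d)) (hν : IsSphereLaw 1 (sphereUniform d 1))
    {N : Set ℝ} (hN : volume N = 0) :
    ∀ᵐ ω ∂XWmeas d n p, ∀ i j, dotp (ω.1 i) (ω.2 j) ∉ N := by
  have := hμ.isProbabilityMeasure
  have := hν.isProbabilityMeasure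
  obtain ⟨N', hNN', hN'm, hN'0⟩ := exists_measurable_superset_of_null hN
  rw [ae_all_iff]
  intro i
  rw [ae_all_iff]
  intro j
  have hsX : SFinite (Xmeas d n) := by unfold Xmeas; infer_instance
  have hsW : SFinite (Wmeas d p) := by unfold Wmeas; infer_instance
  have hmp : MeasurePreserving (Prod.map (Function.eval i) (Function.eval j)) (XWmeas d n p)
      ((sphereUniform d √d).prod (sphereUniform d 1)) :=
    (measurePreserving_eval (fun _ : Fin n => sphereUniform d √d) i).prod
      (measurePreserving_eval (fun _ : Fin p => sphereUniform d 1) j)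
  have hm : MeasurableSet {q : EuclideanSpace ℝ (Fin d) × EuclideanSpace ℝ (Fin d) |
      ⟪q.1, q.2⟫ ∈ N'} :=
    (show Measurable fun q : EuclideanSpace ℝ (Fin d) × EuclideanSpace ℝ (Fin d) =>
      ⟪q.1, q.2⟫ by fun_prop) hN'm
  have h0 : ∀ᵐ q ∂(sphereUniform d √d).prod (sphereUniform d 1),
      ⟪q.1, q.2⟫ ∉ N' := by
    rw [ae_iff]
    simp only [not_not]
    rw [Measure.measure_prod_null hm]
    filter_upwards [hμ.norm_eq] with x hx
    have hx0 : x ≠ 0 := by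
      rw [← norm_ne_zero_iff, hx]
      exact (Real.sqrt_pos.2 (by positivity)).ne'
    have := hν.measure_inner_mem_eq_zero one_pos (by simpa using hd) hx0 hN'0
    simpa [real_inner_comm] using this
  filter_upwards [hmp.quasiMeasurePreserving.ae h0] with ω hω hmem
  exact hω (by simpa [dotp_eq_inner] using hNN' hmem)

theorem integral_sphere_of_tau1 {d : ℕ} (hd : 2 ≤ d)
    (hμ : IsSphereLaw √d (sphereUniform d √d)) {σ τ : ℝ → ℝ} (hτ : Measurable τ)
    (hN : volume {s | σ s ≠ τ s} = 0) {P : Polynomial ℝ} {j : ℕ}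
    (h : ∫ s, (σ s - P.eval s) * s ^ j ∂tau1 d = 0)
    {w : EuclideanSpace ℝ (Fin d)} (hw : ‖w‖ = 1) :
    ∫ x, (τ ⟪x, w⟫ - P.eval ⟪x, w⟫) * ⟪x, w⟫ ^ j ∂sphereUniform d √d = 0 := by
  have hd0 : 0 < d := by omega
  set e : EuclideanSpace ℝ (Fin d) := EuclideanSpace.single ⟨0, hd0⟩ 1 with he
  have he1 : ‖e‖ = 1 := by simp [he]
  have hτ1 : tau1 d = (sphereUniform d √d).map fun x => ⟪x, e⟫ := by
    unfold tau1
    congr 1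
    funext x
    simp [hd0, he, EuclideanSpace.inner_single_right]
  have hmeas : Measurable fun x : EuclideanSpace ℝ (Fin d) => ⟪x, e⟫ := by fun_prop
  have hae : ∀ᵐ s ∂tau1 d, σ s = τ s := by
    rw [hτ1]
    obtain ⟨N', hNN', hN'm, hN'0⟩ := exists_measurable_superset_of_null hN
    refine measure_mono_null (t := N') (fun s hs => hNN' hs) ?_
    rw [Measure.map_apply hmeas hN'm]
    exact hμ.measure_inner_mem_eq_zero (Real.sqrt_pos.2 (by positivity)) (by simpa using hd)
      (norm_ne_zero_iff.1 (by rw [he1]; exact one_ne_zero)) hN'0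
  rw [hμ.integral_comp_inner (hw.trans he1.symm) fun s => (τ s - P.eval s) * s ^ j, ← h,
    integral_congr_ae (g := fun s => (τ s - P.eval s) * s ^ j)
      (by filter_upwards [hae] with s hs; rw [hs]), hτ1,
    integral_map hmeas.aemeasurable]
  exact ((hτ.sub P.continuous.measurable).mul (measurable_id.pow_const j)).aestronglyMeasurable

theorem tendsto_pow_div_of_tendsto {n : ℕ → ℕ} {κ θ : ℝ} (hθ : 0 < θ)
    (hnl : Tendsto (fun d : ℕ => (n d : ℝ) / (d : ℝ) ^ κ) atTop (nhds θ)) {m : ℕ} (hm : m < κ) :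
    Tendsto (fun d : ℕ => ((d : ℝ) + 1) ^ m / n d) atTop (nhds 0) := by
  have h1 : Tendsto (fun d : ℕ => (1 + 1 / (d : ℝ)) ^ m) atTop (nhds 1) := by
    have := (tendsto_const_nhds (x := (1 : ℝ))).add tendsto_one_div_atTop_nhds_zero_nat
    simpa using this.pow m
  have h2 : Tendsto (fun d : ℕ => (d : ℝ) ^ (-(κ - m))) atTop (nhds 0) :=
    (tendsto_rpow_neg_atTop (sub_pos.2 hm)).comp tendsto_natCast_atTop_atTop
  have h3 := (h1.mul h2).div hnl hθ.ne'
  rw [one_mul, zero_div] at h3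
  refine h3.congr' ?_
  filter_upwards [eventually_gt_atTop 0] with d hd
  have hd' : (0 : ℝ) < d := by exact_mod_cast hd
  have hdκ : (0 : ℝ) < (d : ℝ) ^ κ := Real.rpow_pos_of_pos hd' κ
  simp only [Pi.div_apply]
  rw [neg_sub, Real.rpow_sub hd', Real.rpow_natCast]
  have : (1 + 1 / (d : ℝ)) ^ m = ((d : ℝ) + 1) ^ m / (d : ℝ) ^ m := by
    rw [← div_pow]; congr 1; field_simp
  rw [this]
  field_simp

end Assembly

/-- `E_{X,W} |Tr(Z R U_{<ℓ} R Zᵀ)| = o_d(1)`, where `σ_{<ℓ}` (represented by the polynomials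
`P d` of degree `< ℓ`) is the `L²(τ_{d,1})`-projection of `σ` onto polynomials of degree
`< ℓ = ⌈min(κ₁,κ₂)⌉`. -/
theorem low_degree_trace_term_vanishes
    (κ₁ κ₂ θ₁ θ₂ : ℝ) (hκ₁ : 0 < κ₁) (hκ₂ : 0 < κ₂) (hθ₁ : 0 < θ₁) (hθ₂ : 0 < θ₂)
    (p n : ℕ → ℕ) (hp : ∀ d, 0 < p d) (hn : ∀ d, 0 < n d)
    (hpl : Tendsto (fun d : ℕ => (p d : ℝ) / (d : ℝ) ^ κ₁) atTop (nhds θ₁))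
    (hnl : Tendsto (fun d : ℕ => (n d : ℝ) / (d : ℝ) ^ κ₂) atTop (nhds θ₂))
    (σ : ℝ → ℝ) (C₀ : ℝ) (hC₀ : 0 < C₀)
    (hgrow : ∀ s, |σ s| ≤ C₀ * (1 + |s|) ^ C₀)
    (hμne : ∀ k ≤ ⌈min κ₁ κ₂⌉₊, hermiteCoeff σ k ≠ 0)
    (hμgt : 0 < muGtSq σ ⌈min κ₁ κ₂⌉₊)
    (lam : ℝ) (hlam : 0 < lam)
    (P : ℕ → Polynomial ℝ)
    (hdeg : ∀ d, (P d).natDegree < ⌈min κ₁ κ₂⌉₊)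
    (hproj : ∀ d, ∀ j < ⌈min κ₁ κ₂⌉₊,
      (∫ s, (σ s - (P d).eval s) * s ^ j ∂tau1 d) = 0) :
    Tendsto (fun d : ℕ =>
      ∫⁻ ω, ENNReal.ofReal |Matrix.trace
          (Zmat d (n d) (p d) σ ω.1 ω.2 * Rmat d (n d) (p d) σ lam ω.1 ω.2 *
            UmatLow d (p d) (P d) ω.2 * Rmat d (n d) (p d) σ lam ω.1 ω.2 *
            (Zmat d (n d) (p d) σ ω.1 ω.2).transpose)|
        ∂XWmeas d (n d) (p d)) atTop (nhds 0) := by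
  obtain ⟨m, hm⟩ : ∃ m, ⌈min κ₁ κ₂⌉₊ = m + 1 :=
    Nat.exists_eq_succ_of_ne_zero (Nat.ceil_pos.2 (lt_min hκ₁ hκ₂)).ne'
  have hmκ : (m : ℝ) < κ₂ :=
    (Nat.lt_ceil.1 (by omega : m < ⌈min κ₁ κ₂⌉₊)).trans_le (min_le_right _ _)
  obtain ⟨τ, hτ, hτgrow, hN⟩ :=
    (aemeasurable_of_hermiteCoeff_zero_ne_zero (hμne 0 (Nat.zero_le _))).exists_measurable_growth
      (b := fun s => C₀ * (1 + |s|) ^ C₀) (by fun_prop) (fun s => by positivity) hgrow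
  obtain ⟨K, hK0, hK⟩ := exists_lintegral_sq_inner_le hC₀ hτgrow
  have hlim : Tendsto (fun d : ℕ => ENNReal.ofReal (((d : ℝ) + 1) ^ m / n d * (1 + K / lam)))
      atTop (nhds 0) := by
    have := (tendsto_pow_div_of_tendsto hθ₂ hnl hmκ).mul_const (1 + K / lam)
    rw [zero_mul] at this
    simpa using ENNReal.tendsto_ofReal this
  refine tendsto_of_tendsto_of_tendsto_of_le_of_le' tendsto_const_nhds hlim
    (Eventually.of_forall fun d => zero_le) ?_
  filter_upwards [eventually_ge_atTop 2] with d hd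
  rcases sphereUniform_eq_zero_or_isSphereLaw d √d with hμ | hμ
  · simp [XWmeas_eq_zero (hn d) (hp d) (Or.inl hμ)]
  rcases sphereUniform_eq_zero_or_isSphereLaw d 1 with hν | hν
  · simp [XWmeas_eq_zero (hn d) (hp d) (Or.inr hν)]
  have hle := lintegral_abs_trace_le hd (hn d) (hp d) hμ hν hτ (C := C₀ * (1 + √d) ^ C₀)
    (fun s hs => (hτgrow s).trans (by gcongr)) hK0 (hK d _ hν)
    (Nat.lt_succ_iff.1 (hm ▸ hdeg d))
    (fun w hw j hj => integral_sphere_of_tau1 hd hμ hτ hN (hproj d j (by omega)) hw) hlam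
  refine (lintegral_congr_ae ?_).trans_le hle
  filter_upwards [ae_inner_notMem hd hμ hν hN] with ω hω
  have hZ : Zmat d (n d) (p d) σ ω.1 ω.2 = Zmat d (n d) (p d) τ ω.1 ω.2 := by
    unfold Zmat
    congr 1
    ext i j
    simpa [entrywise] using hω i j
  simp only [Rmat, hZ]

end
end

section
/- For every (n,d)-multi-labeling of the h-graph with h ≥ 2, one has k·r_n + r_d ≤ k(h+1); equivalently, Δ ≥ 0. -/
/-!
Nonnegativity of the excess `Δ` of an `(n,d)`-multi-labeling (Lemma "Delta_geq_0").
-/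

noncomputable section

/-- The number of edges between `d`-vertices carrying the `d`-label `j` and `n`-vertices
carrying the `n`-label `a` in the cyclic `h`-graph. -/
def edgeCount {h k n d : ℕ} [NeZero h] (idx : ZMod h → Fin n) (lbl : ZMod h → Fin k → Fin d)
    (a : Fin n) (j : Fin d) : ℕ :=
  ∑ s : ZMod h, (if ∃ b, lbl s b = j then 1 else 0) *
    ((if idx s = a then 1 else 0) + (if idx (s + 1) = a then 1 else 0))

/-- An `(n,d)`-multi-labeling of the `h`-graph: `n`-labels `i_s` and injective ordered
`d`-vertex labels `J_s` around the `2h`-cycle, with `i_s ≠ i_{s+1}` and all edge counts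
`b_{a,j}` even. -/
structure MultiLabeling (h k n d : ℕ) [NeZero h] where
  /-- `n`-labels of the `n`-vertices. -/
  idx : ZMod h → Fin n
  /-- Ordered `d`-vertex labels (injective `k`-tuples with entries in `Fin d`). -/
  lbl : ZMod h → Fin k → Fin d
  lbl_inj : ∀ s, Function.Injective (lbl s)
  idx_ne : ∀ s, idx s ≠ idx (s + 1)
  even_edge : ∀ a j, Even (edgeCount idx lbl a j)

variable {h k n d : ℕ} [NeZero h]

/-- `r_n`: the number of distinct `n`-labels. -/
def rn (L : MultiLabeling h k n d) : ℕ := (Finset.univ.image L.idx).card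

/-- `r_d`: the number of distinct `d`-labels. -/
def rd (L : MultiLabeling h k n d) : ℕ :=
  (Finset.univ.biUnion fun s => Finset.univ.image (L.lbl s)).card

/-- `Δ = k(h+1) − (k r_n + r_d)`. -/
def Δlab (L : MultiLabeling h k n d) : ℤ :=
  (k : ℤ) * (h + 1) - ((k : ℤ) * rn L + rd L)

namespace MultiLabeling

/-- The pairs of an `n`-label and a `d`-label joined by at least one edge. -/
def incidentPairs (L : MultiLabeling h k n d) : Finset (Fin n × Fin d) :=
  Finset.univ.filter fun p => edgeCount L.idx L.lbl p.1 p.2 ≠ 0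

/-- The first time at which the walk visits the `n`-label `a`. -/
def firstVisit (L : MultiLabeling h k n d) (a : Fin n) : ℕ :=
  sInf {t : ℕ | L.idx (t : ZMod h) = a}

/-- The first time at which the `d`-label `j` is used. -/
def firstUse (L : MultiLabeling h k n d) (j : Fin d) : ℕ :=
  sInf {t : ℕ | ∃ b, L.lbl (t : ZMod h) b = j}

theorem idx_firstVisit (L : MultiLabeling h k n d) (s : ZMod h) :
    L.idx (L.firstVisit (L.idx s) : ZMod h) = L.idx s :=
  Nat.sInf_mem (s := {t : ℕ | L.idx (t : ZMod h) = L.idx s})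
    ⟨s.val, by simp only [Set.mem_ofPred_eq, ZMod.natCast_zmod_val]⟩

theorem exists_lbl_firstUse (L : MultiLabeling h k n d) (s : ZMod h) (b : Fin k) :
    ∃ c, L.lbl (L.firstUse (L.lbl s b) : ZMod h) c = L.lbl s b :=
  Nat.sInf_mem (s := {t : ℕ | ∃ c, L.lbl (t : ZMod h) c = L.lbl s b})
    ⟨s.val, b, by simp only [ZMod.natCast_zmod_val]⟩

theorem firstUse_le (L : MultiLabeling h k n d) (t : ℕ) (b : Fin k) :
    L.firstUse (L.lbl (t : ZMod h) b) ≤ t :=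
  Nat.sInf_le ⟨b, rfl⟩

theorem firstVisit_le (L : MultiLabeling h k n d) (t : ℕ) :
    L.firstVisit (L.idx (t : ZMod h)) ≤ t :=
  Nat.sInf_le rfl

theorem firstVisit_ne_zero (L : MultiLabeling h k n d) {s : ZMod h} (hs : L.idx s ≠ L.idx 0) :
    L.firstVisit (L.idx s) ≠ 0 := by
  intro h0
  have := L.idx_firstVisit s
  rw [h0, Nat.cast_zero] at this
  exact hs this.symm

theorem mem_incidentPairs (L : MultiLabeling h k n d) {a : Fin n} (s : ZMod h) (b : Fin k)
    (hs : L.idx s = a ∨ L.idx (s + 1) = a) : (a, L.lbl s b) ∈ L.incidentPairs := by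
  simp only [incidentPairs, Finset.mem_filter, Finset.mem_univ, true_and, edgeCount, ne_eq,
    Finset.sum_eq_zero_iff, true_imp_iff, not_forall]
  refine ⟨s, ?_⟩
  rw [if_pos ⟨b, rfl⟩]
  rcases hs with hs | hs <;> simp [hs]

theorem sum_edgeCount (L : MultiLabeling h k n d) :
    ∑ p : Fin n × Fin d, edgeCount L.idx L.lbl p.1 p.2 = 2 * (k * h) := by
  have hlabels (s : ZMod h) : ∑ j : Fin d, (if ∃ b, L.lbl s b = j then 1 else 0) = k := by
    rw [Finset.sum_boole, Nat.cast_id]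
    have : (Finset.univ.filter fun j => ∃ b, L.lbl s b = j) = Finset.univ.image (L.lbl s) := by
      ext j
      simp
    rw [this, Finset.card_image_of_injective _ (L.lbl_inj s), Finset.card_fin]
  simp only [edgeCount]
  rw [Finset.sum_comm]
  have hstep (s : ZMod h) : ∑ p : Fin n × Fin d, (if ∃ b, L.lbl s b = p.2 then 1 else 0) *
      ((if L.idx s = p.1 then 1 else 0) + (if L.idx (s + 1) = p.1 then 1 else 0)) = 2 * k := by
    rw [Fintype.sum_prod_type_right, ← Finset.sum_mul_sum Finset.univ Finset.univ
      (fun j => if ∃ b, L.lbl s b = j then 1 else 0)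
      (fun a => (if L.idx s = a then 1 else 0) + (if L.idx (s + 1) = a then 1 else 0)), hlabels]
    simp [Finset.sum_add_distrib, mul_comm]
  simp only [hstep, Finset.sum_const, Finset.card_univ, ZMod.card, smul_eq_mul]
  ring

theorem card_incidentPairs_le (L : MultiLabeling h k n d) : L.incidentPairs.card ≤ k * h := by
  have hle : L.incidentPairs.card * 2 ≤ 2 * (k * h) := by
    rw [← L.sum_edgeCount, ← smul_eq_mul]
    refine (Finset.card_nsmul_le_sum _ _ 2 fun p hp => ?_).trans
      (Finset.sum_le_sum_of_subset (Finset.subset_univ L.incidentPairs))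
    have hne := (Finset.mem_filter.mp hp).2
    obtain ⟨m, hm⟩ := L.even_edge p.1 p.2
    omega
  omega

/-- Each `n`-label other than the initial one is entered first along `k` edges, and each `d`-label
is first used along an edge; these edges join distinct pairs of labels. -/
theorem add_le_card_incidentPairs (L : MultiLabeling h k n d) :
    (rn L - 1) * k + rd L ≤ L.incidentPairs.card := by
  set A := (Finset.univ.image L.idx).erase (L.idx 0) ×ˢ (Finset.univ : Finset (Fin k)) with hA
  set D := Finset.univ.biUnion fun s => Finset.univ.image (L.lbl s) with hD
  let f : Fin n × Fin k → Fin n × Fin d :=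
    fun p => (p.1, L.lbl ((L.firstVisit p.1 - 1 : ℕ) : ZMod h) p.2)
  let g : Fin d → Fin n × Fin d := fun j => (L.idx (L.firstUse j : ZMod h), j)
  have hAcard : A.card = (rn L - 1) * k := by
    rw [hA, Finset.card_product, Finset.card_erase_of_mem (by simp), Finset.card_fin, rn]
  have hf : Function.Injective f := by
    rintro ⟨a, b⟩ ⟨a', b'⟩ hab
    obtain ⟨rfl, hb⟩ := Prod.mk.inj hab
    exact congrArg (Prod.mk a) (L.lbl_inj _ hb)
  have hg : Function.Injective g := fun j j' hj => (Prod.mk.inj hj).2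
  have hdisj : Disjoint (A.image f) (D.image g) := by
    rw [Finset.disjoint_left]
    intro p hp hp'
    obtain ⟨⟨a, b⟩, hab, rfl⟩ := Finset.mem_image.mp hp
    obtain ⟨j, -, hj⟩ := Finset.mem_image.mp hp'
    obtain ⟨ha, rfl⟩ := Prod.mk.inj hj
    simp only [hA, Finset.mem_product, Finset.mem_erase, Finset.mem_image, Finset.mem_univ,
      true_and, and_true] at hab
    obtain ⟨hne, s, rfl⟩ := hab
    have h1 := L.firstVisit_ne_zero hne
    have h2 := L.firstUse_le (L.firstVisit (L.idx s) - 1) b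
    have h3 := L.firstVisit_le (L.firstUse (L.lbl ((L.firstVisit (L.idx s) - 1 : ℕ) : ZMod h) b))
    rw [ha] at h3
    dsimp only at h3
    omega
  rw [← hAcard, rd, ← hD, ← Finset.card_image_of_injective A hf,
    ← Finset.card_image_of_injective D hg, ← Finset.card_union_of_disjoint hdisj]
  refine Finset.card_le_card (Finset.union_subset ?_ ?_)
  · intro p hp
    obtain ⟨⟨a, b⟩, hab, rfl⟩ := Finset.mem_image.mp hp
    simp only [hA, Finset.mem_product, Finset.mem_erase, Finset.mem_image, Finset.mem_univ,
      true_and, and_true] at hab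
    obtain ⟨hne, s, rfl⟩ := hab
    refine L.mem_incidentPairs _ b (Or.inr ?_)
    rw [← Nat.cast_add_one, Nat.sub_add_cancel (Nat.pos_of_ne_zero (L.firstVisit_ne_zero hne)),
      L.idx_firstVisit]
  · intro p hp
    obtain ⟨j, hj, rfl⟩ := Finset.mem_image.mp hp
    simp only [hD, Finset.mem_biUnion, Finset.mem_image, Finset.mem_univ, true_and] at hj
    obtain ⟨s, b, rfl⟩ := hj
    obtain ⟨c, hc⟩ := L.exists_lbl_firstUse s b
    have := L.mem_incidentPairs (L.firstUse (L.lbl s b) : ZMod h) c (Or.inl rfl)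
    rwa [hc] at this

end MultiLabeling

/-- For every `(n,d)`-multi-labeling of the `h`-graph, `k r_n + r_d ≤ k(h+1)`;
equivalently `Δ ≥ 0`. -/
theorem multiLabeling_delta_nonneg
    (hh : 2 ≤ h) (hk : 1 ≤ k) (hn : 2 ≤ n) (hd : k ≤ d)
    (L : MultiLabeling h k n d) :
    k * rn L + rd L ≤ k * (h + 1) ∧ 0 ≤ Δlab L := by
  have hmain : k * rn L + rd L ≤ k * (h + 1) := by
    have hle := L.add_le_card_incidentPairs.trans L.card_incidentPairs_le
    have hpos : 0 < rn L := Finset.card_pos.mpr ⟨L.idx 0, by simp⟩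
    obtain ⟨m, hm⟩ := Nat.exists_eq_add_of_le' hpos
    rw [hm, Nat.add_sub_cancel] at hle
    rw [hm]
    linarith
  refine ⟨hmain, ?_⟩
  rw [Δlab, sub_nonneg]
  exact_mod_cast hmain

end
end

section
/- For every (n,d)-multi-labeling of the h-graph with h ≥ 2, one has Σ_{a=1}^{n} Σ_{j=1}^{d} b_{a,j}·1{b_{a,j} > 2} ≤ 12·Δ. -/
/-!
Bound on the total number of high-multiplicity edges of an `(n,d)`-multi-labeling
(Lemma "S_L_ubd").
-/

noncomputable section

variable {h k n d : ℕ} [NeZero h]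

/-- Along a walk `x` whose step `s` carries the label set `J s` of size `k`, each newly visited
vertex contributes `k` new incident pairs and each new label at least one more. -/
theorem card_visited_add_card_labels_le {α β : Type*} [DecidableEq α] [DecidableEq β] {k : ℕ}
    (x : ℕ → α) (J : ℕ → Finset β) (hJ : ∀ s, (J s).card = k) (t : ℕ) :
    k * ((Finset.range (t + 1)).image x).card + ((Finset.range t).biUnion J).card ≤
      ((Finset.range t).biUnion fun s => ({x s, x (s + 1)} : Finset α) ×ˢ J s).card + k := by
  induction t with
  | zero => simp
  | succ t ih =>
    rw [Finset.range_add_one (n := t + 1), Finset.image_insert, Finset.range_add_one (n := t),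
      Finset.biUnion_insert, Finset.biUnion_insert, ← Finset.range_add_one]
    set A := (Finset.range (t + 1)).image x with hA
    set D := (Finset.range t).biUnion J with hD
    set P := (Finset.range t).biUnion fun s => ({x s, x (s + 1)} : Finset α) ×ˢ J s with hP
    have hPsub : ∀ p ∈ P, p.1 ∈ A ∧ p.2 ∈ D := by
      intro p hp
      simp only [hP, Finset.mem_biUnion, Finset.mem_product, Finset.mem_insert,
        Finset.mem_singleton, Finset.mem_range] at hp
      obtain ⟨s, hs, hx, hj⟩ := hp
      refine ⟨Finset.mem_image.2 ?_, Finset.mem_biUnion.2 ⟨s, Finset.mem_range.2 hs, hj⟩⟩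
      rcases hx with h | h
      · exact ⟨s, Finset.mem_range.2 (by omega), h.symm⟩
      · exact ⟨s + 1, Finset.mem_range.2 (by omega), h.symm⟩
    have hxt : x t ∈ A := Finset.mem_image_of_mem x (Finset.mem_range.2 (by omega))
    have hDcard : (J t ∪ D).card = (J t \ D).card + D.card := by
      rw [← Finset.sdiff_union_self_eq_union, Finset.card_union_of_disjoint Finset.sdiff_disjoint]
    have hdisj : Disjoint (({x t} : Finset α) ×ˢ (J t \ D)) P := by
      rw [Finset.disjoint_left]
      intro p hp hpP
      exact (Finset.mem_sdiff.1 (Finset.mem_product.1 hp).2).2 (hPsub p hpP).2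
    have hQcard : (({x t} : Finset α) ×ˢ (J t \ D) ∪ P).card = (J t \ D).card + P.card := by
      rw [Finset.card_union_of_disjoint hdisj, Finset.card_product, Finset.card_singleton, one_mul]
    have hQsub : ({x t} : Finset α) ×ˢ (J t \ D) ∪ P ⊆
        ({x t, x (t + 1)} : Finset α) ×ˢ J t ∪ P :=
      Finset.union_subset_union_left
        (Finset.product_subset_product (by simp) Finset.sdiff_subset)
    by_cases hnew : x (t + 1) ∈ A
    · rw [Finset.insert_eq_of_mem hnew]
      have := Finset.card_le_card hQsub
      omega
    · have hdisj' : Disjoint (({x (t + 1)} : Finset α) ×ˢ J t)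
          (({x t} : Finset α) ×ˢ (J t \ D) ∪ P) := by
        rw [Finset.disjoint_left]
        intro p hp hpQ
        have hp1 : p.1 = x (t + 1) := Finset.mem_singleton.1 (Finset.mem_product.1 hp).1
        apply hnew
        rw [← hp1]
        rcases Finset.mem_union.1 hpQ with h | h
        · rw [Finset.mem_singleton.1 (Finset.mem_product.1 h).1]
          exact hxt
        · exact (hPsub p h).1
      have hsub : ({x (t + 1)} : Finset α) ×ˢ J t ∪ (({x t} : Finset α) ×ˢ (J t \ D) ∪ P) ⊆
          ({x t, x (t + 1)} : Finset α) ×ˢ J t ∪ P :=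
        Finset.union_subset
          ((Finset.product_subset_product (by simp) subset_rfl).trans Finset.subset_union_left) hQsub
      have hle := Finset.card_le_card hsub
      rw [Finset.card_union_of_disjoint hdisj', hQcard, Finset.card_product,
        Finset.card_singleton, one_mul, hJ] at hle
      rw [Finset.card_insert_of_notMem hnew, mul_add, mul_one]
      omega

/-- The edge counts add up to the number `2kh` of edges of the `h`-graph. -/
theorem sum_edgeCount (L : MultiLabeling h k n d) :
    ∑ a : Fin n, ∑ j : Fin d, edgeCount L.idx L.lbl a j = 2 * (k * h) := by
  have hstep : ∀ s : ZMod h, (∑ a : Fin n, ∑ j : Fin d, (if ∃ b, L.lbl s b = j then 1 else 0) *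
      ((if L.idx s = a then 1 else 0) + (if L.idx (s + 1) = a then 1 else 0))) = 2 * k := by
    intro s
    have hcard : (∑ j : Fin d, if ∃ b, L.lbl s b = j then 1 else 0) = k := by
      rw [← Finset.card_filter, Finset.univ_filter_exists,
        Finset.card_image_of_injective _ (L.lbl_inj s), Finset.card_univ, Fintype.card_fin]
    simp_rw [← Finset.sum_mul, hcard, ← Finset.mul_sum, Finset.sum_add_distrib]
    simp [mul_comm]
  unfold edgeCount
  simp_rw [Finset.sum_comm (s := (Finset.univ : Finset (Fin d)))
    (t := (Finset.univ : Finset (ZMod h)))]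
  rw [Finset.sum_comm, Finset.sum_congr rfl fun s _ => hstep s, Finset.sum_const,
    Finset.card_univ, ZMod.card, smul_eq_mul]
  ring

/-- An incident pair `(a, j)` of the `h`-graph has a positive edge count. -/
theorem edgeCount_pos_of_mem (L : MultiLabeling h k n d) {s : ZMod h} {a : Fin n} {j : Fin d}
    (ha : a = L.idx s ∨ a = L.idx (s + 1)) (hj : ∃ b, L.lbl s b = j) :
    0 < edgeCount L.idx L.lbl a j := by
  refine Finset.sum_pos' (fun _ _ => Nat.zero_le _) ⟨s, Finset.mem_univ s, ?_⟩
  rw [if_pos hj]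
  rcases ha with rfl | rfl <;> simp

/-- The number of pairs `(a, j)` with positive edge count is at least `k (r_n - 1) + r_d`. -/
theorem rn_add_rd_le (L : MultiLabeling h k n d) :
    k * rn L + rd L ≤ (Finset.univ.filter fun p : Fin n × Fin d =>
      0 < edgeCount L.idx L.lbl p.1 p.2).card + k := by
  have key := card_visited_add_card_labels_le (fun t : ℕ => L.idx (t : ZMod h))
    (fun t : ℕ => Finset.univ.image (L.lbl (t : ZMod h)))
    (fun t => by rw [Finset.card_image_of_injective _ (L.lbl_inj _), Finset.card_univ,
      Fintype.card_fin]) h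
  have hrn : rn L ≤ ((Finset.range (h + 1)).image fun t : ℕ => L.idx (t : ZMod h)).card := by
    refine Finset.card_le_card fun a ha => ?_
    obtain ⟨s, -, rfl⟩ := Finset.mem_image.1 ha
    exact Finset.mem_image.2 ⟨s.val, Finset.mem_range.2 ((ZMod.val_lt s).trans h.lt_succ_self),
      by rw [ZMod.natCast_zmod_val]⟩
  have hrd : rd L ≤
      ((Finset.range h).biUnion fun t : ℕ => Finset.univ.image (L.lbl (t : ZMod h))).card := by
    refine Finset.card_le_card fun j hj => ?_
    obtain ⟨s, -, hs⟩ := Finset.mem_biUnion.1 hj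
    exact Finset.mem_biUnion.2 ⟨s.val, Finset.mem_range.2 (ZMod.val_lt s),
      by rwa [ZMod.natCast_zmod_val]⟩
  refine (add_le_add (Nat.mul_le_mul_left k hrn) hrd).trans (key.trans ?_)
  refine Nat.add_le_add_right (Finset.card_le_card fun p hp => ?_) k
  simp only [Finset.mem_biUnion, Finset.mem_product, Finset.mem_insert, Finset.mem_singleton,
    Finset.mem_image, Finset.mem_univ, true_and, Nat.cast_add, Nat.cast_one] at hp
  obtain ⟨s, -, ha, hj⟩ := hp
  exact Finset.mem_filter.2 ⟨Finset.mem_univ p, edgeCount_pos_of_mem L ha hj⟩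

/-- For every `(n,d)`-multi-labeling of the `h`-graph,
`∑_{a,j} b_{a,j} 1{b_{a,j} > 2} ≤ 12 Δ`. -/
theorem multiLabeling_high_multiplicity_edge_bound
    (hh : 2 ≤ h) (hk : 1 ≤ k) (hn : 2 ≤ n) (hd : k ≤ d)
    (L : MultiLabeling h k n d) :
    (∑ a : Fin n, ∑ j : Fin d,
        if 2 < edgeCount L.idx L.lbl a j then (edgeCount L.idx L.lbl a j : ℤ) else 0) ≤
      12 * Δlab L := by
  have hpoint : ∀ a j, (if 2 < edgeCount L.idx L.lbl a j then (edgeCount L.idx L.lbl a j : ℤ)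
      else 0) ≤ 2 * (edgeCount L.idx L.lbl a j : ℤ) -
        4 * (if 0 < edgeCount L.idx L.lbl a j then 1 else 0) := by
    intro a j
    obtain ⟨m, hm⟩ := L.even_edge a j
    split_ifs <;> omega
  have hle := Finset.sum_le_sum fun a (_ : a ∈ Finset.univ) =>
    Finset.sum_le_sum fun j (_ : j ∈ Finset.univ) => hpoint a j
  have hnonneg : (0 : ℤ) ≤ ∑ a : Fin n, ∑ j : Fin d,
      if 2 < edgeCount L.idx L.lbl a j then (edgeCount L.idx L.lbl a j : ℤ) else 0 :=
    Finset.sum_nonneg fun a _ => Finset.sum_nonneg fun j _ => by split_ifs <;> omega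
  have hsum : (∑ a : Fin n, ∑ j : Fin d, (edgeCount L.idx L.lbl a j : ℤ)) = 2 * (k * h) := by
    exact_mod_cast sum_edgeCount L
  have hcount : (∑ a : Fin n, ∑ j : Fin d,
      if 0 < edgeCount L.idx L.lbl a j then (1 : ℤ) else 0) =
      ((Finset.univ.filter fun p : Fin n × Fin d =>
        0 < edgeCount L.idx L.lbl p.1 p.2).card : ℤ) := by
    rw [Finset.card_filter, Nat.cast_sum, ← Finset.univ_product_univ, Finset.sum_product]
    simp
  have hvert : (k : ℤ) * rn L + rd L ≤ ((Finset.univ.filter fun p : Fin n × Fin d =>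
      0 < edgeCount L.idx L.lbl p.1 p.2).card : ℤ) + k := by
    exact_mod_cast rn_add_rd_le L
  simp_rw [Finset.sum_sub_distrib, ← Finset.mul_sum] at hle
  rw [hsum, hcount] at hle
  unfold Δlab
  rw [mul_add, mul_one]
  linarith

end
end

section
/- For every (n,d)-multi-labeling of the h-graph with h ≥ 2, define N_j := Σ_{s ∈ ℤ/hℤ} 1{j ∈ range(J_s)} for j ∈ {1,…,d}. Then: (i) if N_j > 0 then N_j ≥ 2; (ii) if the labeling has no singleton — that is, every value a occurring among i₁,…,i_h occurs at least twice — then Σ_{j=1}^{d} N_j·1{N_j > 2} ≤ 6·(Δ − k). -/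
/-!
Multiplicities `N_j` of `d`-labels in an `(n,d)`-multi-labeling: evenness-forced doubling and
a bound on high multiplicities in the absence of singletons (Lemma on `N_j`).
-/

noncomputable section

variable {h k n d : ℕ} [NeZero h]

/-- `N_j`: the number of `d`-vertices whose label contains `j`. -/
def dLabelCount (L : MultiLabeling h k n d) (j : Fin d) : ℕ :=
  ∑ s : ZMod h, if ∃ b, L.lbl s b = j then 1 else 0

theorem dLabelCount_eq_card (L : MultiLabeling h k n d) (j : Fin d) :
    dLabelCount L j = (Finset.univ.filter fun s => ∃ b, L.lbl s b = j).card := by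
  simp [dLabelCount]

theorem dLabelCount_ne_one (L : MultiLabeling h k n d) (j : Fin d) : dLabelCount L j ≠ 1 := by
  intro h1
  rw [dLabelCount_eq_card, Finset.card_eq_one] at h1
  obtain ⟨s, hs⟩ := h1
  have key : ∀ t, (∃ b, L.lbl t b = j) ↔ t = s := fun t => by
    simpa using Finset.ext_iff.mp hs t
  have he := L.even_edge (L.idx s) j
  simp [edgeCount, key, (L.idx_ne s).symm] at he

theorem sum_dLabelCount (L : MultiLabeling h k n d) : ∑ j, dLabelCount L j = k * h := by
  unfold dLabelCount
  rw [Finset.sum_comm]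
  have hrow : ∀ s : ZMod h, (∑ j : Fin d, if ∃ b, L.lbl s b = j then 1 else 0) = k := fun s => by
    have him : (Finset.univ.filter fun j => ∃ b, L.lbl s b = j) =
        Finset.univ.image (L.lbl s) := by
      ext j
      simp
    rw [← Finset.card_filter, him, Finset.card_image_of_injective _ (L.lbl_inj s)]
    simp
  simp [hrow, ZMod.card, mul_comm]

theorem rd_eq_sum (L : MultiLabeling h k n d) :
    rd L = ∑ j, if 0 < dLabelCount L j then 1 else 0 := by
  rw [rd, ← Finset.card_filter]
  congr 1
  ext j
  simp [dLabelCount_eq_card, Finset.card_pos, Finset.Nonempty]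

theorem two_mul_rn_le (L : MultiLabeling h k n d)
    (hL : ∀ s : ZMod h, ∃ s' : ZMod h, s' ≠ s ∧ L.idx s' = L.idx s) : 2 * rn L ≤ h := by
  have hcard := Finset.mul_card_image_le_card_of_maps_to (s := Finset.univ)
    (t := Finset.univ.image L.idx) (f := L.idx) (fun s _ => by simp) 2 (fun a ha => by
      obtain ⟨s, -, rfl⟩ := Finset.mem_image.mp ha
      obtain ⟨s', hne, heq⟩ := hL s
      exact Finset.one_lt_card.mpr ⟨s', by simp [heq], s, by simp, hne⟩)
  simpa [rn, ZMod.card] using hcard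

/-- (i) Any occurring `d`-label occurs at least twice; (ii) if the labeling has no singleton
(each occurring `n`-label occurs at least twice), then
`∑_j N_j 1{N_j > 2} ≤ 6 (Δ − k)`. -/
theorem multiLabeling_dLabelCount_bounds
    (hh : 2 ≤ h) (hk : 1 ≤ k) (hn : 2 ≤ n) (hd : k ≤ d)
    (L : MultiLabeling h k n d) :
    (∀ j : Fin d, 0 < dLabelCount L j → 2 ≤ dLabelCount L j) ∧
    ((∀ s : ZMod h, ∃ s' : ZMod h, s' ≠ s ∧ L.idx s' = L.idx s) →
      (∑ j : Fin d, if 2 < dLabelCount L j then (dLabelCount L j : ℤ) else 0) ≤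
        6 * (Δlab L - k)) := by
  have two_le : ∀ j : Fin d, 0 < dLabelCount L j → 2 ≤ dLabelCount L j := fun j hj => by
    have := dLabelCount_ne_one L j
    omega
  refine ⟨two_le, fun hL => ?_⟩
  have hsum : (∑ j : Fin d, if 2 < dLabelCount L j then (dLabelCount L j : ℤ) else 0) +
      6 * (rd L : ℤ) ≤ 3 * (k * h) := by
    have hN : ((k * h : ℕ) : ℤ) = ∑ j, (dLabelCount L j : ℤ) := by
      rw [← sum_dLabelCount L]
      push_cast
      rfl
    push_cast at hN
    rw [hN, rd_eq_sum]
    push_cast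
    rw [Finset.mul_sum, Finset.mul_sum, ← Finset.sum_add_distrib]
    refine Finset.sum_le_sum fun j _ => ?_
    have := two_le j
    split_ifs <;> omega
  have hrn : (k : ℤ) * (2 * rn L) ≤ k * h :=
    mul_le_mul_of_nonneg_left (by exact_mod_cast two_mul_rn_le L hL) (by positivity)
  unfold Δlab
  linarith

end
end

section
/- For every (n,d)-multi-labeling of the h-graph with h ≥ 2, and for 1 ≤ a < a' ≤ n, define P_{a,a'} := the number of s ∈ ℤ/hℤ such that {i_s, i_{s+1}} = {a, a'}. Then Σ_{1 ≤ a < a' ≤ n} P_{a,a'}·1{P_{a,a'} > 2} ≤ 6·(6 + 1/k)·Δ. -/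
/-!
Bound on the number of consecutive `n`-label pairs of high multiplicity
(Lemma "conseq_npair_ubd").
-/

noncomputable section

variable {h k n d : ℕ} [NeZero h]

/-- `P_{a,a'}`: the number of `s` such that `{i_s, i_{s+1}} = {a, a'}`. -/
def pairCount (L : MultiLabeling h k n d) (a a' : Fin n) : ℕ :=
  (Finset.univ.filter fun s : ZMod h =>
    ({L.idx s, L.idx (s + 1)} : Finset (Fin n)) = {a, a'}).card

/-- The mod 2 boundary of the `s`-th step of the closed walk of `n`-labels. -/
def stepBoundary (L : MultiLabeling h k n d) (s : ZMod h) : Fin n → ZMod 2 :=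
  Pi.single (L.idx s) 1 + Pi.single (L.idx (s + 1)) 1

/-- The positions whose tuple of `d`-labels contains `j`. -/
def labelSupport (L : MultiLabeling h k n d) (j : Fin d) : Finset (ZMod h) :=
  Finset.univ.filter fun s => ∃ b, L.lbl s b = j

/-- The positions `s` with `{i_s, i_{s+1}} = {a, a'}`. -/
def pairSupport (L : MultiLabeling h k n d) (a a' : Fin n) : Finset (ZMod h) :=
  Finset.univ.filter fun s : ZMod h =>
    ({L.idx s, L.idx (s + 1)} : Finset (Fin n)) = {a, a'}

lemma mem_labelSupport (L : MultiLabeling h k n d) {j : Fin d} {s : ZMod h} :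
    s ∈ labelSupport L j ↔ ∃ b, L.lbl s b = j := by
  simp [labelSupport]

lemma stepBoundary_eq_sum (L : MultiLabeling h k n d) (s : ZMod h) :
    stepBoundary L s =
      ∑ c ∈ ({L.idx s, L.idx (s + 1)} : Finset (Fin n)), Pi.single c (1 : ZMod 2) := by
  rw [Finset.sum_pair (L.idx_ne s), stepBoundary]

lemma stepBoundary_eq_of_mem_pairSupport (L : MultiLabeling h k n d) {a a' : Fin n}
    {s t : ZMod h} (hs : s ∈ pairSupport L a a') (ht : t ∈ pairSupport L a a') :
    stepBoundary L s = stepBoundary L t := by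
  simp only [pairSupport, Finset.mem_filter, Finset.mem_univ, true_and] at hs ht
  rw [stepBoundary_eq_sum, stepBoundary_eq_sum, hs, ht]

lemma stepBoundary_ne_zero (L : MultiLabeling h k n d) (s : ZMod h) : stepBoundary L s ≠ 0 := by
  intro h0
  have := congrFun h0 (L.idx s)
  simp [stepBoundary, Pi.single_eq_of_ne (L.idx_ne s)] at this

/-- The steps carrying a fixed `d`-label form a cycle mod 2. -/
lemma sum_stepBoundary_labelSupport (L : MultiLabeling h k n d) (j : Fin d) :
    ∑ s ∈ labelSupport L j, stepBoundary L s = 0 := by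
  ext a
  have hev := (ZMod.natCast_eq_zero_iff_even).2 (L.even_edge a j)
  rw [edgeCount] at hev
  push_cast at hev
  rw [Finset.sum_apply, labelSupport, Finset.sum_filter]
  refine (Finset.sum_congr rfl fun s _ => ?_).trans hev
  simp only [stepBoundary, Pi.add_apply, Pi.single_apply, eq_comm (a := a), ite_mul, one_mul,
    zero_mul]

/-- Sub-sums of a linearly independent family over `ZMod 2` determine the index set. -/
lemma LinearIndepOn.eq_of_sum_eq {ι V : Type*} [DecidableEq ι] [AddCommGroup V]
    [Module (ZMod 2) V] {v : ι → V} {T S₁ S₂ : Finset ι} (hT : LinearIndepOn (ZMod 2) v (T : Set ι))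
    (h₁ : S₁ ⊆ T) (h₂ : S₂ ⊆ T) (h : ∑ s ∈ S₁, v s = ∑ s ∈ S₂, v s) : S₁ = S₂ := by
  rw [linearIndepOn_finset_iff] at hT
  have key := hT (fun i => (if i ∈ S₁ then 1 else 0) - (if i ∈ S₂ then 1 else 0)) (by
    simp only [sub_smul, Finset.sum_sub_distrib, ite_smul, one_smul, zero_smul,
      ← Finset.sum_filter, Finset.filter_mem_eq_inter, Finset.inter_eq_right.2 h₁,
      Finset.inter_eq_right.2 h₂, h, sub_self])
  ext i
  by_cases hi : i ∈ T
  · have := key i hi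
    by_cases h1 : i ∈ S₁ <;> by_cases h2 : i ∈ S₂ <;> simp_all
  · exact ⟨fun h => absurd (h₁ h) hi, fun h => absurd (h₂ h) hi⟩

/-- The closed walk of `n`-labels has a spanning tree. -/
lemma exists_spanning_steps (L : MultiLabeling h k n d) :
    ∃ T : Finset (ZMod h), LinearIndepOn (ZMod 2) (stepBoundary L) (T : Set (ZMod h)) ∧
      rn L ≤ T.card + 1 := by
  classical
  obtain ⟨b, -, -, hspan, hb⟩ := exists_linearIndepOn_extension
    (linearIndepOn_empty (ZMod 2) (stepBoundary L)) (Set.empty_subset Set.univ)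
  refine ⟨b.toFinite.toFinset, by simpa using hb, ?_⟩
  set T := b.toFinite.toFinset
  set W : Finset (Fin n → ZMod 2) := insert (Pi.single (L.idx 0) 1) (T.image (stepBoundary L))
  have hstep : ∀ s, stepBoundary L s ∈ Submodule.span (ZMod 2) (W : Set (Fin n → ZMod 2)) := by
    intro s
    refine Submodule.span_mono ?_ (hspan ⟨s, trivial, rfl⟩)
    simp [W, T]
  have hnat : ∀ m : ℕ, (Pi.single (L.idx (m : ZMod h)) 1 : Fin n → ZMod 2) ∈
      Submodule.span (ZMod 2) (W : Set (Fin n → ZMod 2)) := by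
    intro m
    induction m with
    | zero => exact Submodule.subset_span (by simp [W])
    | succ m ih =>
      have := Submodule.sub_mem _ (hstep m) ih
      simpa [stepBoundary] using this
  have hli : LinearIndepOn (ZMod 2) (fun a : Fin n => (Pi.single a 1 : Fin n → ZMod 2))
      ((Finset.univ.image L.idx : Finset (Fin n)) : Set (Fin n)) :=
    (Pi.linearIndependent_single_one (Fin n) (ZMod 2)).linearIndepOn _
  have hle : Submodule.span (ZMod 2) ((fun a : Fin n => (Pi.single a 1 : Fin n → ZMod 2)) ''
      ((Finset.univ.image L.idx : Finset (Fin n)) : Set (Fin n))) ≤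
      Submodule.span (ZMod 2) (W : Set (Fin n → ZMod 2)) := by
    rw [Submodule.span_le]
    rintro _ ⟨a, ha, rfl⟩
    obtain ⟨s, -, rfl⟩ := Finset.mem_image.1 (Finset.mem_coe.1 ha)
    have := hnat s.val
    rwa [ZMod.natCast_zmod_val] at this
  calc rn L = Module.finrank (ZMod 2) (Submodule.span (ZMod 2)
        ((fun a : Fin n => (Pi.single a 1 : Fin n → ZMod 2)) ''
          ((Finset.univ.image L.idx : Finset (Fin n)) : Set (Fin n)))) := by
        rw [Set.image_eq_range, rn]
        exact (Fintype.card_coe _).symm.trans (finrank_span_eq_card hli).symm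
    _ ≤ Module.finrank (ZMod 2) (Submodule.span (ZMod 2) (W : Set (Fin n → ZMod 2))) :=
        Submodule.finrank_mono hle
    _ ≤ W.card := finrank_span_finset_le_card W
    _ ≤ (T.image (stepBoundary L)).card + 1 := Finset.card_insert_le _ _
    _ ≤ T.card + 1 := by gcongr; exact Finset.card_image_le

lemma card_filter_mem_labelSupport (L : MultiLabeling h k n d) (s : ZMod h) :
    (Finset.univ.filter fun j => s ∈ labelSupport L j).card = k := by
  have : (Finset.univ.filter fun j => s ∈ labelSupport L j) = Finset.univ.image (L.lbl s) := by
    ext j; simp [mem_labelSupport]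
  rw [this, Finset.card_image_of_injective _ (L.lbl_inj s), Finset.card_univ, Fintype.card_fin]

lemma sum_card_labelSupport_inter (L : MultiLabeling h k n d) (X : Finset (ZMod h)) :
    ∑ j, (labelSupport L j ∩ X).card = k * X.card := by
  have := Finset.sum_card_bipartiteAbove_eq_sum_card_bipartiteBelow
    (s := (Finset.univ : Finset (Fin d))) (t := X) (fun j s => s ∈ labelSupport L j)
  simp only [Finset.bipartiteAbove, Finset.bipartiteBelow, card_filter_mem_labelSupport,
    Finset.sum_const, smul_eq_mul] at this
  rw [mul_comm, ← this]
  refine Finset.sum_congr rfl fun j _ => ?_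
  rw [Finset.inter_comm, Finset.filter_mem_eq_inter]

lemma rd_eq_card_filter (L : MultiLabeling h k n d) :
    rd L = (Finset.univ.filter fun j => (labelSupport L j).Nonempty).card := by
  rw [rd]
  congr 1
  ext j
  simp [Finset.Nonempty, mem_labelSupport]

lemma labelSupport_inter_compl_nonempty (L : MultiLabeling h k n d) {T : Finset (ZMod h)}
    (hT : LinearIndepOn (ZMod 2) (stepBoundary L) (T : Set (ZMod h))) {j : Fin d}
    (hj : (labelSupport L j).Nonempty) : (labelSupport L j ∩ Tᶜ).Nonempty := by
  by_contra hne
  have hsub : labelSupport L j ⊆ T := fun s hs => by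
    by_contra hsT
    exact hne ⟨s, by simp [hs, hsT]⟩
  have := hT.eq_of_sum_eq hsub (Finset.empty_subset T)
    (by rw [sum_stepBoundary_labelSupport, Finset.sum_empty])
  simp [this] at hj

lemma sum_stepBoundary_inter_of_inter_compl_eq_singleton (L : MultiLabeling h k n d)
    {T : Finset (ZMod h)} {j : Fin d} {s : ZMod h} (hs : labelSupport L j ∩ Tᶜ = {s}) :
    ∑ t ∈ labelSupport L j ∩ T, stepBoundary L t = -stepBoundary L s := by
  have h0 := sum_stepBoundary_labelSupport L j
  rw [← Finset.sum_inter_add_sum_sdiff (labelSupport L j) T, Finset.sdiff_eq_inter_compl, hs,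
    Finset.sum_singleton] at h0
  exact eq_neg_of_add_eq_zero_left h0

/-- At most `k` of the `d`-labels occurring on a given pair leave the spanning tree only once:
they all share a position of the tree. -/
lemma card_filter_inter_compl_eq_one_le (L : MultiLabeling h k n d) {T : Finset (ZMod h)}
    (hT : LinearIndepOn (ZMod 2) (stepBoundary L) (T : Set (ZMod h))) (a a' : Fin n) :
    (Finset.univ.filter fun j => (labelSupport L j ∩ Tᶜ).card = 1 ∧
      (labelSupport L j ∩ (Tᶜ ∩ pairSupport L a a')).Nonempty).card ≤ k := by
  set G := Finset.univ.filter fun j => (labelSupport L j ∩ Tᶜ).card = 1 ∧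
      (labelSupport L j ∩ (Tᶜ ∩ pairSupport L a a')).Nonempty with hG
  have hex : ∀ j ∈ G, ∃ s ∈ pairSupport L a a', labelSupport L j ∩ Tᶜ = {s} := by
    intro j hj
    obtain ⟨h1, s, hs⟩ := (Finset.mem_filter.1 hj).2
    obtain ⟨s', hs'⟩ := Finset.card_eq_one.1 h1
    simp only [Finset.mem_inter] at hs
    have : s ∈ labelSupport L j ∩ Tᶜ := Finset.mem_inter.2 ⟨hs.1, hs.2.1⟩
    rw [hs', Finset.mem_singleton] at this
    exact ⟨s, hs.2.2, this ▸ hs'⟩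
  rcases G.eq_empty_or_nonempty with h0 | ⟨j₀, hj₀⟩
  · simp [h0]
  obtain ⟨s₀, hs₀, hj₀s⟩ := hex j₀ hj₀
  have hsum₀ := sum_stepBoundary_inter_of_inter_compl_eq_singleton L hj₀s
  obtain ⟨t, ht⟩ : (labelSupport L j₀ ∩ T).Nonempty := by
    rw [Finset.nonempty_iff_ne_empty]
    intro h0
    rw [h0, Finset.sum_empty] at hsum₀
    exact stepBoundary_ne_zero L s₀ (neg_eq_zero.1 hsum₀.symm)
  rw [← card_filter_mem_labelSupport L t]
  refine Finset.card_le_card fun j hj => ?_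
  obtain ⟨s, hs, hjs⟩ := hex j hj
  have heq := hT.eq_of_sum_eq Finset.inter_subset_right Finset.inter_subset_right
    ((sum_stepBoundary_inter_of_inter_compl_eq_singleton L hjs).trans
      (by rw [hsum₀, stepBoundary_eq_of_mem_pairSupport L hs hs₀]))
  rw [← heq] at ht
  exact Finset.mem_filter.2 ⟨Finset.mem_univ _, (Finset.mem_inter.1 ht).1⟩

lemma pairCount_le_card_compl_inter_add_one (L : MultiLabeling h k n d) {T : Finset (ZMod h)}
    (hT : LinearIndepOn (ZMod 2) (stepBoundary L) (T : Set (ZMod h))) (a a' : Fin n) :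
    pairCount L a a' ≤ (Tᶜ ∩ pairSupport L a a').card + 1 := by
  have hone : (pairSupport L a a' ∩ T).card ≤ 1 := by
    refine Finset.card_le_one.2 fun s hs t ht => ?_
    rw [Finset.mem_inter] at hs ht
    exact hT.injOn hs.2 ht.2 (stepBoundary_eq_of_mem_pairSupport L hs.1 ht.1)
  have hsplit := Finset.card_inter_add_card_sdiff (pairSupport L a a') T
  rw [Finset.sdiff_eq_inter_compl, Finset.inter_comm _ Tᶜ] at hsplit
  have hdef : pairCount L a a' = (pairSupport L a a').card := rfl
  omega

/-- The occurrences on a pair of high multiplicity are mostly labels that leave the spanning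
tree at least twice. -/
lemma mul_pairCount_le (L : MultiLabeling h k n d) {T : Finset (ZMod h)}
    (hT : LinearIndepOn (ZMod 2) (stepBoundary L) (T : Set (ZMod h))) {a a' : Fin n}
    (hP : 2 < pairCount L a a') :
    k * pairCount L a a' ≤ 3 * ∑ j with 2 ≤ (labelSupport L j ∩ Tᶜ).card,
      (labelSupport L j ∩ (Tᶜ ∩ pairSupport L a a')).card := by
  have htot := sum_card_labelSupport_inter L (Tᶜ ∩ pairSupport L a a')
  rw [← Finset.sum_filter_add_sum_filter_not _
    (fun j => 2 ≤ (labelSupport L j ∩ Tᶜ).card)] at htot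
  have hgood : ∑ j with ¬ 2 ≤ (labelSupport L j ∩ Tᶜ).card,
      (labelSupport L j ∩ (Tᶜ ∩ pairSupport L a a')).card ≤ k := by
    refine le_trans ?_ (card_filter_inter_compl_eq_one_le L hT a a')
    rw [Finset.card_filter, Finset.sum_filter]
    refine Finset.sum_le_sum fun j _ => ?_
    have hle : (labelSupport L j ∩ (Tᶜ ∩ pairSupport L a a')).card ≤
        (labelSupport L j ∩ Tᶜ).card :=
      Finset.card_le_card (Finset.inter_subset_inter_left Finset.inter_subset_left)
    simp only [← Finset.card_pos]
    split_ifs <;> omega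
  have hcard := Nat.mul_le_mul_left k (pairCount_le_card_compl_inter_add_one L hT a a')
  have hk3 := Nat.mul_le_mul_left k hP
  rw [mul_add] at hcard
  simp only [Nat.succ_eq_add_one] at hk3
  omega

lemma sum_card_inter_pairSupport_le (L : MultiLabeling h k n d) (A : Finset (ZMod h)) :
    ∑ p : Fin n × Fin n with p.1 < p.2, (A ∩ pairSupport L p.1 p.2).card ≤ A.card := by
  rw [← Finset.card_biUnion]
  · exact Finset.card_le_card (Finset.biUnion_subset.2 fun _ _ => Finset.inter_subset_left)
  rintro ⟨a, a'⟩ hp ⟨b, b'⟩ hq hne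
  refine Finset.disjoint_left.2 fun s hs ht => ?_
  simp only [pairSupport, Finset.mem_inter, Finset.mem_filter, Finset.mem_univ, true_and,
    Finset.coe_filter, Set.mem_ofPred_eq] at hs ht hp hq
  have heq : ({a, a'} : Finset (Fin n)) = {b, b'} := hs.2.symm.trans ht.2
  have ha : a ∈ ({b, b'} : Finset (Fin n)) := heq ▸ by simp
  have ha' : a' ∈ ({b, b'} : Finset (Fin n)) := heq ▸ by simp
  simp only [Finset.mem_insert, Finset.mem_singleton] at ha ha'
  apply hne
  rcases ha with rfl | rfl <;> rcases ha' with rfl | rfl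
  · exact absurd hp (lt_irrefl _)
  · rfl
  · exact absurd hp hq.not_gt
  · exact absurd hp (lt_irrefl _)

lemma sum_card_labelSupport_inter_compl_le (L : MultiLabeling h k n d) {T : Finset (ZMod h)}
    (hT : LinearIndepOn (ZMod 2) (stepBoundary L) (T : Set (ZMod h)))
    (hr : rn L ≤ T.card + 1) :
    ((∑ j with 2 ≤ (labelSupport L j ∩ Tᶜ).card, (labelSupport L j ∩ Tᶜ).card : ℕ) : ℤ) ≤
      2 * Δlab L := by
  have htot := sum_card_labelSupport_inter L Tᶜ
  have hpt : ∑ j with 2 ≤ (labelSupport L j ∩ Tᶜ).card, (labelSupport L j ∩ Tᶜ).card +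
      2 * rd L ≤ 2 * ∑ j, (labelSupport L j ∩ Tᶜ).card := by
    rw [rd_eq_card_filter, Finset.card_filter, Finset.sum_filter, Finset.mul_sum, Finset.mul_sum,
      ← Finset.sum_add_distrib]
    refine Finset.sum_le_sum fun j _ => ?_
    have hpos : (labelSupport L j).Nonempty → 0 < (labelSupport L j ∩ Tᶜ).card := fun hj =>
      Finset.card_pos.2 (labelSupport_inter_compl_nonempty L hT hj)
    split_ifs with h1 h2 h2
    · omega
    · omega
    · have := hpos h2
      omega
    · omega
  have hcard := Finset.card_add_card_compl T
  rw [ZMod.card] at hcard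
  have hkr := Nat.mul_le_mul_left k hr
  have hkh := congrArg (k * ·) hcard
  simp only [mul_add, mul_one] at hkr hkh
  rw [Δlab, mul_add, mul_one]
  rw [htot] at hpt
  zify at hpt hkr hkh ⊢
  linarith

/-- The weight of pairs of multiplicity greater than two is at most `6 Δ / k`. -/
lemma mul_sum_pairCount_le (L : MultiLabeling h k n d) :
    ((k * ∑ p : Fin n × Fin n with p.1 < p.2,
      (if 2 < pairCount L p.1 p.2 then pairCount L p.1 p.2 else 0) : ℕ) : ℤ) ≤ 6 * Δlab L := by
  obtain ⟨T, hT, hr⟩ := exists_spanning_steps L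
  have hbad := sum_card_labelSupport_inter_compl_le L hT hr
  have hsum : k * ∑ p : Fin n × Fin n with p.1 < p.2,
      (if 2 < pairCount L p.1 p.2 then pairCount L p.1 p.2 else 0) ≤
      3 * ∑ j with 2 ≤ (labelSupport L j ∩ Tᶜ).card, (labelSupport L j ∩ Tᶜ).card := by
    calc _ ≤ ∑ p : Fin n × Fin n with p.1 < p.2,
          3 * ∑ j with 2 ≤ (labelSupport L j ∩ Tᶜ).card,
            (labelSupport L j ∩ (Tᶜ ∩ pairSupport L p.1 p.2)).card := by
          rw [Finset.mul_sum]
          refine Finset.sum_le_sum fun p _ => ?_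
          split_ifs with hP
          · exact mul_pairCount_le L hT hP
          · simp
      _ = 3 * ∑ j with 2 ≤ (labelSupport L j ∩ Tᶜ).card,
            ∑ p : Fin n × Fin n with p.1 < p.2,
              (labelSupport L j ∩ Tᶜ ∩ pairSupport L p.1 p.2).card := by
          rw [← Finset.mul_sum, Finset.sum_comm]
          simp only [Finset.inter_assoc]
      _ ≤ _ := by
          gcongr
          exact sum_card_inter_pairSupport_le L _
  have := (Nat.cast_le (α := ℤ)).2 hsum
  rw [Nat.cast_mul 3] at this
  push_cast at this hbad ⊢
  linarith

/-- For every `(n,d)`-multi-labeling of the `h`-graph,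
`∑_{a < a'} P_{a,a'} 1{P_{a,a'} > 2} ≤ 6 (6 + 1/k) Δ`. -/
theorem multiLabeling_consecutive_pair_bound
    (hh : 2 ≤ h) (hk : 1 ≤ k) (hn : 2 ≤ n) (hd : k ≤ d)
    (L : MultiLabeling h k n d) :
    (∑ a : Fin n, ∑ a' : Fin n,
        if a < a' then
          (if 2 < pairCount L a a' then (pairCount L a a' : ℝ) else 0)
        else 0) ≤
      6 * (6 + 1 / (k : ℝ)) * (Δlab L : ℝ) := by
  set S := ∑ p : Fin n × Fin n with p.1 < p.2,
    (if 2 < pairCount L p.1 p.2 then pairCount L p.1 p.2 else 0) with hS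
  have hlhs : (∑ a : Fin n, ∑ a' : Fin n,
      if a < a' then
        (if 2 < pairCount L a a' then (pairCount L a a' : ℝ) else 0)
      else 0) = (S : ℝ) := by
    rw [hS, Finset.sum_filter, Fintype.sum_prod_type]
    push_cast
    rfl
  have hkS : (k : ℝ) * S ≤ 6 * (Δlab L : ℝ) := by
    exact_mod_cast mul_sum_pairCount_le L
  have hk1 : (1 : ℝ) ≤ k := by exact_mod_cast hk
  have hS0 : (0 : ℝ) ≤ S := Nat.cast_nonneg S
  have hSle : (S : ℝ) ≤ 6 * (Δlab L : ℝ) := (le_mul_of_one_le_left hS0 hk1).trans hkS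
  have hinv : (0 : ℝ) ≤ 1 / (k : ℝ) := by positivity
  rw [hlhs]
  nlinarith [mul_nonneg hinv (hS0.trans hSle)]

end
end
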